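/- Let 𝒟 be a probability distribution on [0,1)^D × [0,1], let γ, η, N > 0, and let ℱ be the class of GridTD models f = g_Θ∘H_GridTD : [0,1)^D → [0,1] satisfying the assumptions of the GridTD Lipschitz bound with parameters γ, η, N (so that every f ∈ ℱ is Lipschitz with constant at most 2γηDN). Then with probability at least 1 − δ over an i.i.d. sample {(x₁,y₁),…,(x_n,y_n)} from 𝒟, every f ∈ ℱ satisfies 𝔼_{(x,y)∼𝒟}(f(x) − y)² − (1/n) Σ_{i=1}^{n} (f(x_i) − y_i)² ≤ 8γηDN/√n + 3√(log(2/δ)/(2n)). -/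

import Mathlib

open Finset MeasureTheory

/-- One-dimensional linear interpolation at resolution `Nl` over a 1D grid tensor. -/
noncomputable def interp1 (F Nl : ℕ) (G : ℕ → Fin F → ℝ) (x : ℝ) : Fin F → ℝ :=
  fun j =>
    (1 - Int.fract (((Nl : ℝ) - 1) * x)) * G (⌊((Nl : ℝ) - 1) * x⌋).toNat j +
      Int.fract (((Nl : ℝ) - 1) * x) * G ((⌊((Nl : ℝ) - 1) * x⌋).toNat + 1) j

/-- One-dimensional multi-resolution grid encoding `H_d : [0,1) → ℝ^{L×F}`. -/
noncomputable def enc1 (L F : ℕ) (N : Fin L → ℕ) (G : Fin L → ℕ → Fin F → ℝ) (x : ℝ) :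
    Fin L × Fin F → ℝ :=
  fun p => interp1 F (N p.1) (G p.1) x p.2

/-- Tensor decomposed multi-resolution grid encoding (GridTD). -/
noncomputable def gridTDEnc (D L F : ℕ) (N : Fin L → ℕ)
    (G : Fin L → Fin D → ℕ → Fin F → ℝ) (v : Fin D → ℝ) : Fin L × Fin F → ℝ :=
  fun p => ∏ d, enc1 L F N (fun l => G l d) (v d) p

/-- One-hidden-layer MLP `x ↦ W₂ σ(W₁ x + b)` with scalar output. -/
noncomputable def mlp {ι : Type} [Fintype ι] (n1 : ℕ) (σ : ℝ → ℝ)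
    (W1 : Fin n1 → ι → ℝ) (W2 : Fin n1 → ℝ) (bv : Fin n1 → ℝ) (x : ι → ℝ) : ℝ :=
  ∑ i, W2 i * σ ((∑ j, W1 i j * x j) + bv i)

/-- The class of GridTD models `f = g_Θ∘H_GridTD : [0,1)^D → [0,1]` satisfying the
assumptions of the GridTD Lipschitz bound with parameters `γ, η, Nsum`:
`σ` is `γ`-Lipschitz, `‖W₁‖₁‖W₂‖₁ ≤ η`, `Σ_l (N_l − 1) = Nsum`, grid feature vectors
have ℓ1 norm at most 1 (so every member is Lipschitz with constant `≤ 2γη D Nsum`). -/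
def gridTDClass (D : ℕ) (γ η : ℝ) (Nsum : ℕ) : Set ((Fin D → ℝ) → ℝ) :=
  {f | ∃ (L F n1 : ℕ) (N : Fin L → ℕ) (G : Fin L → Fin D → ℕ → Fin F → ℝ)
      (σ : ℝ → ℝ) (W1 : Fin n1 → Fin L × Fin F → ℝ) (W2 : Fin n1 → ℝ) (bv : Fin n1 → ℝ),
      1 ≤ L ∧ (∀ l, 2 ≤ N l) ∧ (∑ l, (N l - 1)) = Nsum ∧
      (∀ s t : ℝ, |σ s - σ t| ≤ γ * |s - t|) ∧
      (∑ i, ∑ j, |W1 i j|) * (∑ i, |W2 i|) ≤ η ∧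
      (∀ (l : Fin L) (d : Fin D) (z : ℕ), (∑ j, |G l d z j|) ≤ 1) ∧
      (∀ v, f v = mlp n1 σ W1 W2 bv (gridTDEnc D L F N G v)) ∧
      (∀ v : Fin D → ℝ, (∀ d, v d ∈ Set.Ico (0:ℝ) 1) → f v ∈ Set.Icc (0:ℝ) 1) ∧
      (∀ v w : Fin D → ℝ, (∀ d, v d ∈ Set.Ico (0:ℝ) 1) → (∀ d, w d ∈ Set.Ico (0:ℝ) 1) →
        |f v - f w| ≤ 2 * γ * η * D * Nsum * ∑ d, |v d - w d|)}

namespace GridTD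

/-- The sign `±1` encoded by a Boolean. -/
def sg (b : Bool) : ℝ := if b then 1 else -1

@[simp] lemma sg_true : sg true = 1 := rfl
@[simp] lemma sg_false : sg false = -1 := rfl
@[simp] lemma sg_not (b : Bool) : sg (!b) = -sg b := by cases b <;> simp
@[simp] lemma abs_sg (b : Bool) : |sg b| = 1 := by cases b <;> simp

/-- The average of a function over a finite type. -/
noncomputable def uavg {Θ : Type*} [Fintype Θ] (F : Θ → ℝ) : ℝ := (∑ θ, F θ) / Fintype.card Θ

section uavg
variable {Θ Θ' : Type*} [Fintype Θ] [Fintype Θ']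

lemma uavg_mono {F G : Θ → ℝ} (h : ∀ θ, F θ ≤ G θ) : uavg F ≤ uavg G := by
  unfold uavg
  gcongr with θ
  exact h θ

lemma uavg_add (F G : Θ → ℝ) : uavg (fun θ => F θ + G θ) = uavg F + uavg G := by
  simp [uavg, sum_add_distrib, add_div]

lemma uavg_sub (F G : Θ → ℝ) : uavg (fun θ => F θ - G θ) = uavg F - uavg G := by
  simp [uavg, sum_sub_distrib, sub_div]

lemma uavg_mul_left (c : ℝ) (F : Θ → ℝ) : uavg (fun θ => c * F θ) = c * uavg F := by
  simp [uavg, ← mul_sum, mul_div_assoc]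

lemma uavg_sum {ι : Type*} (s : Finset ι) (F : ι → Θ → ℝ) :
    uavg (fun θ => ∑ i ∈ s, F i θ) = ∑ i ∈ s, uavg (F i) := by
  unfold uavg
  rw [sum_comm, sum_div]

lemma uavg_const [Nonempty Θ] (c : ℝ) : uavg (fun _ : Θ => c) = c := by
  simp [uavg]

lemma uavg_equiv (e : Θ ≃ Θ') (F : Θ' → ℝ) : uavg (fun θ => F (e θ)) = uavg F := by
  unfold uavg
  rw [Fintype.card_congr e, Equiv.sum_comp e F]

lemma uavg_prod (F : Θ × Θ' → ℝ) : uavg F = uavg (fun a => uavg (fun b => F (a, b))) := by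
  unfold uavg
  rw [Fintype.sum_prod_type, Fintype.card_prod, ← sum_div, div_div, Nat.cast_mul, mul_comm]

lemma uavg_comm (F : Θ → Θ' → ℝ) :
    uavg (fun a => uavg (fun b => F a b)) = uavg (fun b => uavg (fun a => F a b)) := by
  unfold uavg
  simp only [← sum_div]
  rw [sum_comm, div_div, div_div, mul_comm]

lemma uavg_bool (F : Bool → ℝ) : uavg F = (F true + F false) / 2 := by
  simp [uavg]

lemma uavg_cons (n : ℕ) (F : (Fin (n + 1) → Θ) → ℝ) :
    uavg F = uavg (fun a => uavg (fun t : Fin n → Θ => F (Fin.cons a t))) := by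
  rw [← uavg_equiv (Fin.consEquiv (fun _ : Fin (n + 1) => Θ)) F, uavg_prod]
  rfl

lemma uavg_zero_fun (F : (Fin 0 → Θ) → ℝ) : uavg F = F (fun i => i.elim0) := by
  simp [uavg, Subsingleton.elim (default : Fin 0 → Θ) (fun i => i.elim0)]

lemma uavg_prod_fun {ι : Type*} [Fintype ι] [DecidableEq ι] (F : ι → Θ → ℝ) :
    uavg (fun θ : ι → Θ => ∏ i, F i (θ i)) = ∏ i, uavg (F i) := by
  unfold uavg
  rw [prod_div_distrib, Finset.prod_univ_sum, Fintype.piFinset_univ]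
  simp

lemma uavg_eval {ι : Type*} [Fintype ι] [DecidableEq ι] [Nonempty Θ] (i : ι) (F : Θ → ℝ) :
    uavg (fun θ : ι → Θ => F (θ i)) = uavg F := by
  have := uavg_prod_fun (fun (k : ι) (t : Θ) => if k = i then F t else 1)
  simp only [prod_ite_eq', mem_univ, if_true] at this
  rw [this, Finset.prod_eq_single i]
  · simp
  · intro k _ hk
    simp [hk, uavg_const]
  · simp

lemma uavg_exp_sg (x : ℝ) : uavg (fun b => Real.exp (sg b * x)) ≤ Real.exp (x ^ 2 / 2) := by
  rw [uavg_bool]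
  have := Real.cosh_le_exp_half_sq x
  rw [Real.cosh_eq] at this
  simpa using this

/-- Sub-Gaussian bound for a sum of independent functions over a uniform product space. -/
lemma uavg_exp_sum_le {ι : Type*} [Fintype ι] [DecidableEq ι] (s : Θ → Bool)
    (hs : ∀ x : ℝ, uavg (fun θ => Real.exp (sg (s θ) * x)) ≤ Real.exp (x ^ 2 / 2)) (v : ι → ℝ) :
    uavg (fun θ : ι → Θ => Real.exp (∑ i, sg (s (θ i)) * v i)) ≤
      Real.exp ((∑ i, v i ^ 2) / 2) := by
  simp_rw [Real.exp_sum]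
  rw [uavg_prod_fun (fun i t => Real.exp (sg (s t) * v i)), sum_div, Real.exp_sum]
  refine prod_le_prod (fun i _ => ?_) (fun i _ => hs _)
  unfold uavg
  positivity

end uavg

section induction
variable {J Θ : Type*} [Fintype Θ] [Nonempty Θ]

/-- Replacing random signs one coordinate at a time. -/
lemma uavg_replace (Φ : (J → ℝ) → ℝ) (τ : ℝ) :
    ∀ (n : ℕ) (p : Fin n → J → ℝ) (r : Fin n → Θ → J → ℝ)
      (_ : ∀ i (A : J → ℝ), uavg (fun b => Φ (fun j => A j + sg b * p i j)) ≤
        uavg (fun θ => Φ (fun j => A j + r i θ j)) + τ) (A : J → ℝ),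
      uavg (fun ε : Fin n → Bool => Φ (fun j => A j + ∑ i, sg (ε i) * p i j)) ≤
        uavg (fun θ : Fin n → Θ => Φ (fun j => A j + ∑ i, r i (θ i) j)) + n * τ := by
  intro n
  induction n with
  | zero =>
    intro p r h A
    rw [uavg_zero_fun, uavg_zero_fun]
    simp
  | succ n ih =>
    intro p r h A
    rw [uavg_cons, uavg_cons]
    simp only [Fin.sum_univ_succ, Fin.cons_zero, Fin.cons_succ, ← add_assoc]
    have h1 : ∀ b, uavg (fun t : Fin n → Bool => Φ (fun j => A j + sg b * p 0 j +
        ∑ i : Fin n, sg (t i) * p i.succ j)) ≤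
        uavg (fun t : Fin n → Θ => Φ (fun j => A j + sg b * p 0 j + ∑ i : Fin n, r i.succ (t i) j))
          + n * τ := fun b =>
      ih (fun i => p i.succ) (fun i => r i.succ) (fun i => h i.succ) (fun j => A j + sg b * p 0 j)
    refine (uavg_mono h1).trans ?_
    rw [uavg_add, uavg_const]
    have h2 : uavg (fun b => uavg (fun t : Fin n → Θ =>
          Φ (fun j => A j + sg b * p 0 j + ∑ i : Fin n, r i.succ (t i) j))) ≤
        uavg (fun a => uavg (fun t : Fin n → Θ =>
          Φ (fun j => A j + r 0 a j + ∑ i : Fin n, r i.succ (t i) j))) + τ := by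
      rw [uavg_comm, uavg_comm (fun a (t : Fin n → Θ) =>
          Φ (fun j => A j + r 0 a j + ∑ i : Fin n, r i.succ (t i) j)),
        ← uavg_const (Θ := Fin n → Θ) τ, ← uavg_add]
      refine uavg_mono (fun t => ?_)
      have := h 0 (fun j => A j + ∑ i : Fin n, r i.succ (t i) j)
      simpa only [add_right_comm] using this
    push_cast
    linarith

end induction

/-- The maximum of a real function over a finite nonempty type. -/
noncomputable def fmax {J : Type*} [Fintype J] [Nonempty J] (F : J → ℝ) : ℝ :=
  univ.sup' univ_nonempty F

section fmax
variable {J : Type*} [Fintype J] [Nonempty J]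

lemma le_fmax (F : J → ℝ) (j : J) : F j ≤ fmax F := le_sup' F (mem_univ j)

lemma fmax_le {F : J → ℝ} {c : ℝ} (h : ∀ j, F j ≤ c) : fmax F ≤ c := sup'_le _ _ (fun j _ => h j)

lemma exists_fmax (F : J → ℝ) : ∃ j, fmax F = F j := by
  obtain ⟨j, _, hj⟩ := exists_mem_eq_sup' (univ_nonempty (α := J)) F
  exact ⟨j, hj⟩

lemma abs_fmax_sub_le {F G : J → ℝ} {c : ℝ} (h : ∀ j, |F j - G j| ≤ c) :
    |fmax F - fmax G| ≤ c := by
  rw [abs_sub_le_iff]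
  constructor
  · obtain ⟨j, hj⟩ := exists_fmax F
    linarith [le_fmax G j, (abs_sub_le_iff.1 (h j)).1]
  · obtain ⟨j, hj⟩ := exists_fmax G
    linarith [le_fmax F j, (abs_sub_le_iff.1 (h j)).2]

lemma fmax_add_le (F G : J → ℝ) : fmax (fun j => F j + G j) ≤ fmax F + fmax G :=
  fmax_le (fun j => add_le_add (le_fmax F j) (le_fmax G j))

lemma fmax_mul_left {c : ℝ} (hc : 0 ≤ c) (F : J → ℝ) : fmax (fun j => c * F j) = c * fmax F := by
  apply le_antisymm
  · exact fmax_le fun j => mul_le_mul_of_nonneg_left (le_fmax F j) hc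
  · obtain ⟨j, hj⟩ := exists_fmax F
    rw [hj]
    exact le_fmax (fun j => c * F j) j

lemma measurable_fmax {Ω : Type*} [MeasurableSpace Ω] {F : J → Ω → ℝ}
    (h : ∀ j, Measurable (F j)) : Measurable fun ω => fmax fun j => F j ω := by
  have : (fun ω => fmax fun j => F j ω) = univ.sup' univ_nonempty F := by
    ext ω
    simp [fmax, Finset.sup'_apply]
  rw [this]
  exact Finset.measurable_sup' _ (fun j _ => h j)

/-- Averaging over one sign reduces a maximum to pairs of indices. -/
lemma uavg_bool_fmax_le {A p : J → ℝ} {c : ℝ}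
    (h : ∀ j k, (A j + A k + (p j - p k)) / 2 ≤ c) :
    uavg (fun b => fmax (fun j => A j + sg b * p j)) ≤ c := by
  rw [uavg_bool]
  obtain ⟨j, hj⟩ := exists_fmax (fun j => A j + sg true * p j)
  obtain ⟨k, hk⟩ := exists_fmax (fun j => A j + sg false * p j)
  rw [hj, hk]
  have := h j k
  simp only [sg_true, sg_false]
  linarith

/-- Contraction principle for Rademacher averages. -/
lemma uavg_contraction {n : ℕ} (p a : Fin n → J → ℝ)
    (h : ∀ i j k, |p i j - p i k| ≤ |a i j - a i k|) :
    uavg (fun ε : Fin n → Bool => fmax (fun j => ∑ i, sg (ε i) * p i j)) ≤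
      uavg (fun ε : Fin n → Bool => fmax (fun j => ∑ i, sg (ε i) * a i j)) := by
  have := uavg_replace (Θ := Bool) (J := J) fmax 0 n p (fun i b j => sg b * a i j) ?_ 0
  · simpa using this
  intro i A
  rw [add_zero]
  refine uavg_bool_fmax_le fun j k => ?_
  rw [uavg_bool]
  have h1 := le_fmax (fun j => A j + sg true * a i j) j
  have h2 := le_fmax (fun j => A j + sg false * a i j) k
  have h3 := le_fmax (fun j => A j + sg true * a i j) k
  have h4 := le_fmax (fun j => A j + sg false * a i j) j
  have h5 := (le_abs_self _).trans (h i j k)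
  simp only [sg_true, sg_false] at *
  rcases abs_cases (a i j - a i k) with h6 | h6 <;> linarith

/-- Bounded differences inequality for functions of random signs. -/
lemma uavg_exp_boundedDiff (c l : ℝ) :
    ∀ (n : ℕ) (Y : (Fin n → Bool) → ℝ)
      (_ : ∀ (ε : Fin n → Bool) i b, |Y ε - Y (Function.update ε i b)| ≤ 2 * c),
      uavg (fun ε => Real.exp (l * Y ε)) ≤ Real.exp (l * uavg Y + n * (l * c) ^ 2 / 2) := by
  intro n
  induction n with
  | zero =>
    intro Y h
    simp [uavg_zero_fun]
  | succ n ih =>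
    intro Y h
    rw [uavg_cons]
    have h1 : ∀ b, uavg (fun t : Fin n → Bool => Real.exp (l * Y (Fin.cons b t))) ≤
        Real.exp (l * uavg (fun t : Fin n → Bool => Y (Fin.cons b t)) + n * (l * c) ^ 2 / 2) := by
      intro b
      refine ih (fun t => Y (Fin.cons b t)) fun ε i b' => ?_
      have := h (Fin.cons b ε) i.succ b'
      rwa [← Fin.cons_update] at this
    refine (uavg_mono h1).trans ?_
    set g : Bool → ℝ := fun b => uavg (fun t : Fin n → Bool => Y (Fin.cons b t)) with hg
    have h2 : |g true - g false| ≤ 2 * c := by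
      have key : ∀ b b', g b - g b' ≤ 2 * c := by
        intro b b'
        rw [hg]
        simp only
        rw [← uavg_sub, ← uavg_const (Θ := Fin n → Bool) (2 * c)]
        refine uavg_mono fun t => ?_
        have := h (Fin.cons b t) 0 b'
        rw [Fin.update_cons_zero] at this
        exact (le_abs_self _).trans this
      rw [abs_sub_le_iff]
      exact ⟨key _ _, key _ _⟩
    have h3 : uavg Y = (g true + g false) / 2 := by rw [uavg_cons, uavg_bool]
    rw [h3]
    set m := (g true + g false) / 2
    set x := (g true - g false) / 2 with hx
    have h4 : ∀ b, Real.exp (l * g b + n * (l * c) ^ 2 / 2) =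
        Real.exp (l * m + n * (l * c) ^ 2 / 2) * Real.exp (sg b * (l * x)) := by
      intro b
      rw [← Real.exp_add]
      congr 1
      cases b <;> simp [m, x] <;> ring
    change uavg (fun b => Real.exp (l * g b + n * (l * c) ^ 2 / 2)) ≤ _
    simp_rw [h4]
    rw [uavg_mul_left]
    have h5 : |x| ≤ c := by rw [hx, abs_div, abs_two]; linarith
    have h6 : (l * x) ^ 2 ≤ (l * c) ^ 2 := by
      rw [mul_pow, mul_pow]
      have := sq_le_sq' (abs_le.1 h5).1 (abs_le.1 h5).2
      gcongr
    calc _ ≤ Real.exp (l * m + n * (l * c) ^ 2 / 2) * Real.exp ((l * x) ^ 2 / 2) := by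
          gcongr; exact uavg_exp_sg _
      _ ≤ _ := by
        rw [← Real.exp_add]
        apply Real.exp_le_exp.2
        push_cast
        linarith

end fmax

end GridTD

namespace GridTD

/-- The uniform probability measure on a finite type. -/
noncomputable def unif (Θ : Type*) [Fintype Θ] [MeasurableSpace Θ] : Measure Θ :=
  (Fintype.card Θ : ENNReal)⁻¹ • Measure.count

section unif
variable {Θ : Type*} [Fintype Θ] [MeasurableSpace Θ] [MeasurableSingletonClass Θ]

instance [Nonempty Θ] : IsProbabilityMeasure (unif Θ) := by
  constructor
  rw [unif, Measure.smul_apply, Measure.count_univ]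
  simp only [ENat.card_eq_coe_fintype_card, smul_eq_mul]
  exact ENNReal.inv_mul_cancel (by simp) (by simp)

lemma integral_unif (F : Θ → ℝ) : ∫ θ, F θ ∂unif Θ = uavg F := by
  rw [unif, integral_smul_measure, uavg, integral_countable (by simp)]
  simp [Measure.real, div_eq_inv_mul]

end unif

variable {Ω : Type*} [MeasurableSpace Ω] {P : Measure Ω} {J J' : Type*}

/-- The family `h` is dominated by a single random variable of expectation at most `c`. -/
def Dom (P : Measure Ω) (h : J → Ω → ℝ) (c : ℝ) : Prop :=
  ∃ Y : Ω → ℝ, Integrable Y P ∧ (∀ j ω, h j ω ≤ Y ω) ∧ ∫ ω, Y ω ∂P ≤ c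

lemma Dom.mono {h : J → Ω → ℝ} {h' : J' → Ω → ℝ} {c c' : ℝ} (H : Dom P h c)
    (hh : ∀ j', ∃ j, ∀ ω, h' j' ω ≤ h j ω) (hc : c ≤ c') : Dom P h' c' := by
  obtain ⟨Y, hY, h1, h2⟩ := H
  refine ⟨Y, hY, fun j' ω => ?_, h2.trans hc⟩
  obtain ⟨j, hj⟩ := hh j'
  exact (hj ω).trans (h1 j ω)

lemma Dom.mono_const {h : J → Ω → ℝ} {c c' : ℝ} (H : Dom P h c) (hc : c ≤ c') : Dom P h c' :=
  H.mono (fun j => ⟨j, fun _ => le_rfl⟩) hc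

lemma Dom.add {h h' : J → Ω → ℝ} {c c' : ℝ} (H : Dom P h c) (H' : Dom P h' c') :
    Dom P (fun j ω => h j ω + h' j ω) (c + c') := by
  obtain ⟨Y, hY, h1, h2⟩ := H
  obtain ⟨Y', hY', h1', h2'⟩ := H'
  refine ⟨fun ω => Y ω + Y' ω, hY.add hY', fun j ω => add_le_add (h1 j ω) (h1' j ω), ?_⟩
  rw [integral_add hY hY']
  exact add_le_add h2 h2'

lemma dom_const [IsProbabilityMeasure P] {h : J → Ω → ℝ} {c : ℝ} (H : ∀ j ω, h j ω ≤ c) :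
    Dom P h c :=
  ⟨fun _ => c, integrable_const c, H, by simp⟩

lemma Dom.smul {h : J → Ω → ℝ} {c a : ℝ} (ha : 0 ≤ a) (H : Dom P h c) :
    Dom P (fun j ω => a * h j ω) (a * c) := by
  obtain ⟨Y, hY, h1, h2⟩ := H
  refine ⟨fun ω => a * Y ω, hY.const_mul a, fun j ω => mul_le_mul_of_nonneg_left (h1 j ω) ha, ?_⟩
  rw [integral_const_mul]
  exact mul_le_mul_of_nonneg_left h2 ha

lemma dom_sum [IsProbabilityMeasure P] (K : ℕ) (h : ℕ → J → Ω → ℝ) (c : ℕ → ℝ)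
    (H : ∀ k < K, Dom P (h k) (c k)) :
    Dom P (fun j ω => ∑ k ∈ range K, h k j ω) (∑ k ∈ range K, c k) := by
  induction K with
  | zero => exact dom_const (fun j ω => by simp)
  | succ K ih =>
    have := (ih fun k hk => H k (hk.trans K.lt_succ_self)).add (H K K.lt_succ_self)
    simpa only [sum_range_succ] using this

/-- Nonnegative combinations of total weight at most `κ`. -/
lemma Dom.hull {h : J → Ω → ℝ} {c κ : ℝ} (H : Dom P h c) (j₀ : J) (h₀ : ∀ ω, h j₀ ω = 0)
    (hκ : 0 ≤ κ) {h' : J' → Ω → ℝ}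
    (hh : ∀ j', ∃ (m : ℕ) (a : Fin m → ℝ) (s : Fin m → J), (∀ i, 0 ≤ a i) ∧ ∑ i, a i ≤ κ ∧
      ∀ ω, h' j' ω ≤ ∑ i, a i * h (s i) ω) : Dom P h' (κ * c) := by
  obtain ⟨Y, hY, h1, h2⟩ := H
  refine ⟨fun ω => κ * Y ω, hY.const_mul κ, fun j' ω => ?_, ?_⟩
  · obtain ⟨m, a, s, ha, hs, hle⟩ := hh j'
    have hY0 : 0 ≤ Y ω := (h₀ ω).symm.le.trans (h1 j₀ ω)
    calc h' j' ω ≤ ∑ i, a i * h (s i) ω := hle ω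
      _ ≤ ∑ i, a i * Y ω := sum_le_sum fun i _ => mul_le_mul_of_nonneg_left (h1 _ _) (ha i)
      _ = (∑ i, a i) * Y ω := by rw [sum_mul]
      _ ≤ κ * Y ω := mul_le_mul_of_nonneg_right hs hY0
  · rw [integral_const_mul]
    exact mul_le_mul_of_nonneg_left h2 hκ

/-- A bound on exponential moments yields a bound on expected maxima. -/
lemma dom_of_exp [IsProbabilityMeasure P] {h : J → Ω → ℝ} {l m : ℝ} (hl : 0 < l) (hm : 0 < m)
    (S : Ω → ℝ) (hS : Integrable S P) (hS' : ∫ ω, S ω ∂P ≤ m)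
    (hle : ∀ j ω, Real.exp (l * h j ω) ≤ S ω) : Dom P h (Real.log m / l) := by
  refine ⟨fun ω => (Real.log m + S ω / m - 1) / l, ?_, fun j ω => ?_, ?_⟩
  · exact (((integrable_const _).add (hS.div_const m)).sub (integrable_const _)).div_const l
  · rw [le_div_iff₀ hl, mul_comm]
    have hSpos : 0 < S ω := (Real.exp_pos _).trans_le (hle j ω)
    have h1 : l * h j ω ≤ Real.log (S ω) := (Real.le_log_iff_exp_le hSpos).2 (hle j ω)
    have h2 := Real.log_le_sub_one_of_pos (div_pos hSpos hm)
    rw [Real.log_div hSpos.ne' hm.ne'] at h2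
    linarith
  · rw [integral_div]
    gcongr
    have e : (fun ω => Real.log m + S ω / m - 1) = fun ω => (Real.log m - 1) + S ω / m := by
      ext; ring
    rw [e, integral_add (integrable_const _) (hS.div_const m), integral_div]
    simp only [integral_const, probReal_univ, smul_eq_mul, one_mul]
    have : (∫ ω, S ω ∂P) / m ≤ 1 := (div_le_one hm).2 hS'
    linarith

/-- Expected maximum of a family with `exp (H + l² σ² / 2)` exponential moment bounds. -/
lemma dom_of_subgaussian [IsProbabilityMeasure P] {h : J → Ω → ℝ} {H σ : ℝ} (hH : 0 < H)
    (hσ : 0 < σ)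
    (hS : ∀ l : ℝ, 0 < l → ∃ S : Ω → ℝ, Integrable S P ∧
      ∫ ω, S ω ∂P ≤ Real.exp (H + (l * σ) ^ 2 / 2) ∧ ∀ j ω, Real.exp (l * h j ω) ≤ S ω) :
    Dom P h (σ * Real.sqrt (2 * H)) := by
  have hq : 0 < Real.sqrt (2 * H) := Real.sqrt_pos.2 (by linarith)
  have hl : 0 < Real.sqrt (2 * H) / σ := div_pos hq hσ
  obtain ⟨S, h1, h2, h3⟩ := hS _ hl
  have := dom_of_exp hl (Real.exp_pos _) S h1 h2 h3
  convert this using 1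
  rw [Real.log_exp, div_mul_cancel₀ _ hσ.ne', Real.sq_sqrt (by linarith)]
  have : Real.sqrt (2 * H) * Real.sqrt (2 * H) = 2 * H := Real.mul_self_sqrt (by linarith)
  field_simp
  rw [sq, this]
  ring

lemma uavg_fmax_le_of_dom {Θ : Type*} [Fintype Θ] [MeasurableSpace Θ] [MeasurableSingletonClass Θ]
    [Nonempty Θ] [Fintype J] [Nonempty J] {h : J → Θ → ℝ} {c : ℝ} (H : Dom (unif Θ) h c) :
    uavg (fun θ => fmax fun j => h j θ) ≤ c := by
  obtain ⟨Y, _, h1, h2⟩ := H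
  rw [integral_unif] at h2
  exact (uavg_mono fun θ => fmax_le fun j => h1 j θ).trans h2

lemma dom_of_uavg_fmax_le {Θ : Type*} [Fintype Θ] [MeasurableSpace Θ] [MeasurableSingletonClass Θ]
    [Nonempty Θ] [Fintype J] [Nonempty J] {h : J → Θ → ℝ} {c : ℝ}
    (H : uavg (fun θ => fmax fun j => h j θ) ≤ c) : Dom (unif Θ) h c :=
  ⟨fun θ => fmax fun j => h j θ, Integrable.of_finite, fun j θ => le_fmax (fun j => h j θ) j, by
    rwa [integral_unif]⟩

end GridTD

namespace GridTD

variable {Ω X : Type*} [MeasurableSpace Ω] [MeasurableSpace X] {P : Measure Ω}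

/-- Bounded measurable real functions. -/
def BM (h : X → ℝ) : Prop := Measurable h ∧ ∃ c, ∀ x, |h x| ≤ c

lemma BM.add {h g : X → ℝ} (hh : BM h) (hg : BM g) : BM (fun x => h x + g x) := by
  obtain ⟨h1, c, hc⟩ := hh
  obtain ⟨g1, d, hd⟩ := hg
  exact ⟨h1.add g1, c + d, fun x => (abs_add_le _ _).trans (add_le_add (hc x) (hd x))⟩

lemma BM.const (c : ℝ) : BM (fun _ : X => c) := ⟨measurable_const, |c|, fun _ => le_rfl⟩

lemma BM.smul {h : X → ℝ} (hh : BM h) (a : ℝ) : BM (fun x => a * h x) := by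
  obtain ⟨h1, c, hc⟩ := hh
  exact ⟨h1.const_mul a, |a| * c, fun x => by
    rw [abs_mul]; exact mul_le_mul_of_nonneg_left (hc x) (abs_nonneg a)⟩

lemma BM.sum {ι : Type*} (s : Finset ι) {h : ι → X → ℝ} (hh : ∀ i ∈ s, BM (h i)) :
    BM (fun x => ∑ i ∈ s, h i x) := by
  classical
  induction s using Finset.induction_on with
  | empty => simpa using BM.const (X := X) 0
  | insert a s ha ih =>
    simp only [sum_insert ha]
    exact (hh a (mem_insert_self a s)).add (ih fun i hi => hh i (mem_insert_of_mem hi))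

/-- `1`-Lipschitz real functions. -/
def Lip1 (φ : ℝ → ℝ) : Prop := ∀ s t, |φ s - φ t| ≤ |s - t|

lemma Lip1.continuous {φ : ℝ → ℝ} (hφ : Lip1 φ) : Continuous φ := by
  refine (LipschitzWith.of_dist_le_mul (K := 1) fun s t => ?_).continuous
  simpa [Real.dist_eq] using hφ s t

lemma BM.comp {φ : ℝ → ℝ} (hφ : Lip1 φ) {h : X → ℝ} (hh : BM h) : BM (fun x => φ (h x)) := by
  obtain ⟨h1, c, hc⟩ := hh
  refine ⟨hφ.continuous.measurable.comp h1, |φ 0| + c, fun x => ?_⟩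
  have h2 := hφ (h x) 0
  rw [sub_zero] at h2
  linarith [abs_sub_abs_le_abs_sub (φ (h x)) (φ 0), hc x]

/-- A linear process on bounded measurable functions that is sub-Gaussian with respect to the
uniform norm. -/
structure SubG (P : Measure Ω) (Z : (X → ℝ) → Ω → ℝ) (C : ℝ) : Prop where
  add : ∀ {h g : X → ℝ}, BM h → BM g → ∀ ω, Z (fun x => h x + g x) ω = Z h ω + Z g ω
  smul : ∀ {h : X → ℝ}, BM h → ∀ (a : ℝ) ω, Z (fun x => a * h x) ω = a * Z h ω
  meas : ∀ {h : X → ℝ}, BM h → Measurable (Z h)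
  nonneg : 0 ≤ C
  bound : ∀ {h : X → ℝ} {c : ℝ}, Measurable h → (∀ x, |h x| ≤ c) → ∀ ω, |Z h ω| ≤ C * c
  mgf : ∀ {h : X → ℝ} {c : ℝ}, Measurable h → (∀ x, |h x| ≤ c) → ∀ l : ℝ,
    ∫ ω, Real.exp (l * Z h ω) ∂P ≤ Real.exp ((l * c) ^ 2 / 2)

namespace SubG
variable {Z : (X → ℝ) → Ω → ℝ} {C : ℝ}

lemma zero (hZ : SubG P Z C) (ω : Ω) : Z (fun _ => 0) ω = 0 := by
  have := hZ.smul (BM.const (X := X) 0) 0 ω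
  simpa using this

lemma sub (hZ : SubG P Z C) {h g : X → ℝ} (hh : BM h) (hg : BM g) (ω : Ω) :
    Z (fun x => h x - g x) ω = Z h ω - Z g ω := by
  have := hZ.add hh (hg.smul (-1)) ω
  rw [hZ.smul hg] at this
  simpa [sub_eq_add_neg] using this

lemma sum (hZ : SubG P Z C) {ι : Type*} (s : Finset ι) (a : ι → ℝ) {h : ι → X → ℝ}
    (hh : ∀ i ∈ s, BM (h i)) (ω : Ω) :
    Z (fun x => ∑ i ∈ s, a i * h i x) ω = ∑ i ∈ s, a i * Z (h i) ω := by
  classical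
  induction s using Finset.induction_on with
  | empty => simpa using hZ.zero ω
  | insert b s hb ih =>
    simp only [sum_insert hb]
    have h1 : ∀ i ∈ s, BM (h i) := fun i hi => hh i (mem_insert_of_mem hi)
    rw [hZ.add ((hh b (mem_insert_self b s)).smul _) (BM.sum s fun i hi => (h1 i hi).smul _),
      hZ.smul (hh b (mem_insert_self b s)), ih h1]

lemma integrable_exp (hZ : SubG P Z C) [IsFiniteMeasure P] {h : X → ℝ} (hh : BM h) (l : ℝ) :
    Integrable (fun ω => Real.exp (l * Z h ω)) P := by
  obtain ⟨h1, c, hc⟩ := id hh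
  refine Integrable.of_bound ((Real.measurable_exp.comp
    ((hZ.meas hh).const_mul l)).aestronglyMeasurable) (Real.exp (|l| * (C * c)))
    (Filter.Eventually.of_forall fun ω => ?_)
  rw [Real.norm_eq_abs, Real.abs_exp, Real.exp_le_exp]
  calc l * Z h ω ≤ |l * Z h ω| := le_abs_self _
    _ = |l| * |Z h ω| := abs_mul _ _
    _ ≤ _ := mul_le_mul_of_nonneg_left (hZ.bound h1 hc ω) (abs_nonneg l)

end SubG

lemma sum_range_mul_eq (a : ℕ → ℝ) (q K : ℕ) :
    ∑ i ∈ range (q * K), a i = ∑ r ∈ range q, ∑ m : Fin K, a (r + q * m) := by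
  induction K with
  | zero => simp
  | succ K ih =>
    rw [Nat.mul_succ, sum_range_add, ih, ← sum_add_distrib]
    refine sum_congr rfl fun r _ => ?_
    rw [Fin.sum_univ_castSucc]
    simp [add_comm]

/-- Discrete integration of a function on an integer interval. -/
lemma eq_add_sum_increments (g : ℤ → ℝ) (lo v : ℤ) (M : ℕ) (h1 : lo ≤ v) (h2 : v ≤ lo + M) :
    g v = g lo + ∑ i ∈ range M, (g (lo + i + 1) - g (lo + i)) * (if lo + i < v then 1 else 0) := by
  obtain ⟨k, rfl⟩ := Int.exists_add_of_le h1
  have hk : k ≤ M := by omega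
  have h3 : ∑ i ∈ range M, (g (lo + i + 1) - g (lo + i)) *
      (if lo + (i : ℤ) < lo + k then (1 : ℝ) else 0) =
      ∑ i ∈ range k, (g (lo + (i + 1 : ℕ)) - g (lo + i)) := by
    rw [← sum_subset (range_subset_range.2 hk)]
    · refine sum_congr rfl fun i hi => ?_
      rw [if_pos (by have := mem_range.1 hi; omega)]
      push_cast
      rw [mul_one, add_assoc]
    · intro i _ hi
      rw [if_neg (by have := mem_range.not.1 hi; omega), mul_zero]
  rw [h3, sum_range_sub (fun i : ℕ => g (lo + i))]
  simp

lemma exp_sum_abs_le {K : ℕ} (z : Fin K → ℝ) (l : ℝ) :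
    Real.exp (l * ∑ m, |z m|) ≤ ∑ b : Fin K → Bool, Real.exp (l * ∑ m, sg (b m) * z m) := by
  have h := single_le_sum (f := fun b : Fin K → Bool => Real.exp (l * ∑ m, sg (b m) * z m))
    (fun _ _ => (Real.exp_pos _).le) (mem_univ (fun m => decide (0 ≤ z m)))
  refine le_trans (le_of_eq ?_) h
  congr 2
  refine sum_congr rfl fun m _ => ?_
  by_cases hz : 0 ≤ z m
  · simp [hz, abs_of_nonneg hz]
  · simp [hz, abs_of_neg (not_le.1 hz)]

/-- Exponential moment bound for the increments of `Z (φ ∘ ·)` between two lattice valued functions,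
uniformly over all `1`-Lipschitz `φ`. -/
lemma SubG.link {Z : (X → ℝ) → Ω → ℝ} {C : ℝ} [IsProbabilityMeasure P] (hZ : SubG P Z C)
    {u u' : X → ℤ} (hu : Measurable u) (hu' : Measurable u') (lo : ℤ) (q K : ℕ) (hq : 0 < q)
    (h1 : ∀ x, lo ≤ u x ∧ u x ≤ lo + (q * K : ℕ)) (h1' : ∀ x, lo ≤ u' x ∧ u' x ≤ lo + (q * K : ℕ))
    (h2 : ∀ x, |u x - u' x| ≤ q) (μ l : ℝ) (hμ : 0 ≤ μ) (hl : 0 ≤ l) :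
    ∃ S : Ω → ℝ, Integrable S P ∧ ∫ ω, S ω ∂P ≤ 2 ^ K * Real.exp ((l * (q * μ)) ^ 2 / 2) ∧
      ∀ φ : ℝ → ℝ, Lip1 φ → ∀ ω,
        Real.exp (l * (Z (fun x => φ (μ * u x)) ω - Z (fun x => φ (μ * u' x)) ω)) ≤ S ω := by
  classical
  set χ : ℕ → X → ℝ := fun i x =>
    (if lo + (i : ℤ) < u x then 1 else 0) - (if lo + (i : ℤ) < u' x then 1 else 0) with hχ
  have hχ1 : ∀ i x, |χ i x| ≤ 1 := by
    intro i x
    simp only [hχ]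
    split_ifs <;> simp
  have hχm : ∀ i, BM (χ i) := by
    intro i
    refine ⟨?_, 1, hχ1 i⟩
    refine Measurable.sub ?_ ?_
    · exact Measurable.ite (measurableSet_lt measurable_const hu) measurable_const measurable_const
    · exact Measurable.ite (measurableSet_lt measurable_const hu') measurable_const measurable_const
  set f : ℕ → (Fin K → Bool) → X → ℝ := fun r b x => ∑ m : Fin K, sg (b m) * χ (r + q * m) x with hf
  have hfm : ∀ r b, BM (f r b) := fun r b => BM.sum _ fun m _ => (hχm _).smul _
  have hf1 : ∀ r b x, |f r b x| ≤ 1 := by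
    intro r b x
    by_cases hex : ∃ m : Fin K, χ (r + q * m) x ≠ 0
    · obtain ⟨m, hm⟩ := hex
      have : f r b x = sg (b m) * χ (r + q * m) x := by
        refine sum_eq_single m (fun m' _ hne => ?_) (by simp)
        have hne' : (m' : ℕ) ≠ m := fun h => hne (Fin.ext h)
        rw [mul_eq_zero]
        right
        by_contra hm'
        have h3 := abs_le.1 (h2 x)
        have hgap : (q : ℤ) * m' + q ≤ q * m ∨ (q : ℤ) * m + q ≤ q * m' := by
          rcases lt_or_gt_of_ne hne' with h | h
          · left; have : (m' : ℤ) + 1 ≤ m := by exact_mod_cast h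
            nlinarith
          · right; have : (m : ℤ) + 1 ≤ m' := by exact_mod_cast h
            nlinarith
        simp only [hχ] at hm hm'
        push_cast at hm hm'
        split_ifs at hm hm' <;> first | (simp at hm; done) | (simp at hm'; done) | omega
      rw [this, abs_mul, abs_sg, one_mul]
      exact hχ1 _ _
    · push Not at hex
      have : f r b x = 0 := sum_eq_zero fun m _ => by rw [hex m, mul_zero]
      rw [this]; simp
  have hq' : (0 : ℝ) < q := by exact_mod_cast hq
  refine ⟨fun ω => ∑ r ∈ range q, (q : ℝ)⁻¹ * ∑ b, Real.exp ((l * (q * μ)) * Z (f r b) ω),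
    ?_, ?_, ?_⟩
  · refine integrable_finsetSum _ fun r _ => Integrable.const_mul ?_ _
    exact integrable_finsetSum _ fun b _ => hZ.integrable_exp (hfm r b) _
  · rw [integral_finsetSum]
    · have h4 : ∀ r ∈ range q, ∫ ω, (q : ℝ)⁻¹ * ∑ b, Real.exp ((l * (q * μ)) * Z (f r b) ω) ∂P ≤
          (q : ℝ)⁻¹ * (2 ^ K * Real.exp ((l * (q * μ)) ^ 2 / 2)) := by
        intro r _
        rw [integral_const_mul, integral_finsetSum _ fun b _ => hZ.integrable_exp (hfm r b) _]
        refine mul_le_mul_of_nonneg_left ?_ (inv_nonneg.2 hq'.le)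
        refine (sum_le_sum fun b _ => hZ.mgf (hfm r b).1 (hf1 r b) _).trans ?_
        simp
      refine (sum_le_sum h4).trans ?_
      rw [sum_const, card_range, nsmul_eq_mul, ← mul_assoc, mul_inv_cancel₀ hq'.ne', one_mul]
    · exact fun r _ => Integrable.const_mul
        (integrable_finsetSum _ fun b _ => hZ.integrable_exp (hfm r b) _) _
  · intro φ hφ ω
    set g : ℤ → ℝ := fun v => φ (μ * v) with hg
    set d : ℕ → ℝ := fun i => g (lo + i + 1) - g (lo + i) with hd
    have hd1 : ∀ i, |d i| ≤ μ := by
      intro i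
      refine (hφ _ _).trans (le_of_eq ?_)
      push_cast
      rw [← mul_sub, add_sub_cancel_left, mul_one, abs_of_nonneg hμ]
    have hdec : (fun x => φ (μ * u x)) = fun x => φ (μ * u' x) + ∑ i ∈ range (q * K), d i * χ i x := by
      ext x
      have e1 := eq_add_sum_increments g lo (u x) (q * K) (h1 x).1 (h1 x).2
      have e2 := eq_add_sum_increments g lo (u' x) (q * K) (h1' x).1 (h1' x).2
      change g (u x) = g (u' x) + _
      rw [e1, e2, add_assoc, ← sum_add_distrib]
      congr 1
      refine sum_congr rfl fun i _ => ?_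
      simp only [hd, hχ]
      ring
    have hgb : BM (fun x => φ (μ * u' x)) := by
      refine BM.comp hφ (BM.smul ⟨measurable_from_top.comp hu', |(lo : ℝ)| + q * K, fun x => ?_⟩ μ)
      have ha : (lo : ℝ) ≤ u' x := by exact_mod_cast (h1' x).1
      have hb : (u' x : ℝ) ≤ lo + q * K := by exact_mod_cast (h1' x).2
      have hqK : (0 : ℝ) ≤ q * K := by positivity
      simp only [Function.comp_apply]
      rw [abs_le]
      constructor <;> cases abs_cases (lo : ℝ) <;> linarith
    have hsumb : BM (fun x => ∑ i ∈ range (q * K), d i * χ i x) :=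
      BM.sum _ fun i _ => (hχm i).smul _
    rw [hdec, hZ.add hgb hsumb, add_sub_cancel_left, hZ.sum _ _ fun i _ => hχm i]
    have h9 : ∑ i ∈ range (q * K), d i * Z (χ i) ω ≤
        ∑ r ∈ range q, (q : ℝ)⁻¹ * (q * μ * ∑ m : Fin K, |Z (χ (r + q * m)) ω|) := by
      calc _ ≤ ∑ i ∈ range (q * K), μ * |Z (χ i) ω| := by
            refine sum_le_sum fun i _ => (le_abs_self _).trans ?_
            rw [abs_mul]
            exact mul_le_mul_of_nonneg_right (hd1 i) (abs_nonneg _)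
        _ = _ := by
            rw [sum_range_mul_eq]
            refine sum_congr rfl fun r _ => ?_
            rw [mul_assoc, ← mul_assoc, inv_mul_cancel₀ hq'.ne', one_mul, mul_sum]
    have h10 : Real.exp (∑ r ∈ range q, (q : ℝ)⁻¹ * (l * (q * μ) * ∑ m : Fin K, |Z (χ (r + q * m)) ω|))
        ≤ ∑ r ∈ range q, (q : ℝ)⁻¹ * Real.exp (l * (q * μ) * ∑ m : Fin K, |Z (χ (r + q * m)) ω|) := by
      have := convexOn_exp.map_sum_le (t := range q) (w := fun _ => (q : ℝ)⁻¹)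
        (p := fun r => l * (q * μ) * ∑ m : Fin K, |Z (χ (r + q * m)) ω|)
        (fun _ _ => inv_nonneg.2 hq'.le) (by simp [hq'.ne']) (fun _ _ => Set.mem_univ _)
      simpa only [smul_eq_mul] using this
    calc _ ≤ Real.exp (∑ r ∈ range q,
          (q : ℝ)⁻¹ * (l * (q * μ) * ∑ m : Fin K, |Z (χ (r + q * m)) ω|)) := by
          apply Real.exp_le_exp.2
          refine (mul_le_mul_of_nonneg_left h9 hl).trans (le_of_eq ?_)
          rw [mul_sum]
          exact sum_congr rfl fun r _ => by ring
      _ ≤ _ := h10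
      _ ≤ _ := by
        refine sum_le_sum fun r _ => mul_le_mul_of_nonneg_left ?_ (inv_nonneg.2 hq'.le)
        refine (exp_sum_abs_le _ _).trans (le_of_eq ?_)
        refine sum_congr rfl fun b _ => ?_
        rw [hf, hZ.sum _ _ fun i _ => hχm _]

end GridTD

namespace GridTD

variable {Ω X : Type*} [MeasurableSpace Ω] [MeasurableSpace X] {P : Measure Ω}

/-- The signed dyadic number with digits `b`, truncated after `k` digits. -/
noncomputable def dyadic (b : ℕ → Bool) (k : ℕ) : ℝ := ∑ i ∈ range k, sg (b i) / 2 ^ (i + 1)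

lemma dyadic_succ (b : ℕ → Bool) (k : ℕ) :
    dyadic b (k + 1) = dyadic b k + sg (b k) / 2 ^ (k + 1) := sum_range_succ _ _

lemma abs_dyadic_le (b : ℕ → Bool) (k : ℕ) : |dyadic b k| ≤ 1 - (2 ^ k)⁻¹ := by
  induction k with
  | zero => simp [dyadic]
  | succ k ih =>
    rw [dyadic_succ]
    refine (abs_add_le _ _).trans ?_
    rw [abs_div, abs_sg, abs_of_pos (by positivity : (0 : ℝ) < 2 ^ (k + 1)), pow_succ]
    have : (2 ^ k : ℝ)⁻¹ = 2 * (2 ^ k * 2)⁻¹ := by field_simp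
    rw [one_div]
    linarith

/-- Greedy signed dyadic approximation of a real number. -/
noncomputable def greedy (t : ℝ) : ℕ → ℝ
  | 0 => 0
  | k + 1 => greedy t k + sg (decide (greedy t k ≤ t)) / 2 ^ (k + 1)

lemma exists_dyadic {t : ℝ} (ht : |t| ≤ 1) : ∃ b : ℕ → Bool, ∀ k, |t - dyadic b k| ≤ (2 ^ k)⁻¹ := by
  refine ⟨fun k => decide (greedy t k ≤ t), ?_⟩
  have hd : ∀ k, dyadic (fun k => decide (greedy t k ≤ t)) k = greedy t k := by
    intro k
    induction k with
    | zero => simp [dyadic, greedy]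
    | succ k ih => rw [dyadic_succ, ih, greedy]
  intro k
  rw [hd]
  induction k with
  | zero => simpa [greedy] using ht
  | succ k ih =>
    rw [greedy]
    have e : (2 ^ k : ℝ)⁻¹ = 2 * (2 ^ (k + 1))⁻¹ := by rw [pow_succ]; field_simp
    rw [e] at ih
    have hp : (0 : ℝ) < (2 ^ (k + 1))⁻¹ := by positivity
    rw [abs_le] at ih ⊢
    by_cases h : greedy t k ≤ t
    · simp only [h, decide_true, sg_true, one_div]
      constructor <;> linarith
    · simp only [h, decide_false, sg_false, neg_div, one_div]
      constructor <;> linarith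

lemma dyadic_congr {b b' : ℕ → Bool} {k : ℕ} (h : ∀ i < k, b i = b' i) : dyadic b k = dyadic b' k :=
  sum_congr rfl fun i hi => by rw [h i (mem_range.1 hi)]

section chain
variable {ι : Type*} [Fintype ι] {β : ι → X → ℝ}

omit [MeasurableSpace X] in
/-- Convex combinations with weights `β` preserve bounds. -/
lemma abs_sum_weight_le {a : ι → ℝ} {x : X} {c : ℝ} (h0 : ∀ i, 0 ≤ β i x) (h1 : ∑ i, β i x = 1)
    (ha : ∀ i, |a i| ≤ c) : |∑ i, β i x * a i| ≤ c := by
  calc |∑ i, β i x * a i| ≤ ∑ i, |β i x * a i| := abs_sum_le_sum_abs _ _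
    _ ≤ ∑ i, β i x * c := sum_le_sum fun i _ => by
        rw [abs_mul, abs_of_nonneg (h0 i)]; exact mul_le_mul_of_nonneg_left (ha i) (h0 i)
    _ = c := by rw [← sum_mul, h1, one_mul]

/-- Lattice rounding at mesh `2 ^ (-Q)` of the interpolation of `k`-digit dyadic numbers. -/
noncomputable def roundW (β : ι → X → ℝ) (Q : ℕ) (b : ι → ℕ → Bool) (k : ℕ) (x : X) : ℤ :=
  ⌊(2 : ℝ) ^ Q * ∑ c, β c x * dyadic (b c) k⌋

lemma measurable_roundW (hβ : ∀ c, Measurable (β c)) (Q : ℕ) (b : ι → ℕ → Bool) (k : ℕ) :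
    Measurable (roundW β Q b k) :=
  Int.measurable_floor.comp ((Finset.measurable_sum _ fun c _ => (hβ c).mul_const _).const_mul _)

omit [MeasurableSpace X] in
lemma roundW_bounds (h0 : ∀ c x, 0 ≤ β c x) (h1 : ∀ x, ∑ c, β c x = 1) {Q : ℕ}
    (b : ι → ℕ → Bool) {k : ℕ} (hk : k ≤ Q) (x : X) :
    -(2 ^ Q - 2 ^ (Q - k) + 1) ≤ roundW β Q b k x ∧ roundW β Q b k x ≤ 2 ^ Q - 2 ^ (Q - k) := by
  have h := abs_le.1 (abs_sum_weight_le (fun c => h0 c x) (h1 x) fun c => abs_dyadic_le (b c) k)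
  have e : (2 : ℝ) ^ Q * (2 ^ k)⁻¹ = 2 ^ (Q - k) := by
    rw [← div_eq_mul_inv, div_eq_iff (by positivity), ← pow_add, Nat.sub_add_cancel hk]
  have hp : (0 : ℝ) < 2 ^ Q := by positivity
  set s := ∑ c, β c x * dyadic (b c) k with hs
  have hl := mul_le_mul_of_nonneg_left h.1 hp.le
  have hr := mul_le_mul_of_nonneg_left h.2 hp.le
  unfold roundW
  rw [← hs]
  constructor
  · rw [Int.le_floor]
    push_cast
    linarith
  · have h3 : ((⌊(2 : ℝ) ^ Q * s⌋ : ℤ) : ℝ) ≤ ((2 ^ Q - 2 ^ (Q - k) : ℤ) : ℝ) := by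
      push_cast
      linarith [Int.floor_le ((2 : ℝ) ^ Q * s)]
    exact_mod_cast h3

omit [MeasurableSpace X] in
lemma abs_roundW_sub_le (h0 : ∀ c x, 0 ≤ β c x) (h1 : ∀ x, ∑ c, β c x = 1) {Q : ℕ}
    (b : ι → ℕ → Bool) {k : ℕ} (hk : k + 1 ≤ Q) (x : X) :
    |roundW β Q b (k + 1) x - roundW β Q b k x| ≤ 2 ^ (Q - (k + 1)) + 1 := by
  have h : |∑ c, β c x * (sg (b c k) / 2 ^ (k + 1))| ≤ (2 ^ (k + 1))⁻¹ :=
    abs_sum_weight_le (fun c => h0 c x) (h1 x) fun c => by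
      rw [abs_div, abs_sg, abs_of_pos (by positivity : (0 : ℝ) < 2 ^ (k + 1)), one_div]
  have e : (2 : ℝ) ^ Q * (2 ^ (k + 1))⁻¹ = 2 ^ (Q - (k + 1)) := by
    rw [← div_eq_mul_inv, div_eq_iff (by positivity), ← pow_add, Nat.sub_add_cancel hk]
  have hp : (0 : ℝ) < 2 ^ Q := by positivity
  have h' := abs_le.1 h
  have hl := mul_le_mul_of_nonneg_left h'.1 hp.le
  have hr := mul_le_mul_of_nonneg_left h'.2 hp.le
  unfold roundW
  simp_rw [dyadic_succ, mul_add, sum_add_distrib, mul_add]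
  set s := (2 : ℝ) ^ Q * ∑ c, β c x * dyadic (b c) k
  set d := (2 : ℝ) ^ Q * ∑ c, β c x * (sg (b c k) / 2 ^ (k + 1))
  have f1 := Int.floor_le (s + d)
  have f2 := Int.lt_floor_add_one (s + d)
  have f3 := Int.floor_le s
  have f4 := Int.lt_floor_add_one s
  have g1 : ((⌊s + d⌋ - ⌊s⌋ : ℤ) : ℝ) ≤ ((2 ^ (Q - (k + 1)) + 1 : ℤ) : ℝ) := by
    push_cast; linarith
  have g2 : ((-(2 ^ (Q - (k + 1)) + 1) : ℤ) : ℝ) ≤ ((⌊s + d⌋ - ⌊s⌋ : ℤ) : ℝ) := by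
    push_cast; linarith
  exact abs_le.2 ⟨by exact_mod_cast g2, by exact_mod_cast g1⟩

variable {J : Type*} {φ : J → ℝ → ℝ} {T : J → ι → ℝ}

lemma SubG.chain_link {Z : (X → ℝ) → Ω → ℝ} {C : ℝ} [IsProbabilityMeasure P] [Nonempty ι]
    (hZ : SubG P Z C) (hβ : ∀ c, Measurable (β c)) (h0 : ∀ c x, 0 ≤ β c x)
    (h1 : ∀ x, ∑ c, β c x = 1) (hφ : ∀ j, Lip1 (φ j)) (b : J → ι → ℕ → Bool) {Q k : ℕ}
    (hk : k + 1 ≤ Q) :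
    Dom P (fun j ω => Z (fun x => φ j ((2 ^ Q)⁻¹ * roundW β Q (b j) (k + 1) x)) ω -
        Z (fun x => φ j ((2 ^ Q)⁻¹ * roundW β Q (b j) k x)) ω)
      (((2 ^ (k + 1))⁻¹ + (2 ^ Q)⁻¹) * Real.sqrt (2 * (Real.log 2 *
        ((k + 1) * Fintype.card ι + 2 ^ (k + 2) - 2)))) := by
  classical
  have hpk : (2 : ℝ) ≤ 2 ^ (k + 2) := by
    calc (2 : ℝ) = 2 ^ 1 := by norm_num
      _ ≤ _ := pow_le_pow_right₀ (by norm_num) (by omega)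
  have hν : (0 : ℝ) < Fintype.card ι := by exact_mod_cast Fintype.card_pos
  have hH : 0 < Real.log 2 * ((k + 1) * Fintype.card ι + 2 ^ (k + 2) - 2 : ℝ) :=
    mul_pos (Real.log_pos (by norm_num)) (by nlinarith)
  refine dom_of_subgaussian hH (by positivity) fun l hl => ?_
  set ext : (ι → Fin (k + 1) → Bool) → ι → ℕ → Bool := fun b' c i =>
    if h : i < k + 1 then b' c ⟨i, h⟩ else true with hext
  set q : ℕ := 2 ^ (Q - (k + 1)) + 1 with hq
  set K : ℕ := 2 ^ (k + 2) - 2 with hK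
  have hKZ : ((K : ℕ) : ℤ) = 2 ^ (k + 2) - 2 := by
    rw [hK, Nat.cast_sub]
    · push_cast; ring
    · calc 2 = 2 ^ 1 := by norm_num
        _ ≤ _ := Nat.pow_le_pow_right (by norm_num) (by omega)
  have hKR : ((K : ℕ) : ℝ) = 2 ^ (k + 2) - 2 := by exact_mod_cast congrArg (Int.cast (R := ℝ)) hKZ
  have hQ2 : (2 : ℤ) ^ (Q - (k + 1)) * 2 ^ (k + 2) = 2 * 2 ^ Q := by
    rw [← pow_add, show Q - (k + 1) + (k + 2) = Q + 1 by omega, pow_succ]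
    ring
  have hpZ : (4 : ℤ) ≤ 2 ^ (k + 2) := by
    calc (4 : ℤ) = 2 ^ 2 := by norm_num
      _ ≤ _ := pow_le_pow_right₀ (by norm_num) (by omega)
  have hp1 : (1 : ℤ) ≤ 2 ^ (Q - (k + 1)) := one_le_pow₀ (by norm_num)
  have hp2 : (2 : ℤ) ^ (Q - k) = 2 * 2 ^ (Q - (k + 1)) := by
    rw [show Q - k = Q - (k + 1) + 1 by omega, pow_succ]; ring
  have hlen : 2 * (2 ^ Q - 2 ^ (Q - (k + 1))) + 1 ≤ ((q * K : ℕ) : ℤ) := by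
    rw [Nat.cast_mul, hKZ, hq]
    push_cast
    nlinarith
  have hex : ∀ b' : ι → Fin (k + 1) → Bool, ∃ S : Ω → ℝ, Integrable S P ∧
      ∫ ω, S ω ∂P ≤ 2 ^ K * Real.exp ((l * (q * (2 ^ Q)⁻¹)) ^ 2 / 2) ∧
      ∀ φ : ℝ → ℝ, Lip1 φ → ∀ ω,
        Real.exp (l * (Z (fun x => φ ((2 ^ Q)⁻¹ * roundW β Q (ext b') (k + 1) x)) ω -
          Z (fun x => φ ((2 ^ Q)⁻¹ * roundW β Q (ext b') k x)) ω)) ≤ S ω := by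
    intro b'
    refine hZ.link (measurable_roundW hβ Q _ _) (measurable_roundW hβ Q _ _)
      (-(2 ^ Q - 2 ^ (Q - (k + 1)) + 1)) q K (Nat.succ_pos _) (fun x => ?_) (fun x => ?_)
      (fun x => ?_) _ l (by positivity) hl.le
    · have := roundW_bounds h0 h1 (ext b') hk x
      exact ⟨this.1, by linarith [this.2]⟩
    · have := roundW_bounds h0 h1 (ext b') (by omega : k ≤ Q) x
      rw [hp2] at this
      exact ⟨by linarith [this.1], by linarith [this.2]⟩
    · have := abs_roundW_sub_le h0 h1 (ext b') hk x
      rw [hq]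
      exact_mod_cast this
  choose S hS1 hS2 hS3 using hex
  refine ⟨fun ω => ∑ b', S b' ω, integrable_finsetSum _ fun b' _ => hS1 b', ?_, fun j ω => ?_⟩
  · rw [integral_finsetSum _ fun b' _ => hS1 b']
    refine (sum_le_sum fun b' _ => hS2 b').trans (le_of_eq ?_)
    rw [sum_const, card_univ, nsmul_eq_mul, Real.exp_add]
    have e1 : (q : ℝ) * (2 ^ Q)⁻¹ = (2 ^ (k + 1))⁻¹ + (2 ^ Q)⁻¹ := by
      have : (2 : ℝ) ^ Q = 2 ^ (Q - (k + 1)) * 2 ^ (k + 1) := by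
        rw [← pow_add, Nat.sub_add_cancel hk]
      rw [hq]
      push_cast
      rw [this]
      field_simp
    rw [e1, ← mul_assoc]
    congr 1
    have e2 : (k + 1 : ℝ) * Fintype.card ι + 2 ^ (k + 2) - 2 =
        (((k + 1) * Fintype.card ι + K : ℕ) : ℝ) := by
      push_cast
      rw [hKR]
      ring
    rw [e2, mul_comm (Real.log 2), Real.exp_nat_mul, Real.exp_log (by norm_num), pow_add]
    congr 1
    simp [← pow_mul]
  · set b' : ι → Fin (k + 1) → Bool := fun c i => b j c i with hb'
    have hround : ∀ m ≤ k + 1, ∀ x, roundW β Q (b j) m x = roundW β Q (ext b') m x := by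
      intro m hm x
      unfold roundW
      congr 2
      refine sum_congr rfl fun c _ => ?_
      rw [dyadic_congr fun i hi => ?_]
      simp only [hext, hb', dif_pos (show i < k + 1 by omega)]
    simp_rw [hround (k + 1) le_rfl, hround k (Nat.le_succ k)]
    exact (hS3 b' (φ j) (hφ j) ω).trans
      (single_le_sum (f := fun b' => S b' ω)
        (fun i _ => (Real.exp_pos _).le.trans (hS3 i (φ j) (hφ j) ω)) (mem_univ b'))

/-- Chaining bound for `φ ∘ w`, with `φ` an arbitrary `1`-Lipschitz function vanishing at the origin
and `w` a convex interpolation of arbitrary values in `[-1, 1]`. -/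
lemma SubG.chain {Z : (X → ℝ) → Ω → ℝ} {C : ℝ} [IsProbabilityMeasure P] [Nonempty ι]
    (hZ : SubG P Z C) (hβ : ∀ c, Measurable (β c)) (h0 : ∀ c x, 0 ≤ β c x)
    (h1 : ∀ x, ∑ c, β c x = 1) (hφ : ∀ j, Lip1 (φ j)) (hφ0 : ∀ j, φ j 0 = 0)
    (hT : ∀ j c, |T j c| ≤ 1) {Q K : ℕ} (hK : K ≤ Q) :
    Dom P (fun j ω => Z (fun x => φ j (∑ c, β c x * T j c)) ω)
      (∑ k ∈ range K, ((2 ^ (k + 1))⁻¹ + (2 ^ Q)⁻¹) * Real.sqrt (2 * (Real.log 2 *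
        ((k + 1) * Fintype.card ι + 2 ^ (k + 2) - 2))) + C * ((2 ^ K)⁻¹ + (2 ^ Q)⁻¹)) := by
  choose b hb using fun j c => exists_dyadic (hT j c)
  have hβ1 : ∀ c x, β c x ≤ 1 := fun c x => by
    rw [← h1 x]; exact single_le_sum (fun i _ => h0 i x) (mem_univ c)
  have hw : ∀ a : ι → ℝ, BM (fun x => ∑ c, β c x * a c) := by
    intro a
    refine BM.sum _ fun c _ => ⟨(hβ c).mul_const _, |a c|, fun x => ?_⟩
    rw [abs_mul, abs_of_nonneg (h0 c x)]
    exact mul_le_of_le_one_left (abs_nonneg _) (hβ1 c x)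
  have hr : ∀ j k, k ≤ Q → BM (fun x => ((2 : ℝ) ^ Q)⁻¹ * roundW β Q (b j) k x) := by
    intro j k hk
    refine BM.smul ⟨measurable_from_top.comp (measurable_roundW hβ Q (b j) k),
      2 ^ Q + 1, fun x => ?_⟩ _
    have h2 := roundW_bounds h0 h1 (b j) hk x
    have h3 : (0 : ℤ) < 2 ^ (Q - k) := by positivity
    have h4 : |roundW β Q (b j) k x| ≤ 2 ^ Q + 1 := abs_le.2 ⟨by linarith [h2.1], by linarith [h2.2]⟩
    simp only [Function.comp_apply]
    exact_mod_cast h4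
  have hlinks := dom_sum (P := P) K (fun k j ω =>
      Z (fun x => φ j ((2 ^ Q)⁻¹ * roundW β Q (b j) (k + 1) x)) ω -
        Z (fun x => φ j ((2 ^ Q)⁻¹ * roundW β Q (b j) k x)) ω) _
    fun k hk => hZ.chain_link hβ h0 h1 hφ b (by omega : k + 1 ≤ Q)
  have hlast : Dom P (fun j ω => Z (fun x => φ j (∑ c, β c x * T j c)) ω -
      Z (fun x => φ j ((2 ^ Q)⁻¹ * roundW β Q (b j) K x)) ω) (C * ((2 ^ K)⁻¹ + (2 ^ Q)⁻¹)) := by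
    refine dom_const fun j ω => ?_
    have hb1 := BM.comp (hφ j) (hw (T j))
    have hb2 := BM.comp (hφ j) (hr j K hK)
    rw [← hZ.sub hb1 hb2]
    refine (le_abs_self _).trans (hZ.bound (hb1.1.sub hb2.1) (fun x => ?_) ω)
    refine (hφ j _ _).trans ?_
    have h2 : |∑ c, β c x * (T j c - dyadic (b j c) K)| ≤ (2 ^ K)⁻¹ :=
      abs_sum_weight_le (fun c => h0 c x) (h1 x) fun c => hb j c K
    simp only [mul_sub, sum_sub_distrib] at h2
    set s := ∑ c, β c x * dyadic (b j c) K with hs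
    have h3 : |s - (2 ^ Q)⁻¹ * roundW β Q (b j) K x| ≤ (2 ^ Q)⁻¹ := by
      unfold roundW
      rw [← hs]
      have f1 := Int.floor_le ((2 : ℝ) ^ Q * s)
      have f2 := Int.lt_floor_add_one ((2 : ℝ) ^ Q * s)
      have hp : (0 : ℝ) < 2 ^ Q := by positivity
      have e : s - (2 ^ Q)⁻¹ * (⌊(2 : ℝ) ^ Q * s⌋ : ℤ) =
          (2 ^ Q)⁻¹ * ((2 : ℝ) ^ Q * s - (⌊(2 : ℝ) ^ Q * s⌋ : ℤ)) := by
        field_simp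
      rw [e, abs_mul, abs_of_pos (inv_pos.2 hp), abs_of_nonneg (by linarith)]
      exact mul_le_of_le_one_right (inv_pos.2 hp).le (by linarith)
    calc _ = |(∑ c, β c x * T j c - s) + (s - (2 ^ Q)⁻¹ * roundW β Q (b j) K x)| := by
          congr 1; ring
      _ ≤ _ := (abs_add_le _ _).trans (add_le_add h2 h3)
  refine (hlinks.add hlast).mono (fun j => ⟨j, fun ω => le_of_eq ?_⟩) le_rfl
  rw [sum_range_sub (fun k => Z (fun x => φ j ((2 ^ Q)⁻¹ * roundW β Q (b j) k x)) ω)]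
  have hz : Z (fun x => φ j ((2 ^ Q)⁻¹ * roundW β Q (b j) 0 x)) ω = 0 := by
    simp [roundW, dyadic, hφ0, hZ.zero]
  rw [hz]
  ring

end chain

end GridTD

namespace GridTD

variable {X : Type*} [MeasurableSpace X]

/-- The Rademacher process at the sample `x`. -/
noncomputable def radZ {n : ℕ} (x : Fin n → X) (h : X → ℝ) (ε : Fin n → Bool) : ℝ :=
  (Real.sqrt n)⁻¹ * ∑ i, sg (ε i) * h (x i)

/-- The centered empirical process with weight `s`. -/
noncomputable def empZ (𝒟 : Measure X) (n : ℕ) (s h : X → ℝ) (ω : Fin n → X) : ℝ :=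
  Real.sqrt n * ((∫ x, s x * h x ∂𝒟) - (n : ℝ)⁻¹ * ∑ i, s (ω i) * h (ω i))

lemma sum_sq_div_sqrt_le {n : ℕ} (hn : 0 < n) (a : Fin n → ℝ) {c : ℝ} (ha : ∀ i, |a i| ≤ c) (l : ℝ) :
    ∑ i, (l * ((Real.sqrt n)⁻¹ * a i)) ^ 2 ≤ (l * c) ^ 2 := by
  have hn' : (0 : ℝ) < n := by exact_mod_cast hn
  have h1 : ∀ i, (l * ((Real.sqrt n)⁻¹ * a i)) ^ 2 ≤ (l * c) ^ 2 / n := by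
    intro i
    rw [mul_pow, mul_pow, inv_pow, Real.sq_sqrt hn'.le, mul_pow, ← sq_abs (a i), mul_div_assoc,
      inv_mul_eq_div]
    gcongr
    exact ha i
  calc _ ≤ ∑ _i : Fin n, (l * c) ^ 2 / n := sum_le_sum fun i _ => h1 i
    _ = (l * c) ^ 2 := by simp; field_simp

lemma subG_radZ {n : ℕ} (hn : 0 < n) (x : Fin n → X) :
    SubG (unif (Fin n → Bool)) (radZ x) (Real.sqrt n) where
  add := by intros; simp [radZ, mul_add, sum_add_distrib]
  smul := by
    intro h _ a ω
    simp only [radZ, mul_sum]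
    exact sum_congr rfl fun i _ => by ring
  meas := by intros; exact measurable_of_finite _
  nonneg := Real.sqrt_nonneg _
  bound := by
    intro h c _ hc ω
    have hn' : (0 : ℝ) < n := by exact_mod_cast hn
    have h1 : |∑ i, sg (ω i) * h (x i)| ≤ n * c := by
      refine (abs_sum_le_sum_abs _ _).trans ?_
      calc _ ≤ ∑ _i : Fin n, c := sum_le_sum fun i _ => by
            rw [abs_mul, abs_sg, one_mul]; exact hc _
        _ = n * c := by simp
    rw [radZ, abs_mul, abs_of_nonneg (by positivity)]
    calc (Real.sqrt n)⁻¹ * |∑ i, sg (ω i) * h (x i)| ≤ (Real.sqrt n)⁻¹ * (n * c) := by gcongr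
      _ = Real.sqrt n * c := by
        have := Real.mul_self_sqrt hn'.le
        have h0 := Real.sqrt_pos.2 hn'
        field_simp
        linear_combination (-c) * this
  mgf := by
    intro h c _ hc l
    rw [integral_unif]
    have := uavg_exp_sum_le (Θ := Bool) (s := id) uavg_exp_sg
      (fun i : Fin n => l * ((Real.sqrt n)⁻¹ * h (x i)))
    refine le_trans (le_of_eq ?_) (this.trans ?_)
    · congr 1; ext ε; congr 1
      simp only [radZ, mul_sum, id]
      exact sum_congr rfl fun i _ => by ring
    · rw [Real.exp_le_exp]
      gcongr
      exact sum_sq_div_sqrt_le hn _ (fun i => hc _) l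

variable {𝒟 : Measure X} [IsProbabilityMeasure 𝒟]

lemma BM.integrable {h : X → ℝ} (hh : BM h) : Integrable h 𝒟 := by
  obtain ⟨h1, c, hc⟩ := hh
  exact Integrable.of_bound h1.aestronglyMeasurable c (Filter.Eventually.of_forall hc)

lemma BM.mul {h g : X → ℝ} (hh : BM h) (hg : BM g) : BM (fun x => h x * g x) := by
  obtain ⟨h1, c, hc⟩ := hh
  obtain ⟨g1, d, hd⟩ := hg
  exact ⟨h1.mul g1, c * d, fun x => by
    rw [abs_mul]
    exact mul_le_mul (hc x) (hd x) (abs_nonneg _) ((abs_nonneg _).trans (hc x))⟩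

lemma integral_exp_centered_le {h : X → ℝ} {c : ℝ} (hm : Measurable h) (hc : ∀ x, |h x| ≤ c)
    (l : ℝ) : ∫ x, Real.exp (l * (h x - ∫ z, h z ∂𝒟)) ∂𝒟 ≤ Real.exp ((l * c) ^ 2 / 2) := by
  have := (ProbabilityTheory.hasSubgaussianMGF_of_mem_Icc (μ := 𝒟) (X := h) (a := -c) (b := c)
    hm.aemeasurable (Filter.Eventually.of_forall fun x => abs_le.1 (hc x))).mgf_le l
  refine (le_of_eq rfl).trans (this.trans (le_of_eq ?_))
  congr 1
  push_cast
  rw [Real.norm_eq_abs, div_pow, sq_abs]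
  ring

lemma subG_empZ {n : ℕ} (hn : 0 < n) {s : X → ℝ} (hs : Measurable s) (hs1 : ∀ x, |s x| ≤ 1) :
    SubG (Measure.pi fun _ : Fin n => 𝒟) (empZ 𝒟 n s) (2 * Real.sqrt n) where
  add := by
    intro h g hh hg ω
    have hs' : BM s := ⟨hs, 1, hs1⟩
    simp only [empZ, mul_add, sum_add_distrib]
    rw [integral_add (hs'.mul hh).integrable (hs'.mul hg).integrable]
    ring
  smul := by
    intro h _ a ω
    have e : ∀ x, s x * (a * h x) = a * (s x * h x) := fun x => by ring
    simp only [empZ, e, integral_const_mul, ← mul_sum]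
    ring
  meas := by
    intro h hh
    unfold empZ
    have := hh.1
    fun_prop
  nonneg := by positivity
  bound := by
    intro h c hm hc ω
    have hn' : (0 : ℝ) < n := by exact_mod_cast hn
    have h0 : ∀ x, |s x * h x| ≤ c := fun x => by
      rw [abs_mul]
      exact (mul_le_of_le_one_left (abs_nonneg _) (hs1 x)).trans (hc x)
    have h1 : |∑ i, s (ω i) * h (ω i)| ≤ n * c := by
      refine (abs_sum_le_sum_abs _ _).trans ?_
      calc _ ≤ ∑ _i : Fin n, c := sum_le_sum fun i _ => h0 _
        _ = n * c := by simp
    have h2 : |∫ x, s x * h x ∂𝒟| ≤ c := by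
      have := norm_integral_le_of_norm_le_const (μ := 𝒟) (f := fun x => s x * h x) (C := c)
        (Filter.Eventually.of_forall h0)
      simpa using this
    rw [empZ, abs_mul, abs_of_nonneg (Real.sqrt_nonneg _), mul_comm 2, mul_assoc]
    refine mul_le_mul_of_nonneg_left ?_ (Real.sqrt_nonneg _)
    have h3 : |(n : ℝ)⁻¹ * ∑ i, s (ω i) * h (ω i)| ≤ c := by
      rw [abs_mul, abs_of_pos (inv_pos.2 hn'), inv_mul_le_iff₀ hn']
      exact h1
    have := abs_sub (∫ x, s x * h x ∂𝒟) ((n : ℝ)⁻¹ * ∑ i, s (ω i) * h (ω i))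
    linarith
  mgf := by
    intro h c hm hc l
    have hn' : (0 : ℝ) < n := by exact_mod_cast hn
    have hsn := Real.sqrt_pos.2 hn'
    have hss := Real.mul_self_sqrt hn'.le
    have h0 : ∀ x, |s x * h x| ≤ c := fun x => by
      rw [abs_mul]
      exact (mul_le_of_le_one_left (abs_nonneg _) (hs1 x)).trans (hc x)
    set m := ∫ x, s x * h x ∂𝒟 with hmdef
    have e : ∀ ω, Real.exp (l * empZ 𝒟 n s h ω) =
        ∏ i : Fin n, Real.exp ((-(l * (Real.sqrt n)⁻¹)) * (s (ω i) * h (ω i) - m)) := by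
      intro ω
      rw [← Real.exp_sum, empZ, ← mul_sum, sum_sub_distrib]
      congr 1
      simp only [sum_const, card_univ, Fintype.card_fin, nsmul_eq_mul]
      field_simp
      linear_combination (l * (m * n - ∑ i, s (ω i) * h (ω i))) * hss
    simp_rw [e]
    rw [integral_fintype_prod_eq_prod (ι := Fin n) (fun _ x =>
      Real.exp ((-(l * (Real.sqrt n)⁻¹)) * (s x * h x - m)))]
    calc _ ≤ ∏ _i : Fin n, Real.exp (((-(l * (Real.sqrt n)⁻¹)) * c) ^ 2 / 2) := by
          refine prod_le_prod (fun i _ => integral_nonneg fun x => (Real.exp_pos _).le) fun i _ => ?_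
          exact integral_exp_centered_le (hs.mul hm) h0 _
      _ = Real.exp ((l * c) ^ 2 / 2) := by
          rw [prod_const, ← Real.exp_nat_mul]
          congr 1
          simp only [card_univ, Fintype.card_fin]
          field_simp
          rw [Real.sq_sqrt hn'.le]
          ring

end GridTD

namespace GridTD

variable {X : Type*} [MeasurableSpace X] {𝒟 : Measure X} [IsProbabilityMeasure 𝒟]

lemma measurable_finCons {n : ℕ} : Measurable fun p : X × (Fin n → X) =>
    (Fin.cons p.1 p.2 : Fin (n + 1) → X) := by
  refine measurable_pi_lambda _ fun i => ?_
  refine Fin.cases ?_ (fun i => ?_) i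
  · simpa using measurable_fst
  · simp only [Fin.cons_succ]
    fun_prop

lemma integral_pi_succ {n : ℕ} {F : (Fin (n + 1) → X) → ℝ} (hF : BM F) :
    ∫ ω, F ω ∂(Measure.pi fun _ : Fin (n + 1) => 𝒟) =
      ∫ a, ∫ t, F (Fin.cons a t) ∂(Measure.pi fun _ : Fin n => 𝒟) ∂𝒟 := by
  have h := ((measurePreserving_piFinSuccAbove (fun _ : Fin (n + 1) => 𝒟) 0).symm)
  rw [← h.integral_comp']
  refine Eq.trans ?_ (integral_prod (fun p : X × (Fin n → X) => F (Fin.cons p.1 p.2)) ?_)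
  · simp_rw [MeasurableEquiv.piFinSuccAbove_symm_apply, Fin.insertNthEquiv]
    simp
  · obtain ⟨hm, c, hc⟩ := hF
    refine BM.integrable ⟨hm.comp measurable_finCons, c, fun x => hc _⟩

lemma BM.integral_right {Y : Type*} [MeasurableSpace Y] {μ : Measure Y} [IsProbabilityMeasure μ]
    {F : X × Y → ℝ} (hF : BM F) : BM fun a => ∫ t, F (a, t) ∂μ := by
  obtain ⟨hm, c, hc⟩ := hF
  refine ⟨hm.stronglyMeasurable.integral_prod_right'.measurable, c, fun x => ?_⟩
  have := norm_integral_le_of_norm_le_const (μ := μ) (f := fun t => F (x, t)) (C := c)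
    (Filter.Eventually.of_forall fun t => hc _)
  simpa using this

lemma BM.exp {h : X → ℝ} (hh : BM h) : BM fun x => Real.exp (h x) := by
  obtain ⟨h1, c, hc⟩ := hh
  exact ⟨Real.measurable_exp.comp h1, Real.exp c, fun x => by
    rw [Real.abs_exp, Real.exp_le_exp]; exact (le_abs_self _).trans (hc x)⟩

lemma BM.comp_measurable {Y : Type*} [MeasurableSpace Y] {h : X → ℝ} (hh : BM h) {g : Y → X}
    (hg : Measurable g) : BM fun y => h (g y) := by
  obtain ⟨h1, c, hc⟩ := hh
  exact ⟨h1.comp hg, c, fun y => hc _⟩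

lemma integral_exp_le_of_osc {g : X → ℝ} (hg : BM g) {c : ℝ} (hc : ∀ a a', |g a - g a'| ≤ c)
    (l : ℝ) : ∫ a, Real.exp (l * g a) ∂𝒟 ≤ Real.exp (l * ∫ a, g a ∂𝒟 + (l * c) ^ 2 / 8) := by
  obtain ⟨hm, B, hB⟩ := id hg
  have hne : Nonempty X := nonempty_of_isProbabilityMeasure 𝒟
  have hbdd : BddBelow (Set.range g) := ⟨-B, by rintro _ ⟨a, rfl⟩; exact (abs_le.1 (hB a)).1⟩
  have h := (ProbabilityTheory.hasSubgaussianMGF_of_mem_Icc (μ := 𝒟) (X := g) (a := ⨅ a, g a)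
    (b := (⨅ a, g a) + c) hm.aemeasurable (Filter.Eventually.of_forall fun a =>
      ⟨ciInf_le hbdd a, by
        have : g a - c ≤ ⨅ a, g a := le_ciInf fun a' => by
          linarith [(abs_le.1 (hc a a')).2]
        linarith⟩)).mgf_le l
  have e : ∀ a, Real.exp (l * g a) = Real.exp (l * ∫ a, g a ∂𝒟) *
      Real.exp (l * (g a - ∫ a, g a ∂𝒟)) := fun a => by
    rw [← Real.exp_add]; congr 1; ring
  simp_rw [e]
  rw [integral_const_mul, Real.exp_add]
  refine mul_le_mul_of_nonneg_left ((le_of_eq rfl).trans (h.trans (le_of_eq ?_))) (Real.exp_pos _).le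
  congr 1
  push_cast
  rw [Real.norm_eq_abs, div_pow, sq_abs]
  ring

/-- McDiarmid's bounded difference inequality, in exponential moment form. -/
lemma integral_exp_boundedDiff_le (c l : ℝ) : ∀ (n : ℕ) (Y : (Fin n → X) → ℝ) (_ : BM Y)
    (_ : ∀ (ω : Fin n → X) i a, |Y ω - Y (Function.update ω i a)| ≤ c),
    ∫ ω, Real.exp (l * Y ω) ∂(Measure.pi fun _ : Fin n => 𝒟) ≤
      Real.exp (l * ∫ ω, Y ω ∂(Measure.pi fun _ : Fin n => 𝒟) + n * (l * c) ^ 2 / 8) := by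
  intro n
  induction n with
  | zero =>
    intro Y _ _
    have e : ∀ ω, Y ω = Y (fun i => i.elim0) := fun ω => congrArg Y (Subsingleton.elim _ _)
    simp [e]
  | succ n ih =>
    intro Y hY hc
    have hY' : BM fun p : X × (Fin n → X) => Y (Fin.cons p.1 p.2) :=
      hY.comp_measurable measurable_finCons
    have hE' : BM fun p : X × (Fin n → X) => Real.exp (l * Y (Fin.cons p.1 p.2)) :=
      (hY'.smul l).exp
    have hYa : ∀ a, BM fun t : Fin n → X => Y (Fin.cons a t) := fun a =>
      hY'.comp_measurable measurable_prodMk_left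
    set g : X → ℝ := fun a => ∫ t, Y (Fin.cons a t) ∂(Measure.pi fun _ : Fin n => 𝒟) with hg
    have hgB : BM g := hY'.integral_right
    have hosc : ∀ a a', |g a - g a'| ≤ c := by
      intro a a'
      rw [hg]
      simp only
      rw [← integral_sub (hYa a).integrable (hYa a').integrable]
      have := norm_integral_le_of_norm_le_const (μ := Measure.pi fun _ : Fin n => 𝒟)
        (f := fun t => Y (Fin.cons a t) - Y (Fin.cons a' t)) (C := c)
        (Filter.Eventually.of_forall fun t => by
          have := hc (Fin.cons a t) 0 a'
          rwa [Fin.update_cons_zero] at this)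
      simpa using this
    rw [integral_pi_succ (hY.smul l).exp, integral_pi_succ hY]
    calc _ ≤ ∫ a, Real.exp (l * g a) * Real.exp (n * (l * c) ^ 2 / 8) ∂𝒟 := by
          refine integral_mono hE'.integral_right.integrable
            ((hgB.smul l).exp.mul (BM.const _)).integrable fun a => ?_
          rw [← Real.exp_add]
          refine ih _ (hYa a) fun t i b => ?_
          have := hc (Fin.cons a t) i.succ b
          rwa [← Fin.cons_update] at this
      _ ≤ Real.exp (l * ∫ a, g a ∂𝒟 + (l * c) ^ 2 / 8) * Real.exp (n * (l * c) ^ 2 / 8) := by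
          rw [integral_mul_const]
          exact mul_le_mul_of_nonneg_right (integral_exp_le_of_osc hgB hosc l) (Real.exp_pos _).le
      _ = _ := by
          rw [← Real.exp_add]
          congr 1
          push_cast
          ring

/-- McDiarmid's bounded difference inequality. -/
lemma measureReal_boundedDiff_le {n : ℕ} {Y : (Fin n → X) → ℝ} (hn : 0 < n) (hY : BM Y)
    (hc : ∀ (ω : Fin n → X) i a, |Y ω - Y (Function.update ω i a)| ≤ (n : ℝ)⁻¹) {t : ℝ}
    (ht : 0 ≤ t) :
    (Measure.pi fun _ : Fin n => 𝒟).real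
      {ω | (∫ ω, Y ω ∂(Measure.pi fun _ : Fin n => 𝒟)) + t ≤ Y ω} ≤ Real.exp (-(2 * n * t ^ 2)) := by
  have hn' : (0 : ℝ) < n := by exact_mod_cast hn
  have h1 := integral_exp_boundedDiff_le (𝒟 := 𝒟) (n : ℝ)⁻¹ (4 * n * t) n Y hY hc
  have h2 := ProbabilityTheory.measure_ge_le_exp_mul_mgf (μ := Measure.pi fun _ : Fin n => 𝒟)
    (X := Y) ((∫ ω, Y ω ∂(Measure.pi fun _ : Fin n => 𝒟)) + t) (t := 4 * n * t) (by positivity)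
    (hY.smul _).exp.integrable
  refine h2.trans ((mul_le_mul_of_nonneg_left h1 (Real.exp_pos _).le).trans (le_of_eq ?_))
  rw [← Real.exp_add]
  congr 1
  field_simp
  ring

end GridTD

namespace GridTD

variable {X : Type*} [MeasurableSpace X] {𝒟 : Measure X} [IsProbabilityMeasure 𝒟]

lemma measurePreserving_swap_coords {n : ℕ} (ε : Fin n → Bool) :
    MeasurePreserving (fun (z : Fin n → X × X) i => if ε i then z i else (z i).swap)
      (Measure.pi fun _ => 𝒟.prod 𝒟) (Measure.pi fun _ => 𝒟.prod 𝒟) := by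
  refine measurePreserving_pi _ _ (f := fun i (p : X × X) => if ε i then p else p.swap) fun i => ?_
  by_cases h : ε i
  · simp only [h, if_true]
    exact MeasurePreserving.id (𝒟.prod 𝒟)
  · simpa [h] using Measure.measurePreserving_swap (μ := 𝒟) (ν := 𝒟)

variable {J : Type*} [Fintype J] [Nonempty J]

lemma BM.fmax {g : J → X → ℝ} (hg : ∀ j, BM (g j)) : BM fun x => fmax fun j => g j x := by
  choose c hc using fun j => (hg j).2
  refine ⟨measurable_fmax fun j => (hg j).1, ∑ j, |c j|, fun x => ?_⟩
  obtain ⟨j, hj⟩ := exists_fmax fun j => g j x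
  simp only [hj]
  exact (hc j x).trans ((le_abs_self _).trans
    (single_le_sum (f := fun j => |c j|) (fun i _ => abs_nonneg _) (mem_univ j)))

/-- The normalized difference between two samples. -/
noncomputable def pairZ {n : ℕ} (h : X → ℝ) (z : Fin n → X × X) (ε : Fin n → Bool) : ℝ :=
  (Real.sqrt n)⁻¹ * ∑ i, sg (ε i) * (h (z i).2 - h (z i).1)

lemma BM.pairZ {n : ℕ} {h : X → ℝ} (hh : BM h) (ε : Fin n → Bool) :
    BM fun z : Fin n → X × X => pairZ h z ε := by
  refine BM.smul (BM.sum _ fun i _ => BM.smul ?_ _) _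
  simp only [sub_eq_add_neg]
  have h1 : BM fun x => -h x := by simpa using hh.smul (-1)
  exact (hh.comp_measurable (by fun_prop)).add (h1.comp_measurable (by fun_prop))

lemma empZ_eq_integral {n : ℕ} (hn : 0 < n) {h : X → ℝ} (hh : BM h) (ω : Fin n → X) :
    empZ 𝒟 n (fun _ => 1) h ω = ∫ ω', pairZ h (fun i => (ω i, ω' i)) (fun _ => true)
      ∂(Measure.pi fun _ : Fin n => 𝒟) := by
  have hn' : (0 : ℝ) < n := by exact_mod_cast hn
  have hsn := Real.sqrt_pos.2 hn'
  have hss := Real.mul_self_sqrt hn'.le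
  have hi : ∀ i : Fin n, ∫ ω' : Fin n → X, h (ω' i) ∂(Measure.pi fun _ : Fin n => 𝒟) =
      ∫ x, h x ∂𝒟 := fun i => integral_comp_eval (μ := fun _ : Fin n => 𝒟) (i := i) hh.1.aestronglyMeasurable
  have hb : ∀ i : Fin n, Integrable (fun ω' : Fin n → X => h (ω' i))
      (Measure.pi fun _ : Fin n => 𝒟) := fun i =>
    (hh.comp_measurable (measurable_pi_apply i)).integrable
  simp only [pairZ, sg_true, one_mul]
  rw [integral_const_mul, integral_finsetSum]
  swap
  · exact fun i _ => (hb i).sub (integrable_const _)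
  have : ∀ i : Fin n, ∫ ω' : Fin n → X, (h (ω' i) - h (ω i)) ∂(Measure.pi fun _ : Fin n => 𝒟) =
      (∫ x, h x ∂𝒟) - h (ω i) := fun i => by
    rw [integral_sub (hb i) (integrable_const _), hi]; simp
  simp_rw [this]
  rw [empZ, sum_sub_distrib]
  simp only [sum_const, card_univ, Fintype.card_fin, nsmul_eq_mul, one_mul]
  field_simp
  linear_combination ((∫ x, h x ∂𝒟) * n - ∑ i, h (ω i)) * hss

/-- Symmetrization. -/
lemma dom_symmetrization {n : ℕ} (hn : 0 < n) {g : J → X → ℝ} (hg : ∀ j, BM (g j)) {c : ℝ}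
    (H : ∀ x : Fin n → X, Dom (unif (Fin n → Bool)) (fun j => radZ x (g j)) c) :
    Dom (Measure.pi fun _ : Fin n => 𝒟) (fun j => empZ 𝒟 n (fun _ => 1) (g j)) (2 * c) := by
  set P := Measure.pi fun _ : Fin n => 𝒟 with hP
  set P2 := Measure.pi fun _ : Fin n => 𝒟.prod 𝒟 with hP2
  have hem : ∀ j, BM (empZ 𝒟 n (fun _ => 1) (g j)) := fun j => by
    have S := subG_empZ (𝒟 := 𝒟) hn (s := fun _ => 1) measurable_const (by simp)
    obtain ⟨C, hC⟩ := (hg j).2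
    exact ⟨S.meas (hg j), _, S.bound (hg j).1 hC⟩
  have hFB : ∀ ε, BM fun z : Fin n → X × X => fmax fun j => pairZ (g j) z ε := fun ε =>
    BM.fmax fun j => (hg j).pairZ ε
  have hmk : Measurable fun p : (Fin n → X) × (Fin n → X) => fun i => (p.1 i, p.2 i) := by
    fun_prop
  have hGB := (hFB fun _ => true).comp_measurable hmk
  have hinv : ∀ ε, ∫ z, (fmax fun j => pairZ (g j) z ε) ∂P2 =
      ∫ z, (fmax fun j => pairZ (g j) z fun _ => true) ∂P2 := by
    intro ε
    have hm := measurePreserving_swap_coords (𝒟 := 𝒟) ε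
    conv_lhs => rw [hP2, ← hm.map_eq]
    rw [integral_map hm.measurable.aemeasurable
      (by rw [hm.map_eq]; exact (hFB _).1.aestronglyMeasurable)]
    refine integral_congr_ae (Filter.Eventually.of_forall fun z => ?_)
    simp only
    congr 1; ext j
    simp only [pairZ]
    congr 1
    refine sum_congr rfl fun i _ => ?_
    cases ε i <;> simp
  refine ⟨fun ω => fmax fun j => empZ 𝒟 n (fun _ => 1) (g j) ω, (BM.fmax hem).integrable,
    fun j ω => le_fmax (fun j => empZ 𝒟 n (fun _ => 1) (g j) ω) j, ?_⟩
  have h1 : ∫ ω, (fmax fun j => empZ 𝒟 n (fun _ => 1) (g j) ω) ∂P ≤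
      ∫ ω, ∫ ω', (fmax fun j => pairZ (g j) (fun i => (ω i, ω' i)) fun _ => true) ∂P ∂P := by
    refine integral_mono (BM.fmax hem).integrable hGB.integral_right.integrable fun ω => ?_
    refine fmax_le fun j => ?_
    rw [empZ_eq_integral hn (hg j)]
    refine integral_mono ?_ ?_ fun ω' => ?_
    · exact (((hg j).pairZ _).comp_measurable (hmk.comp measurable_prodMk_left)).integrable
    · exact (hGB.comp_measurable measurable_prodMk_left).integrable
    · exact le_fmax (fun j => pairZ (g j) (fun i => (ω i, ω' i)) fun _ => true) j
  have h2 : ∫ ω, ∫ ω', (fmax fun j => pairZ (g j) (fun i => (ω i, ω' i)) fun _ => true) ∂P ∂P =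
      ∫ z, (fmax fun j => pairZ (g j) z fun _ => true) ∂P2 := by
    rw [← integral_prod _ hGB.integrable]
    have he := measurePreserving_arrowProdEquivProdArrow X X (Fin n) (fun _ => 𝒟) (fun _ => 𝒟)
    rw [← he.integral_comp']
    rfl
  have h3 : ∫ z, (fmax fun j => pairZ (g j) z fun _ => true) ∂P2 =
      ∫ z, uavg (fun ε => fmax fun j => pairZ (g j) z ε) ∂P2 := by
    simp only [uavg]
    rw [integral_div, integral_finsetSum _ fun ε _ => (hFB ε).integrable]
    simp_rw [hinv]
    simp
  have h4 : ∀ z : Fin n → X × X, uavg (fun ε => fmax fun j => pairZ (g j) z ε) ≤ 2 * c := by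
    intro z
    have e : ∀ ε j, pairZ (g j) z ε = radZ (fun i => (z i).2) (g j) ε +
        radZ (fun i => (z i).1) (g j) (fun i => !ε i) := by
      intro ε j
      simp only [pairZ, radZ, ← mul_add, ← sum_add_distrib]
      congr 1
      refine sum_congr rfl fun i _ => ?_
      rw [sg_not]; ring
    simp_rw [e]
    refine (uavg_mono fun ε => fmax_add_le _ _).trans ?_
    rw [uavg_add, two_mul]
    refine add_le_add (uavg_fmax_le_of_dom (H _)) ?_
    refine le_trans (le_of_eq ?_) (uavg_fmax_le_of_dom (H fun i => (z i).1))
    exact uavg_equiv (Equiv.piCongrRight fun _ : Fin n => Equiv.boolNot)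
      (fun ε => fmax fun j => radZ (fun i => (z i).1) (g j) ε)
  rw [h2, h3] at h1
  refine h1.trans ?_
  have hU : BM fun z : Fin n → X × X => uavg (fun ε => fmax fun j => pairZ (g j) z ε) := by
    simp only [uavg, div_eq_inv_mul]
    exact (BM.sum _ fun ε _ => hFB ε).smul _
  calc _ ≤ ∫ _z, 2 * c ∂P2 := integral_mono hU.integrable (integrable_const _) h4
    _ = 2 * c := by simp

end GridTD

namespace GridTD

/-- Flipping the bits in `S`. -/
def flipOn {I : Type*} [DecidableEq I] (S : Finset I) : (I → Bool) ≃ (I → Bool) where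
  toFun θ i := if i ∈ S then !θ i else θ i
  invFun θ i := if i ∈ S then !θ i else θ i
  left_inv θ := by ext i; by_cases h : i ∈ S <;> simp [h]
  right_inv θ := by ext i; by_cases h : i ∈ S <;> simp [h]

lemma flipOn_apply {I : Type*} [DecidableEq I] (S : Finset I) (θ : I → Bool) (i : I) :
    flipOn S θ i = if i ∈ S then !θ i else θ i := rfl

lemma uavg_abs_flip {Θ : Type*} [Fintype Θ] (e : Θ ≃ Θ) (F : Θ → ℝ) :
    uavg (fun θ => |F θ - F (e θ)| / 2) ≤ uavg (fun θ => |F θ|) := by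
  have h := uavg_equiv e (fun θ => |F θ|)
  calc uavg (fun θ => |F θ - F (e θ)| / 2) ≤ uavg (fun θ => (1 / 2) * (|F θ| + |F (e θ)|)) :=
        uavg_mono fun θ => by linarith [abs_sub (F θ) (F (e θ))]
    _ = uavg (fun θ => |F θ|) := by rw [uavg_mul_left, uavg_add, h]; ring

lemma four_flips (Δ D : ℝ) (a b c : Bool) :
    4 * (|Δ| + D) ≤ |2 * Δ * sg a + D * (sg b - sg c)| + |2 * Δ * -sg a + D * (sg b - sg c)| +
      (|2 * Δ * sg a + D * (sg b - -sg c)| + |2 * Δ * -sg a + D * (sg b - -sg c)|) := by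
  have h1 := le_abs_self (2 * Δ + 2 * D)
  have h2 := neg_le_abs (2 * Δ - 2 * D)
  have h4 := neg_le_abs (-(2 * Δ) - 2 * D)
  have h5 := le_abs_self (-(2 * Δ) + 2 * D)
  rw [show 2 * Δ - 2 * D = 2 * Δ + -(D * 2) by ring] at h2
  rw [show 2 * Δ + 2 * D = 2 * Δ + D * 2 by ring] at h1
  rw [show -(2 * Δ) - 2 * D = -(2 * Δ) + -(D * 2) by ring] at h4
  rw [show -(2 * Δ) + 2 * D = -(2 * Δ) + D * 2 by ring] at h5
  cases a <;> cases b <;> cases c <;> simp only [sg_true, sg_false] <;> norm_num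
  all_goals linarith

section peel
variable {M : ℕ} {Q : Fin M → Type} [∀ k, Fintype (Q k)] [∀ k, DecidableEq (Q k)]
  {J : Type*}

/-- Random coefficients replacing one Rademacher sign in the peeling argument. -/
noncomputable def peelR (a : J → ℝ) (q : ∀ k, J → Q k) (D : Fin M → ℝ)
    (θ : Option (Σ k, Q k) → Bool) (j : J) : ℝ :=
  2 * a j * sg (θ none) + ∑ k, D k * sg (θ (some ⟨k, q k j⟩))

lemma uavg_abs_peelR_of_ne (a : J → ℝ) (q : ∀ k, J → Q k) (D : Fin M → ℝ) (c : ℝ) {j j' : J}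
    {k : Fin M} (hk : q k j ≠ q k j') :
    |a j - a j'| + D k ≤ uavg (fun θ => |c + (peelR a q D θ j - peelR a q D θ j')|) := by
  set i₁ : Option (Σ k, Q k) := some ⟨k, q k j⟩ with hi₁
  set i₂ : Option (Σ k, Q k) := some ⟨k, q k j'⟩ with hi₂
  have h12 : i₁ ≠ i₂ := by
    simp only [hi₁, hi₂, ne_eq, Option.some.injEq, Sigma.mk.injEq, heq_eq_eq, true_and]
    exact hk
  have h01 : none ≠ i₁ := by simp [hi₁]
  have h02 : none ≠ i₂ := by simp [hi₂]
  set x : (Option (Σ k, Q k) → Bool) → ℝ := fun θ =>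
    2 * (a j - a j') * sg (θ none) + D k * (sg (θ i₁) - sg (θ i₂)) with hx
  have e1 : ∀ θ, (c + (peelR a q D θ j - peelR a q D θ j')) -
      (c + (peelR a q D (flipOn {none, i₁, i₂} θ) j -
        peelR a q D (flipOn {none, i₁, i₂} θ) j')) = 2 * x θ := by
    intro θ
    have hs : ∀ l : J, (l = j ∨ l = j') → (∑ k, D k * sg (θ (some ⟨k, q k l⟩))) -
        ∑ k, D k * sg (flipOn {none, i₁, i₂} θ (some ⟨k, q k l⟩)) =
          2 * (D k * sg (θ (some ⟨k, q k l⟩))) := by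
      intro l hl
      rw [← sum_sub_distrib, sum_eq_single k]
      · have : some ⟨k, q k l⟩ ∈ ({none, i₁, i₂} : Finset (Option (Σ k, Q k))) := by
          rcases hl with rfl | rfl <;> simp [hi₁, hi₂]
        rw [flipOn_apply, if_pos this, sg_not]; ring
      · intro k' _ hk'
        have : some ⟨k', q k' l⟩ ∉ ({none, i₁, i₂} : Finset (Option (Σ k, Q k))) := by
          simp [hi₁, hi₂, hk']
        rw [flipOn_apply, if_neg this]; ring
      · simp
    have h1 := hs j (Or.inl rfl)
    have h2 := hs j' (Or.inr rfl)
    have h0 : sg (flipOn {none, i₁, i₂} θ none) = -sg (θ none) := by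
      rw [flipOn_apply, if_pos (by simp), sg_not]
    simp only [peelR, hx, h0]
    linear_combination h1 - h2
  have h1 := uavg_abs_flip (flipOn {none, i₁, i₂})
    (fun θ => c + (peelR a q D θ j - peelR a q D θ j'))
  simp_rw [e1] at h1
  refine le_trans ?_ h1
  have e2 : ∀ θ, |2 * x θ| / 2 = |x θ| := fun θ => by rw [abs_mul]; norm_num
  simp_rw [e2]
  have f0 := uavg_equiv (flipOn {none}) (fun θ => |x θ|)
  have f2 := uavg_equiv (flipOn {i₂}) (fun θ => |x θ|)
  have f02 := uavg_equiv (flipOn {i₂}) (fun θ => |x (flipOn {none} θ)|)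
  have key : uavg (fun _ : Option (Σ k, Q k) → Bool => 4 * (|a j - a j'| + D k)) ≤
      uavg (fun θ => (|x θ| + |x (flipOn {none} θ)|) +
        (|x (flipOn {i₂} θ)| + |x (flipOn {none} (flipOn {i₂} θ))|)) := by
    refine uavg_mono fun θ => ?_
    have := four_flips (a j - a j') (D k) (θ none) (θ i₁) (θ i₂)
    simpa [hx, flipOn_apply, h12, h01, h02, h01.symm, h02.symm] using this
  rw [uavg_const, uavg_add, uavg_add, uavg_add, f02, f2, f0] at key
  linarith

lemma uavg_abs_peelR (a : J → ℝ) (q : ∀ k, J → Q k) (D : Fin M → ℝ) (c : ℝ) (j j' : J) :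
    2 * |a j - a j'| ≤ uavg (fun θ => |c + (peelR a q D θ j - peelR a q D θ j')|) := by
  have e1 : ∀ θ, (c + (peelR a q D θ j - peelR a q D θ j')) -
      (c + (peelR a q D (flipOn {none} θ) j -
        peelR a q D (flipOn {none} θ) j')) = 4 * (a j - a j') * sg (θ none) := by
    intro θ
    simp only [peelR, flipOn_apply, mem_singleton, if_true, sg_not, reduceCtorEq, if_false]
    ring
  have h1 := uavg_abs_flip (flipOn {none})
    (fun θ => c + (peelR a q D θ j - peelR a q D θ j'))
  simp_rw [e1] at h1
  refine le_trans ?_ h1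
  have e2 : ∀ θ : Option (Σ k, Q k) → Bool, |4 * (a j - a j') * sg (θ none)| / 2 =
      2 * |a j - a j'| := fun θ => by
    rw [abs_mul, abs_mul, abs_sg]; norm_num; ring
  simp_rw [e2]
  rw [uavg_const]

lemma max_eq_half (x y : ℝ) : max x y = (x + y) / 2 + |x - y| / 2 := by
  rw [max_def, abs_eq_max_neg, max_def]; split_ifs <;> linarith

variable [Fintype J] [Nonempty J]

lemma uavg_fmax_peel {n : ℕ} (p a : Fin n → J → ℝ) (q : ∀ k, J → Q k) (D : Fin M → ℝ)
    {τ : ℝ} (hτ : 0 ≤ τ)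
    (h : ∀ i j j', (∃ k, q k j ≠ q k j' ∧ |p i j - p i j'| ≤ |a i j - a i j'| + D k) ∨
      |p i j - p i j'| ≤ |a i j - a i j'| + τ) :
    uavg (fun ε : Fin n → Bool => fmax (fun j => ∑ i, sg (ε i) * p i j)) ≤
      uavg (fun θ : Fin n → (Option (Σ k, Q k) → Bool) =>
        fmax (fun j => ∑ i, peelR (a i) q D (θ i) j)) + n * τ := by
  have := uavg_replace (J := J) fmax τ n p (fun i θ j => peelR (a i) q D θ j) ?_ 0
  · simpa using this
  intro i A
  refine uavg_bool_fmax_le fun j j' => ?_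
  have h1 : p i j - p i j' ≤
      uavg (fun θ => |(A j - A j') + (peelR (a i) q D θ j - peelR (a i) q D θ j')|) + τ := by
    rcases h i j j' with ⟨k, hk, hle⟩ | hle
    · linarith [le_abs_self (p i j - p i j'), uavg_abs_peelR_of_ne (a i) q D (A j - A j') hk]
    · linarith [le_abs_self (p i j - p i j'), uavg_abs_peelR (a i) q D (A j - A j') j j',
        abs_nonneg (a i j - a i j')]
  have h2 : uavg (fun θ => (A j + A j') / 2 + (1 / 2) * (peelR (a i) q D θ j + peelR (a i) q D θ j') +
      (1 / 2) * |(A j - A j') + (peelR (a i) q D θ j - peelR (a i) q D θ j')|) ≤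
      uavg (fun θ => fmax fun j => A j + peelR (a i) q D θ j) := by
    refine uavg_mono fun θ => ?_
    have h3 : max (A j + peelR (a i) q D θ j) (A j' + peelR (a i) q D θ j') ≤
        fmax fun j => A j + peelR (a i) q D θ j :=
      max_le (le_fmax (fun j => A j + peelR (a i) q D θ j) j)
        (le_fmax (fun j => A j + peelR (a i) q D θ j) j')
    rw [max_eq_half] at h3
    refine le_trans (le_of_eq ?_) h3
    rw [show A j + peelR (a i) q D θ j - (A j' + peelR (a i) q D θ j') =
      A j - A j' + (peelR (a i) q D θ j - peelR (a i) q D θ j') by ring]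
    ring
  have h0 : ∀ j, uavg (fun θ => peelR (a i) q D θ j) = 0 := by
    intro j
    have h4 := uavg_equiv (flipOn univ) (fun θ => peelR (a i) q D θ j)
    have h5 : ∀ θ, peelR (a i) q D (flipOn univ θ) j = (-1) * peelR (a i) q D θ j := by
      intro θ
      simp only [peelR, flipOn_apply, mem_univ, if_true, sg_not, mul_neg, sum_neg_distrib]
      ring
    simp_rw [h5] at h4
    rw [uavg_mul_left] at h4
    linarith
  rw [uavg_add, uavg_add, uavg_const, uavg_mul_left, uavg_mul_left, uavg_add, h0, h0] at h2
  linarith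

end peel

/-- Expected maximum of finitely many sums of independent signs. -/
lemma uavg_fmax_sum_le {Θ E : Type*} [Fintype Θ] [Nonempty Θ] [Fintype E] [Nonempty E] {n : ℕ}
    (hn : 0 < n) (s : E → Θ → Bool)
    (hs : ∀ e (x : ℝ), uavg (fun θ => Real.exp (sg (s e θ) * x)) ≤ Real.exp (x ^ 2 / 2))
    (v : E → Fin n → ℝ) (hv : ∀ e i, |v e i| ≤ 1) {H : ℝ} (hH : 0 < H)
    (hE : Real.log (Fintype.card E) ≤ H) :
    uavg (fun θ : Fin n → Θ => fmax fun e => ∑ i, sg (s e (θ i)) * v e i) ≤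
      Real.sqrt n * Real.sqrt (2 * H) := by
  let _ : MeasurableSpace (Fin n → Θ) := ⊤
  have hsn : 0 < Real.sqrt n := Real.sqrt_pos.2 (by exact_mod_cast hn)
  refine uavg_fmax_le_of_dom (dom_of_subgaussian hH hsn fun l _ => ?_)
  refine ⟨fun θ => ∑ e, Real.exp (l * ∑ i, sg (s e (θ i)) * v e i), Integrable.of_finite, ?_,
    fun e θ => single_le_sum (f := fun e => Real.exp (l * ∑ i, sg (s e (θ i)) * v e i))
      (fun _ _ => (Real.exp_pos _).le) (mem_univ e)⟩
  rw [integral_unif, uavg_sum]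
  classical
  calc _ ≤ ∑ _e : E, Real.exp ((l * Real.sqrt n) ^ 2 / 2) := by
        refine sum_le_sum fun e _ => ?_
        have := uavg_exp_sum_le (s e) (hs e) (fun i => l * v e i)
        refine le_trans (le_of_eq ?_) (this.trans ?_)
        · congr 1; ext θ; congr 1
          rw [mul_sum]
          exact sum_congr rfl fun i _ => by ring
        · rw [Real.exp_le_exp, mul_pow, Real.sq_sqrt (Nat.cast_nonneg n)]
          gcongr
          calc ∑ i, (l * v e i) ^ 2 ≤ ∑ _i : Fin n, l ^ 2 := sum_le_sum fun i _ => by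
                rw [mul_pow, ← sq_abs (v e i)]
                exact mul_le_of_le_one_right (sq_nonneg l) (pow_le_one₀ (abs_nonneg _) (hv e i))
            _ = l ^ 2 * n := by simp; ring
    _ = Fintype.card E * Real.exp ((l * Real.sqrt n) ^ 2 / 2) := by simp
    _ ≤ Real.exp H * Real.exp ((l * Real.sqrt n) ^ 2 / 2) := by
        gcongr
        rwa [← Real.log_le_iff_le_exp (by exact_mod_cast Fintype.card_pos)]
    _ = _ := by rw [← Real.exp_add]

lemma uavg_exp_coord {I : Type*} [Fintype I] [DecidableEq I] (i : I) (x : ℝ) :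
    uavg (fun θ : I → Bool => Real.exp (sg (θ i) * x)) ≤ Real.exp (x ^ 2 / 2) := by
  rw [uavg_eval i (fun b : Bool => Real.exp (sg b * x))]
  exact uavg_exp_sg x

end GridTD

namespace GridTD

/-- Greedy `±h` approximation of `φ` at the multiples of `h`. -/
noncomputable def greedyApprox (φ : ℝ → ℝ) (h : ℝ) : ℕ → ℝ
  | 0 => 0
  | i + 1 => greedyApprox φ h i + (if greedyApprox φ h i ≤ φ ((i + 1) * h) then h else -h)

lemma greedyApprox_close {φ : ℝ → ℝ} (hφ : Lip1 φ) (h0 : φ 0 = 0) {h : ℝ} (hh : 0 ≤ h) (i : ℕ) :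
    |φ (i * h) - greedyApprox φ h i| ≤ h := by
  induction i with
  | zero => simpa [greedyApprox, h0] using hh
  | succ i ih =>
    have h1 := hφ ((i + 1 : ℝ) * h) (i * h)
    rw [show ((i + 1 : ℝ) * h) - i * h = h by ring, abs_of_nonneg hh] at h1
    rw [abs_le] at ih h1 ⊢
    simp only [greedyApprox]
    push_cast
    split_ifs with hc
    · constructor <;> linarith
    · push Not at hc
      constructor <;> linarith

lemma greedyApprox_line {φ : ℝ → ℝ} (hφ : Lip1 φ) (h0 : φ 0 = 0) {h : ℝ} (hh : 0 ≤ h) (i : ℕ) {t : ℝ}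
    (ht : i * h ≤ t) (ht' : t ≤ (i + 1) * h) :
    |φ t - (greedyApprox φ h i + (if greedyApprox φ h i ≤ φ ((i + 1) * h) then t - i * h else -(t - i * h)))| ≤
      h := by
  have a := greedyApprox_close hφ h0 hh i
  have b := greedyApprox_close hφ h0 hh (i + 1)
  have c := hφ t (i * h)
  have d := hφ ((i + 1) * h) t
  rw [abs_of_nonneg (sub_nonneg.2 ht)] at c
  rw [abs_of_nonneg (sub_nonneg.2 ht')] at d
  simp only [greedyApprox] at b
  push_cast at b
  rw [abs_le] at a b c d ⊢
  split_ifs at b ⊢ with hc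
  · constructor <;> linarith
  · constructor <;> linarith

open Classical in
/-- The sequence of signs chosen by the greedy approximation, on both sides of the origin. -/
noncomputable def code (m : ℕ) (φ : ℝ → ℝ) (p : Bool × Fin m) : Bool :=
  decide (greedyApprox (fun t => φ (sg p.1 * t)) (m : ℝ)⁻¹ p.2 ≤ φ (sg p.1 * ((p.2 + 1) * (m : ℝ)⁻¹)))

lemma Lip1.comp_sg {φ : ℝ → ℝ} (hφ : Lip1 φ) (b : Bool) : Lip1 fun t => φ (sg b * t) :=
  fun s t => by
    have := hφ (sg b * s) (sg b * t)
    rwa [← mul_sub, abs_mul, abs_sg, one_mul] at this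

lemma code_close {m : ℕ} (hm : 0 < m) {φ ψ : ℝ → ℝ} (hφ : Lip1 φ) (hψ : Lip1 ψ) (h0 : φ 0 = 0)
    (h0' : ψ 0 = 0) (hc : code m φ = code m ψ) {u : ℝ} (hu : |u| ≤ 1) :
    |φ u - ψ u| ≤ 2 / m := by
  have hm' : (0 : ℝ) < m := by exact_mod_cast hm
  obtain ⟨b, t, ht0, ht1, rfl⟩ : ∃ (b : Bool) (t : ℝ), 0 ≤ t ∧ t ≤ 1 ∧ u = sg b * t := by
    rcases le_total 0 u with h | h
    · exact ⟨true, u, h, (le_abs_self u).trans hu, by simp⟩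
    · exact ⟨false, -u, by linarith, (neg_le_abs u).trans hu, by simp⟩
  set h := (m : ℝ)⁻¹ with hh
  have hh0 : 0 < h := inv_pos.2 hm'
  set φ' := fun t => φ (sg b * t) with hφ'
  set ψ' := fun t => ψ (sg b * t) with hψ'
  have hbit : ∀ i < m, (greedyApprox φ' h i ≤ φ' ((i + 1) * h) ↔ greedyApprox ψ' h i ≤ ψ' ((i + 1) * h)) := by
    intro i hi
    have := congrFun hc (b, ⟨i, hi⟩)
    simpa only [code, decide_eq_decide] using this
  have hg : ∀ i ≤ m, greedyApprox φ' h i = greedyApprox ψ' h i := by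
    intro i
    induction i with
    | zero => intro _; rfl
    | succ i ih =>
      intro hi
      have h1 := ih (by omega)
      have h2 := hbit i (by omega)
      simp only [greedyApprox, h1] at h2 ⊢
      simp only [h2]
  have hφ0 : φ' 0 = 0 := by simp [hφ', h0]
  have hψ0 : ψ' 0 = 0 := by simp [hψ', h0']
  obtain ⟨i, hi, hi1, hi2⟩ : ∃ i < m, (i : ℝ) * h ≤ t ∧ t ≤ (i + 1) * h := by
    rcases ht1.lt_or_eq with h1 | h1
    · have hf : ⌊t * m⌋₊ < m := by
        rw [Nat.floor_lt (by positivity)]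
        nlinarith
      refine ⟨⌊t * m⌋₊, hf, ?_, ?_⟩
      · rw [hh, ← div_eq_mul_inv, div_le_iff₀ hm']
        exact Nat.floor_le (by positivity)
      · rw [hh, ← div_eq_mul_inv, le_div_iff₀ hm']
        exact (Nat.lt_floor_add_one _).le
    · refine ⟨m - 1, by omega, ?_, ?_⟩
      · rw [hh, ← div_eq_mul_inv, div_le_iff₀ hm', h1, Nat.cast_sub hm]
        push_cast; linarith
      · rw [hh, ← div_eq_mul_inv, le_div_iff₀ hm', h1, Nat.cast_sub hm]
        push_cast; linarith
  have e1 := greedyApprox_line (hφ.comp_sg b) hφ0 hh0.le i hi1 hi2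
  have e2 := greedyApprox_line (hψ.comp_sg b) hψ0 hh0.le i hi1 hi2
  have h2 := hbit i hi
  have h1 := hg i hi.le
  simp only [hφ', hψ'] at h1 h2
  simp only [h1] at h2 e1
  simp only [h2] at e1
  rw [abs_le] at e1 e2 ⊢
  rw [show 2 / (m : ℝ) = 2 * h by rw [hh]; ring]
  constructor <;> linarith

variable {X : Type*} [MeasurableSpace X] {J E : Type*} [Fintype J] [Nonempty J]
  [Fintype E] [Nonempty E]

omit [MeasurableSpace X] in
lemma uavg_fmax_peelR_le {n : ℕ} (hn : 0 < n) (x : Fin n → X) {w : J → X → ℝ}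
    {e : E → X → ℝ} (he : ∀ c z, |e c z| ≤ 1)
    (hwe : ∀ j (s : Fin n → ℝ), ∃ c, ∑ i, s i * w j (x i) ≤ ∑ i, s i * e c (x i)) {H : ℝ}
    (hH : 0 < H) (hE : Real.log (Fintype.card E) ≤ H) {M : ℕ} {Q : Fin M → Type}
    [∀ k, Fintype (Q k)] [∀ k, DecidableEq (Q k)] (q : ∀ k, J → Q k) (D : Fin M → ℝ)
    (hD0 : ∀ k, 0 ≤ D k) {H' : Fin M → ℝ} (hH' : ∀ k, 0 < H' k)
    (hQ : ∀ k, Real.log (Fintype.card (Q k)) ≤ H' k) :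
    uavg (fun θ : Fin n → Option (Σ k, Q k) → Bool =>
      fmax fun j => ∑ i, peelR (fun j => w j (x i)) q D (θ i) j) ≤
      2 * (Real.sqrt n * Real.sqrt (2 * H)) +
        ∑ k, D k * (Real.sqrt n * Real.sqrt (2 * H' k)) := by
  have hne : ∀ k, Nonempty (Q k) := fun k => ⟨q k (Classical.arbitrary J)⟩
  have hpath : ∀ θ : Fin n → Option (Σ k, Q k) → Bool,
      (fmax fun j => ∑ i, peelR (fun j => w j (x i)) q D (θ i) j) ≤
      2 * (fmax fun c => ∑ i, sg (θ i none) * e c (x i)) +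
        ∑ k, D k * fmax fun p : Q k => ∑ i, sg (θ i (some ⟨k, p⟩)) * 1 := by
    intro θ
    refine fmax_le fun j => ?_
    obtain ⟨c, hc⟩ := hwe j fun i => sg (θ i none)
    have h1 := le_fmax (fun c => ∑ i, sg (θ i none) * e c (x i)) c
    have h2 : ∑ k : Fin M, D k * ∑ i, sg (θ i (some ⟨k, q k j⟩)) * 1 ≤
        ∑ k, D k * fmax fun p : Q k => ∑ i, sg (θ i (some ⟨k, p⟩)) * 1 := sum_le_sum fun k _ =>
      mul_le_mul_of_nonneg_left (le_fmax (fun p : Q k =>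
          ∑ i, sg (θ i (some ⟨k, p⟩)) * 1) _) (hD0 k)
    have h3 : ∑ i, peelR (fun j => w j (x i)) q D (θ i) j =
        2 * ∑ i, sg (θ i none) * w j (x i) +
          ∑ k : Fin M, D k * ∑ i, sg (θ i (some ⟨k, q k j⟩)) * 1 := by
      simp only [peelR, sum_add_distrib, mul_sum, mul_one]
      rw [sum_comm]
      congr 1
      exact sum_congr rfl fun i _ => by ring
    rw [h3]
    linarith
  refine (uavg_mono hpath).trans ?_
  rw [uavg_add, uavg_mul_left, uavg_sum]
  simp_rw [uavg_mul_left]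
  have hA : uavg (fun θ : Fin n → Option (Σ k, Q k) → Bool =>
      fmax fun c => ∑ i, sg (θ i none) * e c (x i)) ≤ Real.sqrt n * Real.sqrt (2 * H) :=
    uavg_fmax_sum_le (Θ := Option (Σ k, Q k) → Bool) hn (fun _ θ => θ none) (fun _ => uavg_exp_coord none)
      (fun c i => e c (x i)) (fun c i => he c _) hH hE
  have hB : ∀ k : Fin M, D k * uavg (fun θ : Fin n → Option (Σ k, Q k) → Bool =>
      fmax fun p : Q k => ∑ i, sg (θ i (some ⟨k, p⟩)) * 1) ≤
      D k * (Real.sqrt n * Real.sqrt (2 * H' k)) := fun k =>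
    mul_le_mul_of_nonneg_left (uavg_fmax_sum_le (Θ := Option (Σ k, Q k) → Bool) hn
      (fun (p : Q k) θ => θ (some ⟨k, p⟩)) (fun p => uavg_exp_coord _) (fun _ _ => 1) (by simp)
      (hH' k) (hQ k)) (hD0 k)
  linarith [sum_le_sum fun k (_ : k ∈ univ) => hB k]

omit [MeasurableSpace X] in
lemma uavg_fmax_class_le {n : ℕ} (hn : 0 < n) (x : Fin n → X) {φ : J → ℝ → ℝ} {w : J → X → ℝ}
    (hφ : ∀ j, Lip1 (φ j)) (hφ0 : ∀ j, φ j 0 = 0) (hw : ∀ j z, |w j z| ≤ 1) {e : E → X → ℝ}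
    (he : ∀ c z, |e c z| ≤ 1)
    (hwe : ∀ j (s : Fin n → ℝ), ∃ c, ∑ i, s i * w j (x i) ≤ ∑ i, s i * e c (x i)) {H : ℝ}
    (hH : 0 < H) (hE : Real.log (Fintype.card E) ≤ H)
    (hcode : ∀ j j', code 8 (φ j) = code 8 (φ j')) (M : ℕ) :
    uavg (fun ε : Fin n → Bool => fmax fun j => ∑ i, sg (ε i) * φ j (w j (x i))) ≤
      Real.sqrt n * (2 * Real.sqrt (2 * H) + 4 * Real.sqrt (2 * Real.log 2)) +
        n * (2 / (8 * 4 ^ M : ℕ)) := by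
  set m : ℕ → ℕ := fun k => 8 * 4 ^ k with hm
  have hmpos : ∀ k, 0 < m k := fun k => by positivity
  set D : Fin M → ℝ := fun k => 2 / m k with hD
  have hD0 : ∀ k, 0 ≤ D k := fun k => by positivity
  have hl2 : 0 < Real.log 2 := Real.log_pos (by norm_num)
  have hstep : ∀ i j j', (∃ k : Fin M, code (m (k + 1)) (φ j) ≠ code (m (k + 1)) (φ j') ∧
      |φ j (w j (x i)) - φ j' (w j' (x i))| ≤ |w j (x i) - w j' (x i)| + D k) ∨
      |φ j (w j (x i)) - φ j' (w j' (x i))| ≤ |w j (x i) - w j' (x i)| + 2 / m M := by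
    intro i j j'
    have key : ∀ k, code (m k) (φ j) = code (m k) (φ j') →
        |φ j (w j (x i)) - φ j' (w j' (x i))| ≤ |w j (x i) - w j' (x i)| + 2 / m k := by
      intro k hk
      have h1 := code_close (hmpos k) (hφ j) (hφ j') (hφ0 j) (hφ0 j') hk (hw j' (x i))
      have h2 := hφ j (w j (x i)) (w j' (x i))
      have h3 := abs_sub_le (φ j (w j (x i))) (φ j (w j' (x i))) (φ j' (w j' (x i)))
      linarith
    by_cases hall : ∀ k ≤ M, code (m k) (φ j) = code (m k) (φ j')
    · exact Or.inr (key M (hall M le_rfl))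
    · left
      push Not at hall
      classical
      set k := Nat.find hall with hkdef
      obtain ⟨hkM, hk⟩ := Nat.find_spec hall
      have hk0 : k ≠ 0 := by
        intro h0
        rw [← hkdef, h0] at hk
        exact hk (hcode j j')
      obtain ⟨k', hk'⟩ := Nat.exists_eq_succ_of_ne_zero hk0
      have hprev : code (m k') (φ j) = code (m k') (φ j') := by
        by_contra hne
        exact Nat.find_min hall (m := k') (by omega) ⟨by omega, hne⟩
      refine ⟨⟨k', by omega⟩, ?_, key k' hprev⟩
      rw [← hkdef, hk'] at hk
      exact hk
  have hpeel := uavg_fmax_peel (Q := fun k : Fin M => (Bool × Fin (m (k + 1)) → Bool))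
    (fun i j => φ j (w j (x i))) (fun i j => w j (x i)) (fun k j => code (m (k + 1)) (φ j)) D
    (τ := 2 / m M) (by positivity) hstep
  refine hpeel.trans (add_le_add ?_ le_rfl)
  refine (uavg_fmax_peelR_le hn x he hwe hH hE (fun (k : Fin M) j => code (m (k + 1)) (φ j)) D
    hD0 (H' := fun k => (4 * 2 ^ ((k : ℕ) + 1)) ^ 2 * Real.log 2) (fun k => by positivity)
    fun k => ?_).trans ?_
  · simp only [Fintype.card_fun, Fintype.card_bool, Fintype.card_prod, Fintype.card_fin]
    rw [Nat.cast_pow, Real.log_pow]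
    refine le_of_eq ?_
    simp only [hm]
    push_cast
    rw [show (4 : ℝ) ^ ((k : ℕ) + 1) = (2 ^ ((k : ℕ) + 1)) ^ 2 by
      rw [← pow_mul, mul_comm, pow_mul]; norm_num]
    ring
  have hB : ∀ k : Fin M, D k * (Real.sqrt n *
      Real.sqrt (2 * ((4 * 2 ^ ((k : ℕ) + 1)) ^ 2 * Real.log 2))) ≤
      Real.sqrt n * Real.sqrt (2 * Real.log 2) * (2 * (1 / 2) ^ (k : ℕ)) := by
    intro k
    rw [show 2 * ((4 * 2 ^ ((k : ℕ) + 1)) ^ 2 * Real.log 2) =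
      (4 * 2 ^ ((k : ℕ) + 1)) ^ 2 * (2 * Real.log 2) by ring,
      Real.sqrt_mul (by positivity), Real.sqrt_sq (by positivity)]
    refine le_of_eq ?_
    simp only [hD, hm]
    push_cast
    rw [show (4 : ℝ) ^ (k : ℕ) = (2 ^ (k : ℕ)) ^ 2 by
          rw [← pow_mul, mul_comm, pow_mul]; norm_num, one_div, inv_pow]
    field_simp
    ring
  have hC : ∑ k : Fin M, (2 * (1 / 2 : ℝ) ^ (k : ℕ)) ≤ 4 := by
    rw [Fin.sum_univ_eq_sum_range (fun k => 2 * (1 / 2 : ℝ) ^ k), ← mul_sum,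
      geom_sum_eq (by norm_num)]
    have h1 : (0 : ℝ) ≤ (1 / 2) ^ M := by positivity
    have h2 : ((1 / 2 : ℝ) ^ M - 1) / (1 / 2 - 1) = 2 * (1 - (1 / 2) ^ M) := by ring
    linarith
  have hB' := sum_le_sum fun k (_ : k ∈ univ) => hB k
  rw [← mul_sum] at hB'
  have hC' := mul_le_mul_of_nonneg_left hC
    (show 0 ≤ Real.sqrt n * Real.sqrt (2 * Real.log 2) by positivity)
  linarith

omit [MeasurableSpace X] [Nonempty J] in
/-- Rademacher complexity of compositions with Lipschitz functions, by splitting into classes and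
peeling. -/
lemma dom_radZ_peel {n : ℕ} (hn : 0 < n) (x : Fin n → X) {φ : J → ℝ → ℝ} {w : J → X → ℝ}
    (hφ : ∀ j, Lip1 (φ j)) (hφ0 : ∀ j, φ j 0 = 0) (hw : ∀ j z, |w j z| ≤ 1) {e : E → X → ℝ}
    (he : ∀ c z, |e c z| ≤ 1)
    (hwe : ∀ j (s : Fin n → ℝ), ∃ c, ∑ i, s i * w j (x i) ≤ ∑ i, s i * e c (x i)) {H : ℝ}
    (hH : 0 < H) (hE : Real.log (Fintype.card E) ≤ H) {r : ℝ} (hr : 0 < r) :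
    Dom (unif (Fin n → Bool)) (fun j => radZ x fun z => φ j (w j z))
      (2 * Real.sqrt (2 * H) + 8 * Real.sqrt (2 * Real.log 2) + r) := by
  have hn' : (0 : ℝ) < n := by exact_mod_cast hn
  have hsn : 0 < Real.sqrt n := Real.sqrt_pos.2 hn'
  have hss := Real.mul_self_sqrt hn'.le
  have hl2 : 0 < Real.log 2 := Real.log_pos (by norm_num)
  set a := 2 * Real.sqrt (2 * H) + 4 * Real.sqrt (2 * Real.log 2) + r with ha
  obtain ⟨M, hM⟩ : ∃ M : ℕ, Real.sqrt n * (2 / (8 * 4 ^ M : ℕ)) ≤ r := by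
    obtain ⟨M, hM⟩ := pow_unbounded_of_one_lt (Real.sqrt n * 2 / r) (show (1 : ℝ) < 4 by norm_num)
    refine ⟨M, ?_⟩
    push_cast
    rw [← mul_div_assoc, div_le_iff₀ (by positivity)]
    rw [div_lt_iff₀ hr] at hM
    nlinarith [mul_pos hr (show (0 : ℝ) < 4 ^ M by positivity)]
  have hφ1 : ∀ j z, |φ j (w j z)| ≤ 1 := fun j z => by
    have := hφ j (w j z) 0
    rw [hφ0, sub_zero, sub_zero] at this
    exact this.trans (hw j z)
  classical
  have hclass : ∀ q : Bool × Fin 8 → Bool, ∀ l : ℝ, 0 < l → (∃ j, code 8 (φ j) = q) →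
      ∃ S : (Fin n → Bool) → ℝ, (∀ ε, 0 < S ε) ∧ uavg S ≤ Real.exp (l ^ 2 / 2) ∧
        ∀ j, code 8 (φ j) = q → ∀ ε, Real.exp (l * (radZ x (fun z => φ j (w j z)) ε - a)) ≤ S ε := by
    rintro q l hl ⟨j₀, hj₀⟩
    have : Nonempty {j // code 8 (φ j) = q} := ⟨⟨j₀, hj₀⟩⟩
    set Y : (Fin n → Bool) → ℝ := fun ε =>
      fmax fun j : {j // code 8 (φ j) = q} => radZ x (fun z => φ j (w j z)) ε with hY
    have hYa : uavg Y ≤ a := by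
      have h1 := uavg_fmax_class_le (J := {j // code 8 (φ j) = q}) hn x (φ := fun j => φ j)
        (w := fun j => w j) (fun j => hφ j) (fun j => hφ0 j) (fun j => hw j) he (fun j => hwe j) hH hE
        (fun j j' => j.2.trans j'.2.symm) M
      have h2 : Y = fun ε => (Real.sqrt n)⁻¹ * fmax fun j : {j // code 8 (φ j) = q} =>
          ∑ i, sg (ε i) * φ j (w j (x i)) := by
        ext ε
        rw [← fmax_mul_left (inv_nonneg.2 hsn.le)]
        rfl
      rw [h2, uavg_mul_left, inv_mul_le_iff₀ hsn]
      refine h1.trans ?_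
      have h3 := mul_le_mul_of_nonneg_left hM hsn.le
      rw [← mul_assoc, hss] at h3
      rw [ha]
      linarith
    have hbd : ∀ (ε : Fin n → Bool) i b, |Y ε - Y (Function.update ε i b)| ≤
        2 * (Real.sqrt n)⁻¹ := by
      intro ε i b
      refine abs_fmax_sub_le fun j => ?_
      rw [radZ, radZ, ← mul_sub, ← sum_sub_distrib, sum_eq_single i]
      · rw [abs_mul, abs_of_pos (inv_pos.2 hsn), mul_comm]
        refine mul_le_mul_of_nonneg_right ?_ (inv_pos.2 hsn).le
        refine (abs_sub _ _).trans ?_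
        rw [abs_mul, abs_mul, abs_sg, abs_sg]
        linarith [hφ1 j (x i)]
      · intro k _ hk
        rw [Function.update_of_ne hk, sub_self]
      · simp
    refine ⟨fun ε => Real.exp (-(l * a)) * Real.exp (l * Y ε), fun ε => by positivity, ?_, ?_⟩
    · have h1 := uavg_exp_boundedDiff (Real.sqrt n)⁻¹ l n Y hbd
      rw [uavg_mul_left]
      refine (mul_le_mul_of_nonneg_left h1 (Real.exp_pos _).le).trans ?_
      rw [← Real.exp_add, Real.exp_le_exp, mul_pow, inv_pow, Real.sq_sqrt hn'.le]
      have h2 : (n : ℝ) * (l ^ 2 * (n : ℝ)⁻¹) = l ^ 2 := by field_simp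
      rw [h2]
      nlinarith [mul_le_mul_of_nonneg_left hYa hl.le]
    · intro j hj ε
      simp only
      rw [← Real.exp_add, Real.exp_le_exp]
      have := le_fmax (fun j : {j // code 8 (φ j) = q} => radZ x (fun z => φ j (w j z)) ε) ⟨j, hj⟩
      simp only at this
      nlinarith [mul_le_mul_of_nonneg_left this hl.le]
  have hD : Dom (unif (Fin n → Bool)) (fun j ε => radZ x (fun z => φ j (w j z)) ε - a)
      (1 * Real.sqrt (2 * (16 * Real.log 2))) := by
    refine dom_of_subgaussian (by positivity) one_pos fun l hl => ?_
    choose! S hS0 hS1 hS2 using fun q => hclass q l hl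
    refine ⟨fun ε => ∑ q, if ∃ j, code 8 (φ j) = q then S q ε else 0, Integrable.of_finite, ?_, ?_⟩
    · rw [integral_unif, uavg_sum]
      calc _ ≤ ∑ _q : Bool × Fin 8 → Bool, Real.exp (l ^ 2 / 2) := by
            refine sum_le_sum fun q _ => ?_
            by_cases hq : ∃ j, code 8 (φ j) = q
            · simp only [hq, if_true]
              exact hS1 q hq
            · simp only [hq, if_false]
              rw [uavg_const]
              positivity
        _ = Real.exp (16 * Real.log 2 + (l * 1) ^ 2 / 2) := by
            rw [Real.exp_add, mul_comm 16, ← Real.rpow_def_of_pos (by norm_num)]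
            norm_num
    · intro j ε
      have h1 : (if ∃ j', code 8 (φ j') = code 8 (φ j) then S (code 8 (φ j)) ε else 0) ≤
          ∑ q, if ∃ j, code 8 (φ j) = q then S q ε else 0 := by
        refine single_le_sum (f := fun q => if ∃ j, code 8 (φ j) = q then S q ε else 0)
          (fun q _ => ?_) (mem_univ _)
        split_ifs with hq
        · exact (hS0 q hq ε).le
        · exact le_rfl
      rw [if_pos ⟨j, rfl⟩] at h1
      exact (hS2 _ ⟨j, rfl⟩ j rfl ε).trans h1
  have h2 := hD.add (dom_const (P := unif (Fin n → Bool)) (h := fun (_ : J) _ => a) (c := a)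
    fun _ _ => le_rfl)
  refine (h2.mono (fun j => ⟨j, fun ε => by simp⟩) ?_)
  rw [show 2 * (16 * Real.log 2) = 4 ^ 2 * (2 * Real.log 2) by ring,
    Real.sqrt_mul (by positivity), Real.sqrt_sq (by positivity), ha]
  linarith

end GridTD

namespace GridTD

lemma one_add_sq_div_two_le (x : ℝ) : 2 + x ^ 2 ≤ Real.exp x + Real.exp (-x) := by
  have h1 : |x / 2| ≤ Real.sinh |x / 2| := Real.self_le_sinh_iff.2 (abs_nonneg _)
  have h2 := pow_le_pow_left₀ (abs_nonneg _) h1 2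
  rw [sq_abs, ← Real.abs_sinh, sq_abs] at h2
  have h3 : (Real.exp (x / 2)) ^ 2 = Real.exp x := by
    rw [← Real.exp_nat_mul]; congr 1; push_cast; ring
  have h4 : (Real.exp (-(x / 2))) ^ 2 = Real.exp (-x) := by
    rw [← Real.exp_nat_mul]; congr 1; push_cast; ring
  have h5 : Real.exp (x / 2) * Real.exp (-(x / 2)) = 1 := by
    rw [← Real.exp_add]; simp
  rw [Real.sinh_eq] at h2
  nlinarith

variable {Ω X : Type*} [MeasurableSpace Ω] [MeasurableSpace X] {P : Measure Ω}
  [IsProbabilityMeasure P] {Z : (X → ℝ) → Ω → ℝ} {C : ℝ}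

omit [IsProbabilityMeasure P] in
lemma SubG.integrable [IsFiniteMeasure P] (hZ : SubG P Z C) {h : X → ℝ} (hh : BM h) :
    Integrable (Z h) P := by
  obtain ⟨h1, c, hc⟩ := id hh
  exact Integrable.of_bound (hZ.meas hh).aestronglyMeasurable _
    (Filter.Eventually.of_forall (hZ.bound h1 hc))

lemma SubG.integral_le (hZ : SubG P Z C) {h : X → ℝ} (hm : Measurable h) (hc : ∀ x, |h x| ≤ 1) :
    ∫ ω, Z h ω ∂P ≤ 1 / 100 := by
  have hh : BM h := ⟨hm, 1, hc⟩
  have h1 := hZ.mgf hm hc (1 / 100)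
  have h2 : ∫ ω, ((1 / 100) * Z h ω + 1) ∂P ≤ ∫ ω, Real.exp (1 / 100 * Z h ω) ∂P :=
    integral_mono (((hZ.integrable hh).const_mul _).add (integrable_const _))
      (hZ.integrable_exp hh _) fun ω => Real.add_one_le_exp _
  rw [integral_add ((hZ.integrable hh).const_mul _) (integrable_const _), integral_const_mul] at h2
  have h3 : Real.exp (((1 / 100 : ℝ) * 1) ^ 2 / 2) ≤ 1 + 1 / 10000 := by
    have h4 := Real.one_sub_le_exp_neg (((1 / 100 : ℝ) * 1) ^ 2 / 2)
    rw [Real.exp_neg] at h4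
    have h5 := Real.exp_pos (((1 / 100 : ℝ) * 1) ^ 2 / 2)
    rw [le_inv_comm₀ (by norm_num) h5] at h4
    refine h4.trans (by norm_num)
  simp only [integral_const, probReal_univ, smul_eq_mul, mul_one] at h2
  linarith

lemma SubG.integral_abs_le (hZ : SubG P Z C) {h : X → ℝ} (hm : Measurable h)
    (hc : ∀ x, |h x| ≤ 1) : ∫ ω, |Z h ω| ∂P ≤ 101 / 100 := by
  have hh : BM h := ⟨hm, 1, hc⟩
  have h1 := hZ.mgf hm hc (1 / 10)
  have h1' := hZ.mgf hm hc (-(1 / 10))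
  have h2 : ∫ ω, |Z h ω| ∂P ≤ ∫ ω, (50 * (Real.exp (1 / 10 * Z h ω) +
      Real.exp (-(1 / 10) * Z h ω)) + (1 / 2 - 100)) ∂P :=
    integral_mono (hZ.integrable hh).abs
      ((((hZ.integrable_exp hh _).add (hZ.integrable_exp hh _)).const_mul _).add
        (integrable_const _)) fun ω => by
        have h3 := one_add_sq_div_two_le (1 / 10 * Z h ω)
        rw [← neg_mul] at h3
        have h4 := sq_abs (Z h ω)
        simp only
        nlinarith [sq_nonneg (|Z h ω| - 1)]
  have i1 := hZ.integrable_exp hh (1 / 10)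
  have i2 := hZ.integrable_exp hh (-(1 / 10))
  have i3 : Integrable (fun ω => 50 * (Real.exp (1 / 10 * Z h ω) +
      Real.exp (-(1 / 10) * Z h ω))) P := (i1.add i2).const_mul _
  rw [integral_add i3 (integrable_const _), integral_const_mul, integral_add i1 i2] at h2
  have h3 : Real.exp (((1 / 10 : ℝ) * 1) ^ 2 / 2) ≤ 200 / 199 := by
    have h4 := Real.one_sub_le_exp_neg (((1 / 10 : ℝ) * 1) ^ 2 / 2)
    rw [Real.exp_neg] at h4
    have h5 := Real.exp_pos (((1 / 10 : ℝ) * 1) ^ 2 / 2)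
    rw [le_inv_comm₀ (by norm_num) h5] at h4
    refine h4.trans (by norm_num)
  have h3' : Real.exp ((-(1 / 10 : ℝ) * 1) ^ 2 / 2) ≤ 200 / 199 := by
    rwa [show ((-(1 / 10 : ℝ)) * 1) ^ 2 = ((1 / 10) * 1) ^ 2 by ring]
  simp only [integral_const, probReal_univ, smul_eq_mul] at h2
  linarith

/-- Maximal inequality for the process `Z` on compositions of functions in `𝒲` with `1`-Lipschitz
functions vanishing at the origin. -/
def ProcBound (P : Measure Ω) (Z : (X → ℝ) → Ω → ℝ) (𝒲 : Set (X → ℝ)) (A : ℝ) : Prop :=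
  ∀ (J : Type) [Fintype J] [Nonempty J] (φ : J → ℝ → ℝ) (w : J → X → ℝ), (∀ j, Lip1 (φ j)) →
    (∀ j, φ j 0 = 0) → (∀ j, w j ∈ 𝒲) → Dom P (fun j => Z fun x => φ j (w j x)) A

/-- Affine combinations of compositions of functions in `𝒲` with `1`-Lipschitz functions vanishing
at the origin. -/
def Rep (𝒲 : Set (X → ℝ)) (κ β₀ : ℝ) (f : X → ℝ) : Prop :=
  ∃ (m : ℕ) (c : ℝ) (a β : Fin m → ℝ) (φ : Fin m → ℝ → ℝ) (w : Fin m → X → ℝ),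
    0 ≤ c ∧ c ≤ 1 ∧ (∀ i, 0 ≤ a i) ∧ ∑ i, a i ≤ κ ∧ (∀ i, |β i| ≤ β₀) ∧ (∀ i, Lip1 (φ i)) ∧
    (∀ i, φ i 0 = 0) ∧ (∀ i, w i ∈ 𝒲) ∧ ∀ x, f x = c + ∑ i, a i * (φ i (w i x) + β i)

/-- All members are measurable with values in `[-1, 1]`. -/
def UnitClass (𝒲 : Set (X → ℝ)) : Prop := 𝒲.Nonempty ∧ ∀ w ∈ 𝒲, Measurable w ∧ ∀ x, |w x| ≤ 1

omit [MeasurableSpace X] [IsProbabilityMeasure P] in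
lemma dom_single {J : Type*} {Y : Ω → ℝ} (hY : Integrable Y P) {c : ℝ} (h : ∫ ω, Y ω ∂P ≤ c) :
    Dom P (fun _ : J => Y) c := ⟨Y, hY, fun _ _ => le_rfl, h⟩

lemma UnitClass.bm {𝒲 : Set (X → ℝ)} (h𝒲 : UnitClass 𝒲) {w : X → ℝ} (hw : w ∈ 𝒲) : BM w :=
  ⟨(h𝒲.2 w hw).1, 1, (h𝒲.2 w hw).2⟩

lemma Rep.bm {𝒲 : Set (X → ℝ)} (h𝒲 : UnitClass 𝒲) {κ β₀ : ℝ} {f : X → ℝ} (hf : Rep 𝒲 κ β₀ f) :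
    BM f := by
  obtain ⟨m, c, a, β, φ, w, -, -, -, -, -, hφ, -, hw, hx⟩ := hf
  rw [funext hx]
  exact (BM.const c).add (BM.sum _ fun i _ => (((h𝒲.bm (hw i)).comp (hφ i)).add (BM.const _)).smul _)

lemma ProcBound.rep {𝒲 : Set (X → ℝ)} {A κ β₀ : ℝ} (H : ProcBound P Z 𝒲 A) (hZ : SubG P Z C)
    (h𝒲 : UnitClass 𝒲) (hκ : 0 ≤ κ) (hβ₀ : 0 ≤ β₀) {J : Type} [Fintype J]
    {f : J → X → ℝ} (hf : ∀ j, Rep 𝒲 κ β₀ (f j)) :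
    Dom P (fun j => Z (f j)) (51 / 100 + κ * (A + 101 / 100 * β₀)) := by
  choose m c a β φ w hc0 hc1 ha hκa hβ hφ hφ0 hw hx using hf
  obtain ⟨w₀, hw₀⟩ := h𝒲.1
  set e := Z fun _ => 1 with he
  have hone : BM (fun _ : X => (1 : ℝ)) := BM.const 1
  have hei : Integrable e P := hZ.integrable hone
  have he1 : ∫ ω, e ω ∂P ≤ 1 / 100 := hZ.integral_le measurable_const (by simp)
  have he2 : ∫ ω, |e ω| ∂P ≤ 101 / 100 := hZ.integral_abs_le measurable_const (by simp)
  have hcomp : ∀ j i, BM fun x => φ j i (w j i x) := fun j i => (h𝒲.bm (hw j i)).comp (hφ j i)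
  have hexp : ∀ j ω, Z (f j) ω = c j * e ω + ∑ i, a j i * (Z (fun x => φ j i (w j i x)) ω +
      β j i * e ω) := by
    intro j ω
    rw [show f j = fun x => c j * 1 + ∑ i, a j i * (φ j i (w j i x) + β j i * 1) from
      funext fun x => by simp only [hx, mul_one]]
    rw [hZ.add (hone.smul _) (BM.sum _ fun i _ => ((hcomp j i).add (hone.smul _)).smul _),
      hZ.smul hone, hZ.sum _ _ fun i _ => (hcomp j i).add (hone.smul _)]
    congr 1
    refine sum_congr rfl fun i _ => ?_
    rw [hZ.add (hcomp j i) (hone.smul _), hZ.smul hone]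
  have hD := H (Option (Σ j, Fin (m j)))
    (fun o => o.elim (fun _ => 0) fun p => φ p.1 p.2) (fun o => o.elim w₀ fun p => w p.1 p.2)
    (by rintro (_ | p); exacts [fun s t => by simp, hφ _ _])
    (by rintro (_ | p); exacts [rfl, hφ0 _ _])
    (by rintro (_ | p); exacts [hw₀, hw _ _])
  have hD2 : Dom P (fun j ω => ∑ i, a j i * Z (fun x => φ j i (w j i x)) ω) (κ * A) :=
    hD.hull none (fun ω => hZ.zero ω) hκ fun j => ⟨m j, a j, fun i => some ⟨j, i⟩, ha j, hκa j,
      fun ω => le_rfl⟩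
  have hD3 : Dom P (fun _ : J => fun ω => 1 / 2 * e ω + (1 / 2 + κ * β₀) * |e ω|)
      (51 / 100 + κ * (101 / 100 * β₀)) := by
    refine dom_single ((hei.const_mul _).add (hei.abs.const_mul _)) ?_
    change ∫ ω, (1 / 2 * e ω + (1 / 2 + κ * β₀) * |e ω|) ∂P ≤ _
    rw [integral_add (hei.const_mul _) (hei.abs.const_mul _), integral_const_mul,
      integral_const_mul]
    have h1 : 0 ≤ 1 / 2 + κ * β₀ := by positivity
    nlinarith [mul_le_mul_of_nonneg_left he2 h1]
  refine (hD2.add hD3).mono (fun j => ⟨j, fun ω => ?_⟩) (by linarith)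
  rw [hexp]
  have h1 : c j * e ω ≤ 1 / 2 * e ω + 1 / 2 * |e ω| := by
    have := neg_abs_le (e ω)
    have := le_abs_self (e ω)
    nlinarith [hc0 j, hc1 j]
  have h2 : ∑ i, a j i * (β j i * e ω) ≤ κ * β₀ * |e ω| := by
    calc ∑ i, a j i * (β j i * e ω) ≤ ∑ i, a j i * (β₀ * |e ω|) := by
          refine sum_le_sum fun i _ => mul_le_mul_of_nonneg_left ?_ (ha j i)
          refine (le_abs_self _).trans ?_
          rw [abs_mul]
          exact mul_le_mul_of_nonneg_right (hβ j i) (abs_nonneg _)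
      _ = (∑ i, a j i) * (β₀ * |e ω|) := by rw [sum_mul]
      _ ≤ κ * (β₀ * |e ω|) := mul_le_mul_of_nonneg_right (hκa j) (by positivity)
      _ = _ := by ring
  simp only [mul_add, sum_add_distrib]
  linarith

variable {𝒟 : Measure X} [IsProbabilityMeasure 𝒟]

omit [MeasurableSpace X] in
lemma dom_radZ_contraction {n : ℕ} (x : Fin n → X) {J : Type*} [Fintype J] [Nonempty J]
    {p a : J → X → ℝ} (h : ∀ i j k, |p j (x i) - p k (x i)| ≤ |a j (x i) - a k (x i)|) {c : ℝ}
    (H : Dom (unif (Fin n → Bool)) (fun j => radZ x (a j)) c) :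
    Dom (unif (Fin n → Bool)) (fun j => radZ x (p j)) c := by
  have h1 := uavg_fmax_le_of_dom H
  refine dom_of_uavg_fmax_le (le_trans ?_ h1)
  have h2 : ∀ g : J → X → ℝ, (fun ε : Fin n → Bool => fmax fun j => radZ x (g j) ε) = fun ε =>
      (Real.sqrt n)⁻¹ * fmax fun j => ∑ i, sg (ε i) * g j (x i) := by
    intro g
    ext ε
    rw [← fmax_mul_left (inv_nonneg.2 (Real.sqrt_nonneg _))]
    rfl
  rw [h2, h2, uavg_mul_left, uavg_mul_left]
  exact mul_le_mul_of_nonneg_left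
    (uavg_contraction (fun i j => p j (x i)) (fun i j => a j (x i)) h)
    (inv_nonneg.2 (Real.sqrt_nonneg _))

lemma procBound_empZ_of_radZ {n : ℕ} (hn : 0 < n) {𝒲 : Set (X → ℝ)} {A : ℝ} (h𝒲 : UnitClass 𝒲)
    (H : ∀ x : Fin n → X, ProcBound (unif (Fin n → Bool)) (radZ x) 𝒲 A) {s : X → ℝ}
    (hs : Measurable s) (hs1 : ∀ x, |s x| ≤ 1) :
    ProcBound (Measure.pi fun _ : Fin n => 𝒟) (empZ 𝒟 n s) 𝒲 (2 * A) := by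
  intro J _ _ φ w hφ hφ0 hw
  have h1 := dom_symmetrization (𝒟 := 𝒟) hn (g := fun j x => s x * φ j (w j x))
    (fun j => BM.mul ⟨hs, 1, hs1⟩ ((h𝒲.bm (hw j)).comp (hφ j)))
    (c := A) fun x => dom_radZ_contraction x (fun i j k => ?_) (H x J φ w hφ hφ0 hw)
  · refine h1.mono (fun j => ⟨j, fun ω => le_of_eq ?_⟩) le_rfl
    simp only [empZ, one_mul]
  · rw [← mul_sub, abs_mul]
    exact mul_le_of_le_one_left (abs_nonneg _) (hs1 _)

lemma dom_loss {n : ℕ} (hn : 0 < n) {𝒲 : Set (X → ℝ)} {AR AL κ β₀ : ℝ} (h𝒲 : UnitClass 𝒲)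
    (HR : ∀ x : Fin n → X, ProcBound (unif (Fin n → Bool)) (radZ x) 𝒲 AR)
    (HL : ∀ s : X → ℝ, Measurable s → (∀ x, |s x| ≤ 1) →
      ProcBound (Measure.pi fun _ : Fin n => 𝒟) (empZ 𝒟 n s) 𝒲 AL)
    (hκ : 0 ≤ κ) (hβ₀ : 0 ≤ β₀) {y : X → ℝ} (hy : Measurable y) (hy0 : ∀ x, 0 ≤ y x)
    (hy1 : ∀ x, y x ≤ 1) {J : Type} [Fintype J] [Nonempty J] {f : J → X → ℝ}
    (hf : ∀ j, Rep 𝒲 κ β₀ (f j)) (hf0 : ∀ j x, 0 ≤ f j x) (hf1 : ∀ j x, f j x ≤ 1) :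
    Dom (Measure.pi fun _ : Fin n => 𝒟)
      (fun j => empZ 𝒟 n (fun _ => 1) fun x => (f j x - y x) ^ 2)
      (154 / 100 + κ * (2 * AR + AL + 303 / 100 * β₀)) := by
  have hfb := fun j => (hf j).bm h𝒲
  have hs : Measurable fun x => 1 - 2 * y x := measurable_const.sub (hy.const_mul 2)
  have hs1 : ∀ x, |1 - 2 * y x| ≤ 1 := fun x => abs_le.2 ⟨by linarith [hy1 x], by linarith [hy0 x]⟩
  have S1 := subG_empZ (𝒟 := 𝒟) hn (s := fun _ => 1) measurable_const (by simp)
  have S2 := subG_empZ (𝒟 := 𝒟) hn hs hs1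
  have h2 := (HL _ hs hs1).rep S2 h𝒲 hκ hβ₀ hf
  have hyb : BM y := ⟨hy, 1, fun x => abs_le.2 ⟨by linarith [hy0 x], hy1 x⟩⟩
  have hqb : ∀ j, BM fun x => f j x * f j x + -1 * f j x := fun j =>
    ((hfb j).mul (hfb j)).add ((hfb j).smul _)
  have h1 := dom_symmetrization (𝒟 := 𝒟) hn hqb
    (c := 51 / 100 + κ * (AR + 101 / 100 * β₀)) fun x =>
      dom_radZ_contraction x (fun i j k => by
        rw [show f j (x i) * f j (x i) + -1 * f j (x i) - (f k (x i) * f k (x i) + -1 * f k (x i)) =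
          (f j (x i) + f k (x i) - 1) * (f j (x i) - f k (x i)) by ring, abs_mul]
        refine mul_le_of_le_one_left (abs_nonneg _) (abs_le.2 ⟨?_, ?_⟩) <;>
          linarith [hf0 j (x i), hf1 j (x i), hf0 k (x i), hf1 k (x i)])
        ((HR x).rep (subG_radZ hn x) h𝒲 hκ hβ₀ hf)
  have h3 : Dom (Measure.pi fun _ : Fin n => 𝒟)
      (fun _ : J => empZ 𝒟 n (fun _ => 1) fun x => y x * y x) (1 / 100) := by
    refine dom_single (S1.integrable (hyb.mul hyb)) (S1.integral_le (hy.mul hy) fun x => ?_)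
    rw [abs_mul]
    have : |y x| ≤ 1 := abs_le.2 ⟨by linarith [hy0 x], hy1 x⟩
    nlinarith [abs_nonneg (y x)]
  refine ((h1.add h2).add h3).mono (fun j => ⟨j, fun ω => le_of_eq ?_⟩) (by linarith)
  have e1 : empZ 𝒟 n (fun x => 1 - 2 * y x) (f j) ω =
      empZ 𝒟 n (fun _ => 1) (fun x => (1 - 2 * y x) * f j x) ω := by simp only [empZ, one_mul]
  rw [e1, ← S1.add (hqb j) (BM.mul ⟨hs, 1, hs1⟩ (hfb j)),
    ← S1.add ((hqb j).add (BM.mul ⟨hs, 1, hs1⟩ (hfb j))) (hyb.mul hyb)]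
  congr 1
  ext x
  ring

end GridTD

namespace GridTD

/-- Piecewise linear interpolation, with `n` pieces of equal length on `[0, 1]`, of the node
values `u`. -/
noncomputable def itp (n : ℕ) (u : ℕ → ℝ) (x : ℝ) : ℝ :=
  (1 - Int.fract ((n : ℝ) * x)) * u (⌊(n : ℝ) * x⌋).toNat +
    Int.fract ((n : ℝ) * x) * u ((⌊(n : ℝ) * x⌋).toNat + 1)

lemma measurable_itp (n : ℕ) (u : ℕ → ℝ) : Measurable (itp n u) := by
  have h1 : Measurable fun x : ℝ => (n : ℝ) * x := measurable_id.const_mul _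
  have h2 : Measurable fun x : ℝ => Int.fract ((n : ℝ) * x) := measurable_fract.comp h1
  have h3 : Measurable fun x : ℝ => u (⌊(n : ℝ) * x⌋).toNat :=
    (measurable_from_top (f := fun k : ℤ => u k.toNat)).comp (Int.measurable_floor.comp h1)
  have h4 : Measurable fun x : ℝ => u ((⌊(n : ℝ) * x⌋).toNat + 1) :=
    (measurable_from_top (f := fun k : ℤ => u (k.toNat + 1))).comp (Int.measurable_floor.comp h1)
  exact ((measurable_const.sub h2).mul h3).add (h2.mul h4)

lemma abs_itp_le {n : ℕ} {u : ℕ → ℝ} (hu : ∀ z, |u z| ≤ 1) (x : ℝ) : |itp n u x| ≤ 1 := by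
  have h0 := Int.fract_nonneg ((n : ℝ) * x)
  have h1 := Int.fract_lt_one ((n : ℝ) * x)
  have a := abs_le.1 (hu (⌊(n : ℝ) * x⌋).toNat)
  have b := abs_le.1 (hu ((⌊(n : ℝ) * x⌋).toNat + 1))
  unfold itp
  rw [abs_le]
  constructor <;> nlinarith

lemma itp_eq_of_mem {n k : ℕ} (u : ℕ → ℝ) {x : ℝ} (h1 : (k : ℝ) ≤ n * x) (h2 : n * x ≤ k + 1) :
    itp n u x = (1 - (n * x - k)) * u k + (n * x - k) * u (k + 1) := by
  rcases h2.lt_or_eq with h2 | h2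
  · have hf : ⌊(n : ℝ) * x⌋ = k := Int.floor_eq_iff.2 ⟨by exact_mod_cast h1, by exact_mod_cast h2⟩
    rw [itp, Int.fract, hf]
    simp
  · have hf : ⌊(n : ℝ) * x⌋ = (k + 1 : ℕ) := by
      rw [h2]; exact_mod_cast Int.floor_natCast (k + 1)
    rw [itp, Int.fract, hf, h2]
    simp

lemma exists_piece {n : ℕ} (hn : 0 < n) {x : ℝ} (h0 : 0 ≤ x) (h1 : x < 1) :
    ∃ k < n, (k : ℝ) / n ≤ x ∧ x < (k + 1) / n := by
  have hn' : (0 : ℝ) < n := by exact_mod_cast hn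
  refine ⟨⌊(n : ℝ) * x⌋₊, ?_, ?_, ?_⟩
  · rw [Nat.floor_lt (by positivity)]
    nlinarith
  · rw [div_le_iff₀ hn', mul_comm x]
    exact Nat.floor_le (by positivity)
  · rw [lt_div_iff₀ hn', mul_comm x]
    exact Nat.lt_floor_add_one _

/-- All breakpoints of piecewise linear functions with at most `N` equal pieces. -/
noncomputable def nodes : ℕ → Finset ℝ
  | 0 => {0, 1}
  | N + 1 => nodes N ∪ (Icc 1 N).image fun j : ℕ => (j : ℝ) / ((N + 1 : ℕ) : ℝ)

lemma zero_mem_nodes (N : ℕ) : (0 : ℝ) ∈ nodes N := by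
  induction N with
  | zero => simp [nodes]
  | succ N ih => exact mem_union_left _ ih

lemma one_mem_nodes (N : ℕ) : (1 : ℝ) ∈ nodes N := by
  induction N with
  | zero => simp [nodes]
  | succ N ih => exact mem_union_left _ ih

lemma card_nodes_le (N : ℕ) : (nodes (N + 1)).card ≤ 2 ^ (N + 1) := by
  induction N with
  | zero =>
    simp [nodes]
  | succ N ih =>
    rw [nodes]
    refine (card_union_le _ _).trans ?_
    have h1 := (card_image_le (s := Icc 1 (N + 1))
      (f := fun j : ℕ => (j : ℝ) / ((N + 1 + 1 : ℕ) : ℝ)))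
    rw [Nat.card_Icc] at h1
    have h2 := Nat.lt_two_pow_self (n := N + 1)
    rw [pow_succ]
    omega

lemma div_mem_nodes {N n j : ℕ} (hn : 0 < n) (hN : n ≤ N) (hj : j ≤ n) :
    (j : ℝ) / n ∈ nodes N := by
  have hn' : (n : ℝ) ≠ 0 := by exact_mod_cast hn.ne'
  rcases Nat.eq_zero_or_pos j with rfl | hj0
  · simpa using zero_mem_nodes N
  rcases hj.lt_or_eq with hj | rfl
  · induction N with
    | zero => omega
    | succ N ih =>
      rcases hN.lt_or_eq with h | rfl
      · exact mem_union_left _ (ih (by omega))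
      · exact mem_union_right _ (mem_image.2 ⟨j, mem_Icc.2 ⟨hj0, by omega⟩, rfl⟩)
  · rw [div_self hn']
    exact one_mem_nodes N

open Classical in
/-- Tent functions of a finite set of nodes. -/
noncomputable def tent (G : Finset ℝ) (t x : ℝ) : ℝ :=
  ∑ p ∈ G, ∑ q ∈ G, if (p ≤ x ∧ x < q ∧ ∀ s ∈ G, s ≤ p ∨ q ≤ s) then
    (if t = p then (q - x) / (q - p) else 0) + (if t = q then (x - p) / (q - p) else 0) else 0

lemma measurable_tent (G : Finset ℝ) (t : ℝ) : Measurable (tent G t) := by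
  classical
  unfold tent
  refine Finset.measurable_sum _ fun p _ => Finset.measurable_sum _ fun q _ => ?_
  refine Measurable.ite ?_ ?_ measurable_const
  · have : {x : ℝ | p ≤ x ∧ x < q ∧ ∀ s ∈ G, s ≤ p ∨ q ≤ s} =
        Set.Ico p q ∩ {_x : ℝ | ∀ s ∈ G, s ≤ p ∨ q ≤ s} := by
      ext x; simp [and_assoc]
    rw [this]
    exact measurableSet_Ico.inter (MeasurableSet.const _)
  · refine Measurable.add ?_ ?_
    · split_ifs
      · exact (measurable_const.sub measurable_id).div_const _
      · exact measurable_const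
    · split_ifs
      · exact (measurable_id.sub measurable_const).div_const _
      · exact measurable_const

lemma tent_nonneg (G : Finset ℝ) (t x : ℝ) : 0 ≤ tent G t x := by
  refine sum_nonneg fun p _ => sum_nonneg fun q _ => ?_
  split_ifs with h h1 h2 h2 <;> first
    | exact le_rfl
    | (obtain ⟨h3, h4, -⟩ := h
       have h5 : 0 < q - p := by linarith
       have h6 : 0 ≤ x - p := by linarith
       have h7 : 0 ≤ q - x := by linarith
       positivity)

lemma sum_tent {G : Finset ℝ} (h0 : (0 : ℝ) ∈ G) (h1 : (1 : ℝ) ∈ G) {x : ℝ} (hx0 : 0 ≤ x)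
    (hx1 : x < 1) : ∃ p q : ℝ, p ≤ x ∧ x < q ∧ (∀ s ∈ G, s ≤ p ∨ q ≤ s) ∧
      ∀ g : ℝ → ℝ, ∑ t ∈ G, tent G t x * g t =
        (q - x) / (q - p) * g p + (x - p) / (q - p) * g q := by
  classical
  obtain ⟨p, hp, hpm⟩ := exists_max_image (G.filter fun s => s ≤ x) id
    ⟨0, mem_filter.2 ⟨h0, hx0⟩⟩
  obtain ⟨q, hq, hqm⟩ := exists_min_image (G.filter fun s => x < s) id
    ⟨1, mem_filter.2 ⟨h1, hx1⟩⟩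
  rw [mem_filter] at hp hq
  have hcon : ∀ s ∈ G, s ≤ p ∨ q ≤ s := fun s hs => by
    rcases le_or_gt s x with h | h
    · exact Or.inl (hpm s (mem_filter.2 ⟨hs, h⟩))
    · exact Or.inr (hqm s (mem_filter.2 ⟨hs, h⟩))
  refine ⟨p, q, hp.2, hq.2, hcon, fun g => ?_⟩
  have htent : ∀ t, tent G t x = (if t = p then (q - x) / (q - p) else 0) +
      (if t = q then (x - p) / (q - p) else 0) := by
    intro t
    unfold tent
    rw [sum_eq_single p, sum_eq_single q, if_pos ⟨hp.2, hq.2, hcon⟩]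
    · intro q' hq' hne
      rw [if_neg]
      rintro ⟨-, h2, h3⟩
      rcases h3 q hq.1 with h | h
      · linarith [hp.2, hq.2]
      · exact hne (le_antisymm h (hqm q' (mem_filter.2 ⟨hq', h2⟩)))
    · exact fun h => absurd hq.1 h
    · intro p' hp' hne
      refine sum_eq_zero fun q' hq' => if_neg ?_
      rintro ⟨h1, h2, h3⟩
      rcases h3 p hp.1 with h | h
      · exact hne (le_antisymm (hpm p' (mem_filter.2 ⟨hp', h1⟩)) h)
      · linarith [hp.2]
    · exact fun h => absurd hp.1 h
  simp only [htent, add_mul, sum_add_distrib, ite_mul, zero_mul, sum_ite_eq', hp.1, hq.1, if_true]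

lemma itp_eq_sum_tent {N n : ℕ} (hn : 0 < n) (hN : n ≤ N) (u : ℕ → ℝ) {x : ℝ} (hx0 : 0 ≤ x)
    (hx1 : x < 1) : itp n u x = ∑ t ∈ nodes N, tent (nodes N) t x * itp n u t := by
  obtain ⟨p, q, hp, hq, hcon, hs⟩ := sum_tent (zero_mem_nodes N) (one_mem_nodes N) hx0 hx1
  obtain ⟨k, hk, hk1, hk2⟩ := exists_piece hn hx0 hx1
  have hn' : (0 : ℝ) < n := by exact_mod_cast hn
  have hp1 : (k : ℝ) / n ≤ p := by
    rcases hcon _ (div_mem_nodes hn hN hk.le) with h | h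
    · exact h
    · linarith
  have hq1 : q ≤ (k + 1) / n := by
    have hm := div_mem_nodes (j := k + 1) hn hN hk
    push_cast at hm
    rcases hcon _ hm with h | h
    · linarith
    · exact h
  have key : ∀ t, (k : ℝ) / n ≤ t → t ≤ (k + 1) / n →
      itp n u t = (1 - (n * t - k)) * u k + (n * t - k) * u (k + 1) := fun t h1 h2 =>
    itp_eq_of_mem u (by rw [div_le_iff₀ hn'] at h1; linarith)
      (by rw [le_div_iff₀ hn'] at h2; linarith)
  rw [hs, key x hk1 hk2.le, key p hp1 (by linarith), key q (by linarith) hq1]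
  have hpq : q - p ≠ 0 := by linarith
  field_simp
  ring

lemma sum_tent_eq_one (N : ℕ) {x : ℝ} (hx0 : 0 ≤ x) (hx1 : x < 1) :
    ∑ t ∈ nodes N, tent (nodes N) t x = 1 := by
  obtain ⟨p, q, hp, hq, -, hs⟩ := sum_tent (zero_mem_nodes N) (one_mem_nodes N) hx0 hx1
  have := hs fun _ => 1
  simp only [mul_one] at this
  rw [this, ← add_div]
  have hpq : q - p ≠ 0 := by linarith
  field_simp
  ring

end GridTD

namespace GridTD

/-- Absolutely convex combinations of products of piecewise linear interpolants of node values in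
`[-1, 1]`. -/
def gridW (D N : ℕ) : Set ((Fin D → ℝ) → ℝ) :=
  {w | ∃ (ι : Type) (_ : Fintype ι) (a : ι → ℝ) (n : ι → ℕ) (u : ι → Fin D → ℕ → ℝ),
    ∑ p, |a p| ≤ 1 ∧ (∀ p, 0 < n p ∧ n p ≤ N) ∧ (∀ p d z, |u p d z| ≤ 1) ∧
    ∀ v, w v = ∑ p, a p * ∏ d, itp (n p) (u p d) (v d)}

variable {D N : ℕ} {w : (Fin D → ℝ) → ℝ}

lemma abs_prod_itp_le {n : ℕ} {u : Fin D → ℕ → ℝ} (hu : ∀ d z, |u d z| ≤ 1) (v : Fin D → ℝ) :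
    |∏ d, itp n (u d) (v d)| ≤ 1 := by
  rw [abs_prod]
  exact prod_le_one (fun _ _ => abs_nonneg _) fun d _ => abs_itp_le (hu d) _

lemma abs_le_one_of_mem_gridW (hw : w ∈ gridW D N) (v : Fin D → ℝ) : |w v| ≤ 1 := by
  obtain ⟨ι, _, a, n, u, ha, -, hu, hv⟩ := hw
  rw [hv]
  refine (abs_sum_le_sum_abs _ _).trans (le_trans (sum_le_sum fun p _ => ?_) ha)
  rw [abs_mul]
  exact mul_le_of_le_one_right (abs_nonneg _) (abs_prod_itp_le (hu p) v)

lemma measurable_of_mem_gridW (hw : w ∈ gridW D N) : Measurable w := by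
  obtain ⟨ι, _, a, n, u, -, -, -, hv⟩ := hw
  rw [funext hv]
  refine Finset.measurable_sum _ fun p _ => Measurable.const_mul ?_ _
  exact Finset.measurable_prod _ fun d _ => (measurable_itp _ _).comp (measurable_pi_apply d)

lemma zero_mem_gridW : (fun _ => 0) ∈ gridW D N :=
  ⟨Empty, inferInstance, fun _ => 0, fun _ => 1, fun _ _ _ => 0, by simp, by simp, by simp, by simp⟩

lemma eq_sum_tent_of_mem_gridW (hw : w ∈ gridW D N) {v : Fin D → ℝ}
    (hv : ∀ d, v d ∈ Set.Ico (0 : ℝ) 1) :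
    w v = ∑ c : Fin D → nodes N, (∏ d, tent (nodes N) (c d) (v d)) * w fun d => c d := by
  obtain ⟨ι, _, a, n, u, -, hn, -, h⟩ := hw
  simp only [h, mul_sum]
  rw [sum_comm]
  refine sum_congr rfl fun p _ => ?_
  have h1 : ∀ d, itp (n p) (u p d) (v d) =
      ∑ t : nodes N, tent (nodes N) t (v d) * itp (n p) (u p d) t := fun d => by
    rw [itp_eq_sum_tent (hn p).1 (hn p).2 _ (hv d).1 (hv d).2]
    exact (sum_coe_sort (nodes N) fun t => tent (nodes N) t (v d) * itp (n p) (u p d) t).symm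
  simp only [h1]
  rw [Fintype.prod_sum, mul_sum]
  refine sum_congr rfl fun c _ => ?_
  rw [prod_mul_distrib]
  ring

lemma sum_prod_tent {v : Fin D → ℝ} (hv : ∀ d, v d ∈ Set.Ico (0 : ℝ) 1) :
    ∑ c : Fin D → nodes N, ∏ d, tent (nodes N) (c d) (v d) = 1 := by
  rw [← Fintype.prod_sum fun (d : Fin D) (t : nodes N) => tent (nodes N) t (v d)]
  refine prod_eq_one fun d _ => ?_
  rw [← sum_tent_eq_one N (hv d).1 (hv d).2]
  exact sum_coe_sort (nodes N) fun t => tent (nodes N) t (v d)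

lemma exists_sign_itp {m n : ℕ} (hn : 0 < n) (s x : Fin m → ℝ) (hx : ∀ i, x i ∈ Set.Ico (0 : ℝ) 1)
    {u : ℕ → ℝ} (hu : ∀ z, |u z| ≤ 1) : ∃ b : ℕ → Bool,
      ∑ i, s i * itp n u (x i) ≤ ∑ i, s i * itp n (fun z => sg (b z)) (x i) := by
  have h1 : ∀ i, ∃ c : ℕ → ℝ, ∀ u : ℕ → ℝ, itp n u (x i) = ∑ z ∈ range (n + 1), c z * u z := by
    intro i
    obtain ⟨k, hk, -, -⟩ := exists_piece hn (hx i).1 (hx i).2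
    obtain ⟨k, hk, hk1, hk2⟩ := exists_piece hn (hx i).1 (hx i).2
    have hn' : (0 : ℝ) < n := by exact_mod_cast hn
    rw [div_le_iff₀ hn'] at hk1
    rw [lt_div_iff₀ hn'] at hk2
    refine ⟨fun z => (if z = k then 1 - (n * x i - k) else 0) +
      (if z = k + 1 then n * x i - k else 0), fun u => ?_⟩
    rw [itp_eq_of_mem (k := k) u (by linarith) (by linarith)]
    simp only [add_mul, sum_add_distrib, ite_mul, zero_mul, sum_ite_eq', mem_range,
      show k < n + 1 by omega, show k + 1 < n + 1 by omega, if_true]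
  choose c hc using h1
  have h2 : ∀ u : ℕ → ℝ, ∑ i, s i * itp n u (x i) =
      ∑ z ∈ range (n + 1), (∑ i, s i * c i z) * u z := by
    intro u
    simp only [hc, mul_sum, sum_mul]
    rw [sum_comm]
    simp only [mul_assoc]
  refine ⟨fun z => decide (0 ≤ ∑ i, s i * c i z), ?_⟩
  rw [h2, h2]
  refine sum_le_sum fun z _ => ?_
  refine (le_abs_self _).trans ?_
  rw [abs_mul]
  refine (mul_le_of_le_one_right (abs_nonneg _) (hu z)).trans (le_of_eq ?_)
  by_cases h : 0 ≤ ∑ i, s i * c i z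
  · simp [h, abs_of_nonneg]
  · have h' := h
    push Not at h'
    simp [h, abs_of_neg h']

lemma exists_sign_prod_itp {m n : ℕ} (hn : 0 < n) (s : Fin m → ℝ) (x : Fin m → Fin D → ℝ)
    (hx : ∀ i d, x i d ∈ Set.Ico (0 : ℝ) 1) {u : Fin D → ℕ → ℝ} (hu : ∀ d z, |u d z| ≤ 1) :
    ∃ b : Fin D → ℕ → Bool, ∑ i, s i * ∏ d, itp n (u d) (x i d) ≤
      ∑ i, s i * ∏ d, itp n (fun z => sg (b d z)) (x i d) := by
  classical
  have key : ∀ S : Finset (Fin D), ∃ b : Fin D → ℕ → Bool,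
      ∑ i, s i * ∏ d, itp n (u d) (x i d) ≤ ∑ i, s i *
        ∏ d, itp n (if d ∈ S then fun z => sg (b d z) else u d) (x i d) := by
    intro S
    induction S using Finset.induction_on with
    | empty => exact ⟨fun _ _ => true, by simp⟩
    | insert d₀ S hd ih =>
      obtain ⟨b, hb⟩ := ih
      obtain ⟨b₀, hb₀⟩ := exists_sign_itp hn (fun i => s i * ∏ d ∈ univ.erase d₀,
        itp n (if d ∈ S then fun z => sg (b d z) else u d) (x i d)) (fun i => x i d₀)
        (fun i => hx i d₀) (hu d₀)
      refine ⟨Function.update b d₀ b₀, hb.trans ?_⟩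
      refine le_trans (le_of_eq (sum_congr rfl fun i _ => ?_))
        (hb₀.trans (le_of_eq (sum_congr rfl fun i _ => ?_)))
      · rw [← mul_prod_erase univ _ (mem_univ d₀), if_neg hd]; ring
      · rw [← mul_prod_erase univ (fun d => itp n (if d ∈ insert d₀ S then fun z =>
          sg (Function.update b d₀ b₀ d z) else u d) (x i d)) (mem_univ d₀)]
        simp only [mem_insert_self, if_true, Function.update_self]
        rw [mul_assoc, mul_comm (∏ d ∈ univ.erase d₀, _)]
        congr 2
        refine prod_congr rfl fun d hd' => ?_
        have hne := ne_of_mem_erase hd'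
        rw [Function.update_of_ne hne]
        simp only [mem_insert, hne, false_or]
  simpa using key univ

lemma itp_smul (n : ℕ) (a : ℝ) (u : ℕ → ℝ) (x : ℝ) :
    itp n (fun z => a * u z) x = a * itp n u x := by
  unfold itp; ring

/-- Signed products of interpolants of node values `±1`, equal to `1` at the origin. -/
noncomputable def extremal (D N : ℕ) (e : Bool × Σ n : Fin N, (Fin D → Fin (n + 1) → Bool))
    (v : Fin D → ℝ) : ℝ :=
  sg e.1 * ∏ d, itp (e.2.1 + 1) (fun z => if h : 0 < z ∧ z ≤ (e.2.1 : ℕ) + 1 then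
    sg (e.2.2 d ⟨z - 1, by omega⟩) else 1) (v d)

lemma abs_extremal_le (e : Bool × Σ n : Fin N, (Fin D → Fin (n + 1) → Bool)) (v : Fin D → ℝ) :
    |extremal D N e v| ≤ 1 := by
  rw [extremal, abs_mul, abs_sg, one_mul]
  refine abs_prod_itp_le (fun d z => ?_) v
  split_ifs
  · rw [abs_sg]
  · simp

lemma sg_mul_sg (a b : Bool) : sg a * sg b = sg (a == b) := by
  cases a <;> cases b <;> simp [sg]

lemma exists_prod_sg {D : ℕ} (b : Fin D → Bool) : ∃ b₀, ∏ d, sg (b d) = sg b₀ := by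
  induction D with
  | zero => exact ⟨true, by simp [sg]⟩
  | succ D ih =>
    obtain ⟨b₀, h⟩ := ih fun d => b d.succ
    exact ⟨b 0 == b₀, by rw [Fin.prod_univ_succ, h, sg_mul_sg]⟩

lemma exists_extremal {n : ℕ} (hn : n < N) (b : Fin D → ℕ → Bool) (b₁ : Bool) :
    ∃ e, ∀ v : Fin D → ℝ, (∀ d, v d ∈ Set.Ico (0 : ℝ) 1) →
      sg b₁ * ∏ d, itp (n + 1) (fun z => sg (b d z)) (v d) = extremal D N e v := by
  obtain ⟨b₀, hb₀⟩ := exists_prod_sg fun d => b d 0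
  refine ⟨⟨b₁ == b₀, ⟨n, hn⟩, fun d z => b d 0 == b d (z + 1)⟩, fun v hv => ?_⟩
  rw [extremal, ← sg_mul_sg, mul_assoc, ← hb₀, ← prod_mul_distrib]
  congr 1
  refine prod_congr rfl fun d _ => ?_
  rw [← itp_smul]
  obtain ⟨k, hk, hk1, hk2⟩ := exists_piece n.succ_pos (hv d).1 (hv d).2
  have hn' : (0 : ℝ) < (n.succ : ℕ) := by positivity
  rw [div_le_iff₀ hn'] at hk1
  rw [lt_div_iff₀ hn'] at hk2
  have key : ∀ z ≤ n + 1, sg (b d z) = sg (b d 0) * (if h : 0 < z ∧ z ≤ n + 1 then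
      sg (b d 0 == b d (z - 1 + 1)) else 1) := by
    intro z hz
    rcases Nat.eq_zero_or_pos z with rfl | h
    · simp
    · rw [dif_pos ⟨h, hz⟩, Nat.sub_add_cancel h]
      cases b d 0 <;> cases b d z <;> simp [sg]
  rw [itp_eq_of_mem (k := k) _ (by linarith) (by linarith),
    itp_eq_of_mem (k := k) _ (by linarith) (by linarith)]
  simp only
  rw [key k (by omega), key (k + 1) (by omega)]

lemma exists_extremal_ge {m : ℕ} (hN : 0 < N) (hw : w ∈ gridW D N) (s : Fin m → ℝ)
    (x : Fin m → Fin D → ℝ) (hx : ∀ i d, x i d ∈ Set.Ico (0 : ℝ) 1) :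
    ∃ e, ∑ i, s i * w (x i) ≤ ∑ i, s i * extremal D N e (x i) := by
  obtain ⟨ι, _, a, n, u, ha, hn, hu, h⟩ := hw
  have key : ∀ p, ∃ e, |∑ i, s i * ∏ d, itp (n p) (u p d) (x i d)| ≤
      ∑ i, s i * extremal D N e (x i) := by
    intro p
    obtain ⟨k, hk⟩ := Nat.exists_eq_succ_of_ne_zero (hn p).1.ne'
    have h1 : ∀ b₁ : Bool, ∃ e, sg b₁ * ∑ i, s i * ∏ d, itp (n p) (u p d) (x i d) ≤
        ∑ i, s i * extremal D N e (x i) := by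
      intro b₁
      obtain ⟨b, hb⟩ := exists_sign_prod_itp (hn p).1 (fun i => sg b₁ * s i) x hx (hu p)
      obtain ⟨e, he⟩ := exists_extremal (show k < N by have := (hn p).2; omega) b b₁
      refine ⟨e, ?_⟩
      rw [mul_sum]
      simp only [← mul_assoc]
      refine hb.trans (le_of_eq (sum_congr rfl fun i _ => ?_))
      rw [← he _ (hx i), hk]
      ring
    rcases abs_choice (∑ i, s i * ∏ d, itp (n p) (u p d) (x i d)) with h2 | h2
    · obtain ⟨e, he⟩ := h1 true
      exact ⟨e, by rw [h2]; simpa [sg] using he⟩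
    · obtain ⟨e, he⟩ := h1 false
      exact ⟨e, by rw [h2]; simpa [sg] using he⟩
  have hne : Nonempty (Bool × Σ n : Fin N, (Fin D → Fin (n + 1) → Bool)) :=
    ⟨⟨true, ⟨0, hN⟩, fun _ _ => true⟩⟩
  set M := fmax fun e => ∑ i, s i * extremal D N e (x i) with hM
  obtain ⟨e, he⟩ := exists_fmax fun e => ∑ i, s i * extremal D N e (x i)
  have hM0 : 0 ≤ M := by
    obtain ⟨e₁, he₁⟩ := exists_extremal (D := D) hN (fun _ _ => true) true
    obtain ⟨e₂, he₂⟩ := exists_extremal (D := D) hN (fun _ _ => true) false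
    have a1 := le_fmax (fun e => ∑ i, s i * extremal D N e (x i)) e₁
    have a2 := le_fmax (fun e => ∑ i, s i * extremal D N e (x i)) e₂
    simp only [← he₁ _ (hx _), ← he₂ _ (hx _), sg] at a1 a2
    simp only [mul_neg, neg_mul, sum_neg_distrib, one_mul, Bool.false_eq_true, if_true, if_false]
      at a1 a2
    linarith
  refine ⟨e, ?_⟩
  rw [show (∑ i, s i * extremal D N e (x i)) = M from he ▸ rfl]
  calc ∑ i, s i * w (x i) = ∑ p, a p * ∑ i, s i * ∏ d, itp (n p) (u p d) (x i d) := by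
        simp only [h, mul_sum]
        rw [sum_comm]
        exact sum_congr rfl fun p _ => sum_congr rfl fun i _ => by ring
    _ ≤ ∑ p, |a p| * M := by
        refine sum_le_sum fun p _ => ?_
        refine (le_abs_self _).trans ?_
        rw [abs_mul]
        refine mul_le_mul_of_nonneg_left ?_ (abs_nonneg _)
        obtain ⟨e, he⟩ := key p
        exact he.trans (le_fmax (fun e => ∑ i, s i * extremal D N e (x i)) e)
    _ = (∑ p, |a p|) * M := by rw [sum_mul]
    _ ≤ M := mul_le_of_le_one_left hM0 ha

lemma card_extremal_le (hD : 2 ≤ D) (N : ℕ) :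
    (3 : ℝ) * Fintype.card (Bool × Σ n : Fin N, (Fin D → Fin (n + 1) → Bool)) ≤
      8 * 2 ^ (D * N) := by
  have h1 : Fintype.card (Bool × Σ n : Fin N, (Fin D → Fin (n + 1) → Bool)) =
      2 * ∑ n ∈ range N, 2 ^ ((n + 1) * D) := by
    simp only [Fintype.card_prod, Fintype.card_bool, Fintype.card_sigma, Fintype.card_fun,
      Fintype.card_fin, ← pow_mul]
    rw [Fin.sum_univ_eq_sum_range fun n => 2 ^ ((n + 1) * D)]
  have h2 : 3 * ∑ n ∈ range N, 2 ^ ((n + 1) * D) ≤ 4 * 2 ^ (D * N) := by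
    induction N with
    | zero => simp
    | succ N ih =>
      rw [sum_range_succ, mul_add]
      have h3 : 4 * 2 ^ (D * N) ≤ 2 ^ ((N + 1) * D) := by
        rw [show (N + 1) * D = D + D * N by ring, pow_add]
        exact Nat.mul_le_mul_right _ (Nat.pow_le_pow_right (n := 2) two_pos hD)
      have h4 : 2 ^ (D * (N + 1)) = 2 ^ ((N + 1) * D) := by rw [mul_comm]
      have := ih (by
        simp only [Fintype.card_prod, Fintype.card_bool, Fintype.card_sigma, Fintype.card_fun,
          Fintype.card_fin, ← pow_mul]
        rw [Fin.sum_univ_eq_sum_range fun n => 2 ^ ((n + 1) * D)])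
      omega
  rw [h1]
  have : ((3 * (2 * ∑ n ∈ range N, 2 ^ ((n + 1) * D)) : ℕ) : ℝ) ≤ ((8 * 2 ^ (D * N) : ℕ) : ℝ) := by
    exact_mod_cast (by omega)
  push_cast at this ⊢
  linarith

end GridTD

namespace GridTD

/-- The size of a link of the chaining argument with `ν` free values at scale `2⁻ᵏ`. -/
noncomputable def linkSize (ν k : ℕ) : ℝ :=
  (2 ^ (k + 1))⁻¹ * Real.sqrt (2 * (Real.log 2 * ((k + 1) * ν + 2 ^ (k + 2) - 2)))

lemma growth_le {ν K₀ : ℕ} {B : ℝ} (hB : ((K₀ : ℝ) + 1) * ν + 2 ^ (K₀ + 2) ≤ B * (9 / 4) ^ K₀) (i : ℕ) :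
    (((K₀ + i : ℕ) : ℝ) + 1) * ν + 2 ^ (K₀ + i + 2) ≤ B * (9 / 4) ^ (K₀ + i) := by
  induction i with
  | zero => simpa using hB
  | succ i ih =>
    have h1 : (0 : ℝ) ≤ (K₀ + i : ℕ) * ν := by positivity
    have h2 : (0 : ℝ) ≤ ν := by positivity
    have h3 : (0 : ℝ) < 2 ^ (K₀ + i + 2) := by positivity
    have e1 : (2 : ℝ) ^ (K₀ + (i + 1) + 2) = 2 * 2 ^ (K₀ + i + 2) := by ring
    have e2 : B * (9 / 4 : ℝ) ^ (K₀ + (i + 1)) = 9 / 4 * (B * (9 / 4) ^ (K₀ + i)) := by ring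
    rw [e1, e2]
    push_cast at *
    nlinarith

lemma sqrt_link_le (ν k : ℕ) {r : ℝ} (hr : 0 ≤ r)
    (h : 13863 / 10000 * ((k + 1) * ν + 2 ^ (k + 2) - 2) ≤ r ^ 2) :
    Real.sqrt (2 * (Real.log 2 * ((k + 1) * ν + 2 ^ (k + 2) - 2))) ≤ r := by
  rw [Real.sqrt_le_left hr]
  have h1 : (0 : ℝ) ≤ (k + 1) * ν + 2 ^ (k + 2) - 2 := by
    have h2 : (2 : ℝ) ^ 1 ≤ 2 ^ (k + 2) := pow_le_pow_right₀ (by norm_num) (by omega)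
    have h3 : (0 : ℝ) ≤ (k + 1) * ν := by positivity
    linarith
  have := Real.log_two_lt_d9
  nlinarith

lemma sum_linkSize_le {ν K₀ : ℕ} {r : ℕ → ℝ} {B b : ℝ} (hr : ∀ k < K₀, 0 ≤ r k ∧
      13863 / 10000 * (((k : ℝ) + 1) * ν + 2 ^ (k + 2) - 2) ≤ r k ^ 2)
    (hB : ((K₀ : ℝ) + 1) * ν + 2 ^ (K₀ + 2) ≤ B * (9 / 4) ^ K₀) (hb : 0 ≤ b)
    (hbB : 13863 / 10000 * B ≤ b ^ 2) (K : ℕ) :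
    ∑ k ∈ range K, linkSize ν k ≤
      ∑ k ∈ range K₀, (2 ^ (k + 1))⁻¹ * r k + 2 * b * (3 / 4) ^ K₀ := by
  have h0 : ∀ k, 0 ≤ linkSize ν k := fun k => by unfold linkSize; positivity
  have h1 : ∀ i, linkSize ν (K₀ + i) ≤ b / 2 * (3 / 4) ^ (K₀ + i) := by
    intro i
    have hg := growth_le hB i
    have hs := sqrt_link_le ν (K₀ + i) (r := b * (3 / 2) ^ (K₀ + i)) (by positivity) (by
      have e : (b * (3 / 2 : ℝ) ^ (K₀ + i)) ^ 2 = b ^ 2 * (9 / 4) ^ (K₀ + i) := by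
        rw [mul_pow, ← pow_mul, mul_comm _ 2, pow_mul]; norm_num
      rw [e]
      have hp : (0 : ℝ) < (9 / 4) ^ (K₀ + i) := by positivity
      nlinarith)
    calc linkSize ν (K₀ + i) ≤ (2 ^ (K₀ + i + 1))⁻¹ * (b * (3 / 2) ^ (K₀ + i)) := by
          unfold linkSize; gcongr
      _ = b / 2 * (3 / 4) ^ (K₀ + i) := by
          rw [pow_succ, show (3 / 2 : ℝ) = 2 * (3 / 4) by norm_num, mul_pow]
          field_simp
  have h2 : ∀ M, ∑ i ∈ range M, linkSize ν (K₀ + i) ≤ 2 * b * (3 / 4) ^ K₀ := by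
    intro M
    have h3 : ∑ i ∈ range M, linkSize ν (K₀ + i) ≤ 2 * b * (3 / 4) ^ K₀ - 2 * b * (3 / 4) ^ (K₀ + M) := by
      induction M with
      | zero => simp
      | succ M ih =>
        rw [sum_range_succ]
        have := h1 M
        have e : (3 / 4 : ℝ) ^ (K₀ + (M + 1)) = 3 / 4 * (3 / 4) ^ (K₀ + M) := by ring
        rw [e]; nlinarith
    have : 0 ≤ 2 * b * (3 / 4 : ℝ) ^ (K₀ + M) := by positivity
    linarith
  calc ∑ k ∈ range K, linkSize ν k ≤ ∑ k ∈ range (K₀ + K), linkSize ν k :=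
        sum_le_sum_of_subset_of_nonneg (range_mono (by omega)) fun k _ _ => h0 k
    _ = ∑ k ∈ range K₀, linkSize ν k + ∑ i ∈ range K, linkSize ν (K₀ + i) := sum_range_add _ _ _
    _ ≤ _ := by
        refine add_le_add (sum_le_sum fun k hk => ?_) (h2 K)
        obtain ⟨hr0, hrk⟩ := hr k (mem_range.1 hk)
        unfold linkSize
        gcongr
        exact sqrt_link_le ν k hr0 hrk

lemma sum_linkSize_le_4 (K : ℕ) : ∑ k ∈ range K, linkSize 4 k ≤ 50 / 10 := by
  refine (sum_linkSize_le (K₀ := 6) (r := fun k => ![289, 441, 601, 799, 1067, 1443] (Fin.ofNat 6 k) / 100)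
    (B := 2189 / 1000) (b := 175 / 100) ?_ (by norm_num) (by norm_num) (by norm_num) K).trans ?_
  · intro k hk
    interval_cases k <;> norm_num [Fin.ofNat]
  · norm_num [sum_range_succ, Fin.ofNat]

lemma sum_linkSize_le_8 (K : ℕ) : ∑ k ∈ range K, linkSize 8 k ≤ 61 / 10 := by
  refine (sum_linkSize_le (K₀ := 6) (r := fun k => ![373, 553, 726, 928, 1190, 1554] (Fin.ofNat 6 k) / 100)
    (B := 2405 / 1000) (b := 183 / 100) ?_ (by norm_num) (by norm_num) (by norm_num) K).trans ?_
  · intro k hk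
    interval_cases k <;> norm_num [Fin.ofNat]
  · norm_num [sum_range_succ, Fin.ofNat]

lemma sum_linkSize_le_16 (K : ℕ) : ∑ k ∈ range K, linkSize 16 k ≤ 77 / 10 := by
  refine (sum_linkSize_le (K₀ := 6) (r := fun k => ![500, 726, 928, 1142, 1404, 1755] (Fin.ofNat 6 k) / 100)
    (B := 2837 / 1000) (b := 199 / 100) ?_ (by norm_num) (by norm_num) (by norm_num) K).trans ?_
  · intro k hk
    interval_cases k <;> norm_num [Fin.ofNat]
  · norm_num [sum_range_succ, Fin.ofNat]

lemma sum_linkSize_le_32 (K : ℕ) : ∑ k ∈ range K, linkSize 32 k ≤ 102 / 10 := by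
  refine (sum_linkSize_le (K₀ := 6) (r := fun k => ![687, 986, 1235, 1480, 1755, 2100] (Fin.ofNat 6 k) / 100)
    (B := 3700 / 1000) (b := 227 / 100) ?_ (by norm_num) (by norm_num) (by norm_num) K).trans ?_
  · intro k hk
    interval_cases k <;> norm_num [Fin.ofNat]
  · norm_num [sum_range_succ, Fin.ofNat]

lemma sum_linkSize_le_64 (K : ℕ) : ∑ k ∈ range K, linkSize 64 k ≤ 138 / 10 := by
  refine (sum_linkSize_le (K₀ := 6) (r := fun k => ![957, 1363, 1690, 1992, 2302, 2659] (Fin.ofNat 6 k) / 100)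
    (B := 5426 / 1000) (b := 275 / 100) ?_ (by norm_num) (by norm_num) (by norm_num) K).trans ?_
  · intro k hk
    interval_cases k <;> norm_num [Fin.ofNat]
  · norm_num [sum_range_succ, Fin.ofNat]

lemma sum_linkSize_le_128 (K : ℕ) : ∑ k ∈ range K, linkSize 128 k ≤ 190 / 10 := by
  refine (sum_linkSize_le (K₀ := 6) (r := fun k => ![1343, 1906, 2349, 2742, 3120, 3521] (Fin.ofNat 6 k) / 100)
    (B := 8879 / 1000) (b := 351 / 100) ?_ (by norm_num) (by norm_num) (by norm_num) K).trans ?_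
  · intro k hk
    interval_cases k <;> norm_num [Fin.ofNat]
  · norm_num [sum_range_succ, Fin.ofNat]

lemma sum_linkSize_le_256 (K : ℕ) : ∑ k ∈ range K, linkSize 256 k ≤ 265 / 10 := by
  refine (sum_linkSize_le (K₀ := 6) (r := fun k => ![1892, 2680, 3293, 3823, 4314, 4801] (Fin.ofNat 6 k) / 100)
    (B := 15785 / 1000) (b := 468 / 100) ?_ (by norm_num) (by norm_num) (by norm_num) K).trans ?_
  · intro k hk
    interval_cases k <;> norm_num [Fin.ofNat]
  · norm_num [sum_range_succ, Fin.ofNat]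

variable {Ω X : Type*} [MeasurableSpace Ω] [MeasurableSpace X] {P : Measure Ω}
variable {ι : Type*} [Fintype ι] {β : ι → X → ℝ} {J : Type*} {φ : J → ℝ → ℝ} {T : J → ι → ℝ}

lemma SubG.chain_bound {Z : (X → ℝ) → Ω → ℝ} {C : ℝ} [IsProbabilityMeasure P] [Nonempty ι]
    (hZ : SubG P Z C) (hβ : ∀ c, Measurable (β c)) (h0 : ∀ c x, 0 ≤ β c x)
    (h1 : ∀ x, ∑ c, β c x = 1) (hφ : ∀ j, Lip1 (φ j)) (hφ0 : ∀ j, φ j 0 = 0)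
    (hT : ∀ j c, |T j c| ≤ 1) {ν : ℕ} (hν : Fintype.card ι ≤ ν) {U A : ℝ}
    (hU : ∀ K, ∑ k ∈ range K, linkSize ν k ≤ U) (hA : U < A) :
    Dom P (fun j ω => Z (fun x => φ j (∑ c, β c x * T j c)) ω) A := by
  have hC := hZ.nonneg
  have hlim : Filter.Tendsto (fun K : ℕ => ((2 : ℝ) ^ K)⁻¹) Filter.atTop (nhds 0) := by
    simpa using tendsto_pow_atTop_nhds_zero_of_lt_one (r := (2⁻¹ : ℝ)) (by norm_num) (by norm_num)
  have hlim' : ∀ c : ℝ, 0 ≤ c → ∃ K : ℕ, ∀ Q ≥ K, c * ((2 : ℝ) ^ Q)⁻¹ ≤ (A - U) / 2 := by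
    intro c _
    have := hlim.const_mul c
    rw [mul_zero] at this
    exact Filter.eventually_atTop.1 (this.eventually_le_const (by linarith))
  obtain ⟨K, hK⟩ := hlim' C hC
  set S : ℕ → ℝ := fun k => Real.sqrt (2 * (Real.log 2 * ((k + 1) * Fintype.card ι + 2 ^ (k + 2) - 2)))
    with hS
  have hS0 : 0 ≤ ∑ k ∈ range K, S k := sum_nonneg fun k _ => Real.sqrt_nonneg _
  obtain ⟨K', hK'⟩ := hlim' ((∑ k ∈ range K, S k) + C) (by positivity)
  refine (hZ.chain hβ h0 h1 hφ hφ0 hT (le_max_left K K')).mono_const ?_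
  have e1 := hK K le_rfl
  have e2 := hK' (max K K') (le_max_right _ _)
  have e3 : ∑ k ∈ range K, ((2 ^ (k + 1) : ℝ)⁻¹ + (2 ^ max K K')⁻¹) * S k =
      ∑ k ∈ range K, (2 ^ (k + 1) : ℝ)⁻¹ * S k + (2 ^ max K K')⁻¹ * ∑ k ∈ range K, S k := by
    rw [mul_sum, ← sum_add_distrib]
    exact sum_congr rfl fun k _ => add_mul _ _ _
  have e4 : ∑ k ∈ range K, (2 ^ (k + 1) : ℝ)⁻¹ * S k ≤ ∑ k ∈ range K, linkSize ν k := by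
    refine sum_le_sum fun k _ => ?_
    simp only [hS]
    unfold linkSize
    have : (Fintype.card ι : ℝ) ≤ ν := by exact_mod_cast hν
    have hl := Real.log_pos one_lt_two
    gcongr
  have e5 := hU K
  calc _ = ∑ k ∈ range K, ((2 ^ (k + 1) : ℝ)⁻¹ + (2 ^ max K K')⁻¹) * S k +
        C * ((2 ^ K)⁻¹ + (2 ^ max K K')⁻¹) := by rw [hS]
    _ ≤ A := by rw [e3]; nlinarith

end GridTD

namespace GridTD

variable {Ω X : Type*} [MeasurableSpace Ω] [MeasurableSpace X] {P : Measure Ω}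
  [IsProbabilityMeasure P] {Z : (X → ℝ) → Ω → ℝ} {C : ℝ} {D N : ℕ} {v : X → Fin D → ℝ}

/-- The functions of `gridW` in the coordinates `v`, shifted by their value at `z` times `t`. -/
def pullW (D N : ℕ) (v : X → Fin D → ℝ) (t : ℝ) (z : Fin D → ℝ) : Set (X → ℝ) :=
  (fun w x => w (v x) - t * w z) '' gridW D N

omit [MeasurableSpace X] in
lemma exists_tent_of_mem_pullW (hv : ∀ x d, v x d ∈ Set.Ico (0 : ℝ) 1) {t : ℝ} {z : Fin D → ℝ}
    {g : X → ℝ} (hg : g ∈ pullW D N v t z) : ∃ w ∈ gridW D N, ∀ x,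
      g x = ∑ c : Fin D → nodes N, (∏ d, tent (nodes N) (c d) (v x d)) * (w (fun d => c d) - t * w z) := by
  obtain ⟨w, hw, rfl⟩ := hg
  refine ⟨w, hw, fun x => ?_⟩
  simp only [mul_sub, sum_sub_distrib]
  rw [← eq_sum_tent_of_mem_gridW hw (hv x), ← sum_mul, sum_prod_tent (hv x), one_mul]

lemma unitClass_pullW (hm : Measurable v) (hv : ∀ x d, v x d ∈ Set.Ico (0 : ℝ) 1) {t : ℝ}
    {z : Fin D → ℝ} (hT : ∀ w ∈ gridW D N, ∀ c : Fin D → nodes N, |w (fun d => c d) - t * w z| ≤ 1) :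
    UnitClass (pullW D N v t z) := by
  refine ⟨⟨_, _, zero_mem_gridW, rfl⟩, fun g hg => ⟨?_, fun x => ?_⟩⟩
  · obtain ⟨w, hw, rfl⟩ := hg
    exact ((measurable_of_mem_gridW hw).comp hm).sub_const _
  · obtain ⟨w, hw, h⟩ := exists_tent_of_mem_pullW hv hg
    rw [h x]
    exact abs_sum_weight_le (β := fun (c : Fin D → nodes N) x => ∏ d, tent (nodes N) (c d) (v x d))
      (fun c => prod_nonneg fun d _ => tent_nonneg _ _ _) (sum_prod_tent (hv x)) (hT w hw)

lemma procBound_chain (hZ : SubG P Z C) (hm : Measurable v)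
    (hv : ∀ x d, v x d ∈ Set.Ico (0 : ℝ) 1) {t : ℝ} {z : Fin D → ℝ}
    (hT : ∀ w ∈ gridW D N, ∀ c : Fin D → nodes N, |w (fun d => c d) - t * w z| ≤ 1)
    {ν : ℕ} (hν : (nodes N).card ^ D ≤ ν) {U A : ℝ}
    (hU : ∀ K, ∑ k ∈ range K, linkSize ν k ≤ U) (hA : U < A) :
    ProcBound P Z (pullW D N v t z) A := by
  intro J _ _ φ w hφ hφ0 hw
  choose w' hw' hww' using fun j => exists_tent_of_mem_pullW hv (hw j)
  have : Nonempty (nodes N) := ⟨⟨0, zero_mem_nodes N⟩⟩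
  have := hZ.chain_bound (β := fun (c : Fin D → nodes N) x => ∏ d, tent (nodes N) (c d) (v x d))
    (T := fun j c => w' j (fun d => c d) - t * w' j z)
    (fun c => Finset.measurable_prod _ fun d _ =>
      (measurable_tent _ _).comp ((measurable_pi_apply d).comp hm))
    (fun c x => prod_nonneg fun d _ => tent_nonneg _ _ _) (fun x => sum_prod_tent (hv x))
    hφ hφ0 (fun j c => hT _ (hw' j) c) (ν := ν) (by simpa using hν) hU hA
  simpa only [hww'] using this

lemma abs_node_value_le {z : Fin D → ℝ} (w) (hw : w ∈ gridW D N) (c : Fin D → nodes N) :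
    |w (fun d => c d) - 0 * w z| ≤ 1 := by
  simpa using abs_le_one_of_mem_gridW hw _

omit [MeasurableSpace X] in
lemma procBound_peel {n : ℕ} (hn : 0 < n) (hD : 2 ≤ D) (hN : 0 < N)
    (hv : ∀ x d, v x d ∈ Set.Ico (0 : ℝ) 1) {z : Fin D → ℝ} {A : ℝ}
    (hA : 2 * Real.sqrt (2 * (Real.log (8 / 3) + (D * N : ℕ) * Real.log 2)) +
      8 * Real.sqrt (2 * Real.log 2) < A) (x : Fin n → X) :
    ProcBound (unif (Fin n → Bool)) (radZ x) (pullW D N v 0 z) A := by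
  intro J _ _ φ w hφ hφ0 hw
  have : Nonempty (Bool × Σ n : Fin N, (Fin D → Fin (n + 1) → Bool)) :=
    ⟨(true, ⟨⟨0, hN⟩, fun _ _ => true⟩)⟩
  have hl2 := Real.log_pos one_lt_two
  have hl3 : 0 < Real.log (8 / 3) := Real.log_pos (by norm_num)
  refine (dom_radZ_peel hn x hφ hφ0 (w := w) (fun j => ?_)
    (E := Bool × Σ n : Fin N, (Fin D → Fin (n + 1) → Bool))
    (e := fun e x => extremal D N e (v x)) (fun e x => abs_extremal_le _ _) (fun j s => ?_)
    (H := Real.log (8 / 3) + (D * N : ℕ) * Real.log 2) (by positivity) ?_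
    (sub_pos.2 hA)).mono_const (by linarith)
  · obtain ⟨w', hw', h⟩ := hw j
    intro x
    rw [← h]
    simpa using abs_le_one_of_mem_gridW hw' _
  · obtain ⟨w', hw', h⟩ := hw j
    obtain ⟨e, he⟩ := exists_extremal_ge hN hw' s (fun i => v (x i)) fun i => hv _
    refine ⟨e, ?_⟩
    rw [← h]
    simpa using he
  · rw [← Real.log_pow, ← Real.log_mul (by norm_num) (by positivity)]
    have h1 : (0 : ℝ) < Fintype.card (Bool × Σ n : Fin N, (Fin D → Fin (n + 1) → Bool)) := by
      exact_mod_cast Fintype.card_pos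
    refine Real.log_le_log h1 ?_
    have := card_extremal_le hD N
    linarith

lemma abs_affine_le {p q t : ℝ} (ht : |t| ≤ 1) (h1 : |p + q| ≤ 1) (h2 : |p - q| ≤ 1) :
    |p + q * t| ≤ 1 := by
  rw [abs_le] at *
  constructor <;> nlinarith

lemma abs_mul_sub_mean_le {a a' b b' : ℝ} (ha : |a| ≤ 1) (ha' : |a'| ≤ 1) (hb : |b| ≤ 1)
    (hb' : |b'| ≤ 1) : |a * b - (a + a') / 2 * ((b + b') / 2)| ≤ 1 := by
  rw [show a * b - (a + a') / 2 * ((b + b') / 2) =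
    (-(a' * b + a' * b') / 4) + ((3 * b - b') / 4) * a by ring]
  refine abs_affine_le ha ?_ ?_
  · rw [show -(a' * b + a' * b') / 4 + (3 * b - b') / 4 =
      ((3 * b - b') / 4) + (-(b + b') / 4) * a' by ring]
    refine abs_affine_le ha' ?_ ?_ <;> (rw [abs_le] at *; constructor <;> linarith)
  · rw [show -(a' * b + a' * b') / 4 - (3 * b - b') / 4 =
      (-(3 * b - b') / 4) + (-(b + b') / 4) * a' by ring]
    refine abs_affine_le ha' ?_ ?_ <;> (rw [abs_le] at *; constructor <;> linarith)

lemma exists_pair_of_mem_nodes_one {c : ℝ} (hc : c ∈ nodes 1) : ∃ k k' : ℕ, ∀ u : ℕ → ℝ,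
    itp 1 u c = u k ∧ itp 1 u (1 / 2) = (u k + u k') / 2 := by
  have h2 : ∀ u : ℕ → ℝ, itp 1 u (1 / 2) = (u 0 + u 1) / 2 := fun u => by
    rw [itp_eq_of_mem (k := 0) u (by norm_num) (by norm_num)]; norm_num; ring
  have h3 : c = 0 ∨ c = 1 := by simpa [nodes] using hc
  rcases h3 with rfl | rfl
  · exact ⟨0, 1, fun u => ⟨by simp [itp], h2 u⟩⟩
  · exact ⟨1, 0, fun u => ⟨by simp [itp], by rw [h2, add_comm]⟩⟩

lemma abs_node_value_sub_center_le (w) (hw : w ∈ gridW 2 1) (c : Fin 2 → nodes 1) :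
    |w (fun d => c d) - 1 * w (fun _ => 1 / 2)| ≤ 1 := by
  obtain ⟨ι, _, a, n, u, ha, hn, hu, hw⟩ := hw
  have hn1 : ∀ p, n p = 1 := fun p => by have := hn p; omega
  choose k k' hk using fun d => exists_pair_of_mem_nodes_one (c d).2
  rw [one_mul, hw, hw, ← sum_sub_distrib]
  refine (abs_sum_le_sum_abs _ _).trans ((sum_le_sum fun p _ => ?_).trans ha)
  rw [← mul_sub, abs_mul, hn1, Fin.prod_univ_two, Fin.prod_univ_two]
  refine mul_le_of_le_one_right (abs_nonneg _) ?_
  rw [(hk 0 _).1, (hk 0 _).2, (hk 1 _).1, (hk 1 _).2]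
  exact abs_mul_sub_mean_le (hu _ _ _) (hu _ _ _) (hu _ _ _) (hu _ _ _)

lemma procBound_line (hZ : SubG P Z C) {h : X → ℝ} (hm : Measurable h)
    (hh : ∀ x, h x ∈ Set.Ico (-(1 / 2) : ℝ) (1 / 2)) : ProcBound P Z {h} (84 / 100) := by
  intro J _ _ φ w hφ hφ0 hw
  obtain rfl : w = fun _ => h := funext hw
  have hC := hZ.nonneg
  obtain ⟨q, hq⟩ := exists_nat_gt (100 * C + 1)
  have hq0 : (0 : ℝ) < q := by linarith
  set u : X → ℤ := fun x => ⌊h x * (2 * q)⌋ with hu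
  have hum : Measurable u := Int.measurable_floor.comp (hm.mul_const _)
  have hu1 : ∀ x, -(q : ℤ) ≤ u x ∧ u x < q := fun x => by
    obtain ⟨h1, h2⟩ := hh x
    rw [hu, Int.le_floor, Int.floor_lt]
    push_cast
    constructor <;> nlinarith
  have hbm : BM h := ⟨hm, 1 / 2, fun x => abs_le.2 ⟨(hh x).1, (hh x).2.le⟩⟩
  set μ : ℝ := (2 * q)⁻¹ with hμ
  have hqμ : q * μ = 1 / 2 := by rw [hμ]; field_simp
  have hclose : ∀ x, |h x - μ * u x| ≤ μ := fun x => by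
    have h1 := Int.floor_le (h x * (2 * q))
    have h2 := Int.lt_floor_add_one (h x * (2 * q))
    have h3 : h x = μ * (h x * (2 * q)) := by rw [hμ]; field_simp
    have hμ0 : 0 < μ := by positivity
    rw [h3, ← mul_sub, abs_mul, abs_of_pos hμ0]
    refine mul_le_of_le_one_right hμ0.le (abs_le.2 ⟨?_, ?_⟩) <;> simp only [hu] <;> linarith
  have hbu : BM fun x => μ * (u x : ℝ) := by
    refine ⟨(measurable_from_top.comp hum).const_mul μ, 1 / 2 + μ, fun x => ?_⟩
    have := hclose x
    have h2 := hh x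
    rw [abs_le] at *
    constructor <;> linarith [h2.1, h2.2]
  have hl2 := Real.log_pos one_lt_two
  have key : Dom P (fun (j : J) ω => Z (fun x => φ j (μ * u x)) ω) (1 / 2 * Real.sqrt (2 * (2 * Real.log 2))) := by
    refine dom_of_subgaussian (by positivity) (by norm_num) fun l hl => ?_
    obtain ⟨S, hS, hS1, hS2⟩ := hZ.link hum (measurable_const (a := (0 : ℤ))) (-(q : ℤ)) q 2
      (by exact_mod_cast hq0) (fun x => ⟨(hu1 x).1, by have := (hu1 x).2; push_cast; linarith⟩)
      (fun x => ⟨by simp, by push_cast; linarith⟩)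
      (fun x => by rw [sub_zero, abs_le]; exact ⟨(hu1 x).1, (hu1 x).2.le⟩) μ l (by positivity) hl.le
    refine ⟨S, hS, ?_, fun j ω => ?_⟩
    · rw [hqμ] at hS1
      refine hS1.trans (le_of_eq ?_)
      rw [Real.exp_add, two_mul (Real.log 2), Real.exp_add, Real.exp_log two_pos]
      ring
    · have := hS2 (φ j) (hφ j) ω
      simpa [hφ0, hZ.zero] using this
  have hrest : Dom P (fun (j : J) ω => Z (fun x => φ j (h x) - φ j (μ * u x)) ω) (C * μ) := by
    refine dom_const fun j ω => (le_abs_self _).trans (hZ.bound ?_ (fun x => ?_) ω)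
    · exact (hbm.comp (hφ j)).1.sub (hbu.comp (hφ j)).1
    · exact (hφ j _ _).trans (hclose x)
  refine (((key.add hrest).mono (h' := fun j => Z fun x => φ j (h x)) fun j => ⟨j, fun ω => ?_⟩) ?_)
  · rw [hZ.sub (hbm.comp (hφ j)) (hbu.comp (hφ j))]; linarith
  · have h1 : Real.sqrt (2 * (2 * Real.log 2)) ≤ 1666 / 1000 := by
      rw [Real.sqrt_le_left (by norm_num)]
      have := Real.log_two_lt_d9
      norm_num; linarith
    have h2 : C * μ ≤ 1 / 200 := by
      rw [hμ, ← div_eq_mul_inv, div_le_iff₀ (by positivity)]; linarith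
    linarith

end GridTD

namespace GridTD

lemma interp1_eq_itp {F Nl : ℕ} (hN : 1 ≤ Nl) (G : ℕ → Fin F → ℝ) (x : ℝ) (j : Fin F) :
    interp1 F Nl G x j = itp (Nl - 1) (fun z => G z j) x := by
  simp only [interp1, itp, Nat.cast_sub hN, Nat.cast_one]

/-- Increments of a GridTD model are weighted sums of increments of Lipschitz functions of
elements of `gridW`. -/
lemma exists_increments {D Nsum : ℕ} {γ η : ℝ} (hγ : 0 < γ) {f : (Fin D → ℝ) → ℝ}
    (hf : f ∈ gridTDClass D γ η Nsum) : ∃ (m : ℕ) (a : Fin m → ℝ) (ψ : Fin m → ℝ → ℝ)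
      (w : Fin m → (Fin D → ℝ) → ℝ), (∀ i, 0 ≤ a i) ∧ ∑ i, a i ≤ γ * η ∧ (∀ i, Lip1 (ψ i)) ∧
      (∀ i, w i ∈ gridW D Nsum) ∧ ∀ v v', f v - f v' = ∑ i, a i * (ψ i (w i v) - ψ i (w i v')) := by
  obtain ⟨L, F, n1, N, G, σ, W1, W2, bv, -, hN, hNs, hσ, hW, hG, hfv, -, -⟩ := hf
  set A : Fin n1 → ℝ := fun i => ∑ p, |W1 i p| with hA
  have hA0 : ∀ i, 0 ≤ A i := fun i => sum_nonneg fun p _ => abs_nonneg _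
  set w : Fin n1 → (Fin D → ℝ) → ℝ := fun i v => ∑ p : Fin L × Fin F, W1 i p / A i *
    ∏ d, itp (N p.1 - 1) (fun z => G p.1 d z p.2) (v d) with hw
  have hAw : ∀ i v, A i * w i v = ∑ p, W1 i p * gridTDEnc D L F N G v p := by
    intro i v
    rw [hw, mul_sum]
    refine sum_congr rfl fun p _ => ?_
    have e : gridTDEnc D L F N G v p = ∏ d, itp (N p.1 - 1) (fun z => G p.1 d z p.2) (v d) :=
      prod_congr rfl fun d _ => interp1_eq_itp (by have := hN p.1; omega) _ _ _
    rw [e]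
    rcases eq_or_ne (A i) 0 with h | h
    · have h1 : |W1 i p| ≤ A i := single_le_sum (f := fun p => |W1 i p|) (fun _ _ => abs_nonneg _) (mem_univ p)
      have h2 : W1 i p = 0 := by rw [h] at h1; exact abs_nonpos_iff.1 h1
      simp [h2]
    · field_simp
  refine ⟨n1, fun i => γ * |W2 i| * A i,
    fun i t => (γ * |W2 i| * A i)⁻¹ * (W2 i * σ (A i * t + bv i)), w, fun i => ?_, ?_, fun i s t => ?_,
    fun i => ?_, fun v v' => ?_⟩
  · have := hA0 i; positivity
  · calc ∑ i, γ * |W2 i| * A i ≤ ∑ i, γ * |W2 i| * ∑ k, A k := by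
          refine sum_le_sum fun i _ => ?_
          have : A i ≤ ∑ k, A k := single_le_sum (fun k _ => hA0 k) (mem_univ i)
          gcongr
      _ = γ * ((∑ i, ∑ j, |W1 i j|) * ∑ i, |W2 i|) := by
          rw [← sum_mul, ← mul_sum]; ring
      _ ≤ γ * η := by gcongr
  · rw [← mul_sub, ← mul_sub, abs_mul, abs_mul]
    have h0 := hA0 i
    have h1 : |σ (A i * s + bv i) - σ (A i * t + bv i)| ≤ γ * (A i * |s - t|) := by
      refine (hσ _ _).trans (le_of_eq ?_)
      rw [show A i * s + bv i - (A i * t + bv i) = A i * (s - t) by ring, abs_mul, abs_of_nonneg h0]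
    have h2 : 0 ≤ γ * |W2 i| * A i := by positivity
    rw [abs_of_nonneg (inv_nonneg.2 h2)]
    calc (γ * |W2 i| * A i)⁻¹ * (|W2 i| * |σ (A i * s + bv i) - σ (A i * t + bv i)|)
        ≤ (γ * |W2 i| * A i)⁻¹ * (|W2 i| * (γ * (A i * |s - t|))) := by gcongr
      _ = (γ * |W2 i| * A i)⁻¹ * (γ * |W2 i| * A i) * |s - t| := by ring
      _ ≤ 1 * |s - t| := by
          gcongr
          exact inv_mul_le_one
      _ = |s - t| := one_mul _
  · refine ⟨Fin L × Fin F, inferInstance, fun p => W1 i p / A i, fun p => N p.1 - 1,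
      fun p d z => G p.1 d z p.2, ?_, fun p => ⟨?_, ?_⟩, fun p d z => ?_,
      fun v => rfl⟩
    · simp only [abs_div, abs_of_nonneg (hA0 i)]
      rw [← sum_div]
      exact div_self_le_one _
    · have := hN p.1
      simp only
      omega
    · rw [← hNs]
      exact single_le_sum (f := fun l => N l - 1) (fun _ _ => Nat.zero_le _) (mem_univ p.1)
    · exact (single_le_sum (f := fun j => |G p.1 d z j|) (fun _ _ => abs_nonneg _)
        (mem_univ p.2)).trans (hG p.1 d z)
  · rw [hfv, hfv, mlp, mlp, ← sum_sub_distrib]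
    refine sum_congr rfl fun i _ => ?_
    simp only
    rw [← hAw, ← hAw, ← mul_sub, ← mul_sub, ← mul_assoc, ← mul_sub]
    rcases eq_or_ne (γ * |W2 i| * A i) 0 with h | h
    · rw [h, zero_mul, zero_mul]
      rcases mul_eq_zero.1 h with h | h
      · have : W2 i = 0 := by simpa [hγ.ne'] using h
        simp [this]
      · simp [h]
    · rw [mul_inv_cancel₀ h, one_mul]

variable {X : Type*} [MeasurableSpace X] {D N : ℕ} {v : X → Fin D → ℝ}

omit [MeasurableSpace X] in
lemma rep_pullW_zero {γ η : ℝ} (hγ : 0 < γ) {f : (Fin D → ℝ) → ℝ}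
    (hf : f ∈ gridTDClass D γ η N) {z : Fin D → ℝ} :
    Rep (pullW D N v 0 z) (γ * η) 1 fun x => f (v x) := by
  obtain ⟨m, a, ψ, w, ha, hs, hψ, hw, h⟩ := exists_increments hγ hf
  have h01 : f (fun _ => 0) ∈ Set.Icc (0 : ℝ) 1 := by
    obtain ⟨L, F, n1, N, G, σ, W1, W2, bv, -, -, -, -, -, -, -, h, -⟩ := hf
    exact h _ fun _ => by norm_num
  refine ⟨m, f fun _ => 0, a, fun i => ψ i 0 - ψ i (w i fun _ => 0), fun i t => ψ i t - ψ i 0,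
    fun i x => w i (v x) - 0 * w i z, h01.1, h01.2, ha, hs, fun i => ?_, fun i s t => ?_,
    fun i => sub_self _, fun i => ⟨w i, hw i, rfl⟩, fun x => ?_⟩
  · refine (hψ i _ _).trans ?_
    rw [zero_sub, abs_neg]
    exact abs_le_one_of_mem_gridW (hw i) _
  · rw [sub_sub_sub_cancel_right]; exact hψ i s t
  · have := h (v x) fun _ => 0
    simp only [zero_mul, sub_zero, sub_add_sub_cancel]
    linarith

omit [MeasurableSpace X] in
lemma rep_pullW_one {γ η : ℝ} (hγ : 0 < γ) {f : (Fin D → ℝ) → ℝ}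
    (hf : f ∈ gridTDClass D γ η N) {z : Fin D → ℝ} (hz : ∀ d, z d ∈ Set.Ico (0 : ℝ) 1) :
    Rep (pullW D N v 1 z) (γ * η) 0 fun x => f (v x) := by
  obtain ⟨m, a, ψ, w, ha, hs, hψ, hw, h⟩ := exists_increments hγ hf
  have h01 : f z ∈ Set.Icc (0 : ℝ) 1 := by
    obtain ⟨L, F, n1, N, G, σ, W1, W2, bv, -, -, -, -, -, -, -, h, -⟩ := hf
    exact h _ hz
  refine ⟨m, f z, a, fun _ => 0, fun i t => ψ i (t + w i z) - ψ i (w i z),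
    fun i x => w i (v x) - 1 * w i z, h01.1, h01.2, ha, hs, fun i => by simp, fun i s t => ?_,
    fun i => by simp, fun i => ⟨w i, hw i, rfl⟩, fun x => ?_⟩
  · rw [sub_sub_sub_cancel_right]
    refine (hψ i _ _).trans (le_of_eq ?_)
    rw [add_sub_add_right_eq_sub]
  · have := h (v x) z
    simp only [one_mul, sub_add_cancel, add_zero]
    linarith

omit [MeasurableSpace X] in
lemma rep_line {v : X → Fin 1 → ℝ} (hv : ∀ x d, v x d ∈ Set.Ico (0 : ℝ) 1) {γ η : ℝ} (hγ : 0 < γ)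
    (hη : 0 < η) (hN : 0 < N) {f : (Fin 1 → ℝ) → ℝ} (hf : f ∈ gridTDClass 1 γ η N) :
    Rep {fun x => v x 0 - 1 / 2} (2 * γ * η * N) 0 fun x => f (v x) := by
  obtain ⟨L, F, n1, N', G, σ, W1, W2, bv, -, -, -, -, -, -, -, h01, hL⟩ := hf
  set K : ℝ := 2 * γ * η * N with hK
  have hK0 : 0 < K := by positivity
  have hcube : ∀ {t : ℝ}, t ∈ Set.Ico (-(1 / 2) : ℝ) (1 / 2) →
      ∀ d : Fin 1, (fun _ => t + 1 / 2 : Fin 1 → ℝ) d ∈ Set.Ico (0 : ℝ) 1 := fun ht d =>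
    ⟨by linarith [ht.1], by linarith [ht.2]⟩
  have hlip : LipschitzOnWith 1 (fun t : ℝ => K⁻¹ * (f (fun _ => t + 1 / 2) - f fun _ => 1 / 2))
      (Set.Ico (-(1 / 2) : ℝ) (1 / 2)) := by
    refine LipschitzOnWith.of_dist_le_mul fun s hs t ht => ?_
    have := hL _ _ (hcube hs) (hcube ht)
    simp only [univ_unique, sum_singleton, Nat.cast_one, mul_one, add_sub_add_right_eq_sub, ← hK] at this
    rw [Real.dist_eq, Real.dist_eq, ← mul_sub, sub_sub_sub_cancel_right, abs_mul,
      abs_of_pos (inv_pos.2 hK0), NNReal.coe_one, one_mul]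
    calc _ ≤ K⁻¹ * (K * |s - t|) := by gcongr
      _ = _ := by field_simp
  obtain ⟨φ, hφ, hφe⟩ := hlip.extend_real
  have hz := h01 (fun _ => 1 / 2) fun _ => by norm_num
  refine ⟨1, f fun _ => 1 / 2, fun _ => K, fun _ => 0, fun _ => φ, fun _ x => v x 0 - 1 / 2, hz.1,
    hz.2, fun _ => hK0.le, by simp, fun _ => by simp, fun _ s t => ?_, fun _ => ?_, fun _ => rfl,
    fun x => ?_⟩
  · simpa [Real.dist_eq] using hφ.dist_le_mul s t
  · simp only
    rw [← hφe (show (0 : ℝ) ∈ _ by norm_num)]; simp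
  · have h1 : v x 0 - 1 / 2 ∈ Set.Ico (-(1 / 2) : ℝ) (1 / 2) :=
      ⟨by linarith [(hv x 0).1], by linarith [(hv x 0).2]⟩
    have h2 : v x = fun _ => v x 0 := funext fun d => by rw [Subsingleton.elim d 0]
    simp only [univ_unique, sum_singleton, ← hφe h1, sub_add_cancel, add_zero, ← h2]
    field_simp
    ring

end GridTD

namespace GridTD

lemma card_nodes_pow_le {N : ℕ} (hN : 0 < N) (D : ℕ) : (nodes N).card ^ D ≤ 2 ^ (D * N) := by
  obtain ⟨M, rfl⟩ := Nat.exists_eq_succ_of_ne_zero hN.ne'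
  rw [mul_comm, pow_mul]
  exact Nat.pow_le_pow_left (card_nodes_le M) D

lemma log_eight_thirds_le : Real.log (8 / 3) ≤ 10 / 7 * Real.log 2 := by
  have h : Real.log ((8 / 3) ^ 7) ≤ Real.log (2 ^ 10) := Real.log_le_log (by norm_num) (by norm_num)
  rw [Real.log_pow, Real.log_pow] at h
  push_cast at h
  linarith

lemma peel_const_lt {b : ℕ} {r : ℝ} (hr : 0 ≤ r) (h : 13863 / 10000 * ((b : ℝ) + 10 / 7) ≤ r ^ 2) :
    2 * Real.sqrt (2 * (Real.log (8 / 3) + b * Real.log 2)) + 8 * Real.sqrt (2 * Real.log 2) <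
      2 * r + 943 / 100 := by
  have h1 := log_eight_thirds_le
  have h2 := Real.log_two_lt_d9
  have h3 : Real.sqrt (2 * (Real.log (8 / 3) + b * Real.log 2)) ≤ r := by
    rw [Real.sqrt_le_left hr]
    have : (b : ℝ) * Real.log 2 ≤ b * (13863 / 20000) := by gcongr; linarith
    linarith
  have h4 : Real.sqrt (2 * Real.log 2) ≤ 11775 / 10000 := by
    rw [Real.sqrt_le_left (by norm_num)]
    norm_num
    linarith
  linarith

variable {X : Type*} [MeasurableSpace X] {𝒟 : Measure X} [IsProbabilityMeasure 𝒟]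

/-- Process bounds for a class representing all GridTD models, with constants summing up to at
most `c`. -/
def Regime (𝒟 : Measure X) (n D N : ℕ) (γ η : ℝ) (v : X → Fin D → ℝ) (c : ℝ) : Prop :=
  ∃ (𝒲 : Set (X → ℝ)) (κ β₀ AR AL : ℝ), UnitClass 𝒲 ∧ 0 ≤ κ ∧ 0 ≤ β₀ ∧
    (∀ x : Fin n → X, ProcBound (unif (Fin n → Bool)) (radZ x) 𝒲 AR) ∧
    (∀ s : X → ℝ, Measurable s → (∀ x, |s x| ≤ 1) →
      ProcBound (Measure.pi fun _ : Fin n => 𝒟) (empZ 𝒟 n s) 𝒲 AL) ∧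
    κ * (2 * AR + AL + 303 / 100 * β₀) ≤ c ∧
    ∀ f ∈ gridTDClass D γ η N, Rep 𝒲 κ β₀ fun x => f (v x)

lemma regime_line {n N : ℕ} (hn : 0 < n) (hN : 0 < N) {γ η : ℝ} (hγ : 0 < γ) (hη : 0 < η)
    {v : X → Fin 1 → ℝ} (hm : Measurable v) (hv : ∀ x d, v x d ∈ Set.Ico (0 : ℝ) 1) :
    Regime 𝒟 n 1 N γ η v (8 * γ * η * N) := by
  have hm0 : Measurable fun x => v x 0 - 1 / 2 := ((measurable_pi_apply 0).comp hm).sub_const _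
  have hh : ∀ x, v x 0 - 1 / 2 ∈ Set.Ico (-(1 / 2) : ℝ) (1 / 2) := fun x =>
    ⟨by linarith [(hv x 0).1], by linarith [(hv x 0).2]⟩
  refine ⟨{fun x => v x 0 - 1 / 2}, 2 * γ * η * N, 0, 84 / 100, 84 / 100, ⟨⟨_, rfl⟩, ?_⟩,
    by positivity, le_rfl, fun x => procBound_line (subG_radZ hn x) hm0 hh,
    fun s hs hs1 => procBound_line (subG_empZ hn hs hs1) hm0 hh, ?_,
    fun f hf => rep_line hv hγ hη hN hf⟩
  · rintro _ rfl
    exact ⟨hm0, fun x => abs_le.2 ⟨by linarith [(hh x).1], by linarith [(hh x).2]⟩⟩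
  · have : 0 < γ * η * N := by positivity
    nlinarith

lemma regime_centered {n : ℕ} (hn : 0 < n) {γ η : ℝ} (hγ : 0 < γ) (hη : 0 < η)
    {v : X → Fin 2 → ℝ} (hm : Measurable v) (hv : ∀ x d, v x d ∈ Set.Ico (0 : ℝ) 1) :
    Regime 𝒟 n 2 1 γ η v (16 * (γ * η)) := by
  have hT := abs_node_value_sub_center_le
  have hν : (nodes 1).card ^ 2 ≤ 4 := card_nodes_pow_le one_pos 2
  refine ⟨pullW 2 1 v 1 fun _ => 1 / 2, γ * η, 0, 51 / 10, 51 / 10, unitClass_pullW hm hv hT,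
    by positivity, le_rfl,
    fun x => procBound_chain (subG_radZ hn x) hm hv hT hν sum_linkSize_le_4 (by norm_num),
    fun s hs hs1 => procBound_chain (subG_empZ hn hs hs1) hm hv hT hν sum_linkSize_le_4 (by norm_num),
    ?_, fun f hf => rep_pullW_one hγ hf fun _ => by norm_num⟩
  have : 0 < γ * η := by positivity
  nlinarith

variable {D N : ℕ} {v : X → Fin D → ℝ}

omit [IsProbabilityMeasure 𝒟] in
lemma regime_of_bounds {n : ℕ} {γ η : ℝ} (hγ : 0 < γ) (hη : 0 < η)
    (hm : Measurable v) (hv : ∀ x d, v x d ∈ Set.Ico (0 : ℝ) 1) {AR AL c : ℝ}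
    (hR : ∀ x : Fin n → X, ProcBound (unif (Fin n → Bool)) (radZ x) (pullW D N v 0 0) AR)
    (hL : ∀ s : X → ℝ, Measurable s → (∀ x, |s x| ≤ 1) →
      ProcBound (Measure.pi fun _ : Fin n => 𝒟) (empZ 𝒟 n s) (pullW D N v 0 0) AL)
    (hc : 2 * AR + AL + 303 / 100 ≤ c) : Regime 𝒟 n D N γ η v (c * (γ * η)) := by
  refine ⟨pullW D N v 0 0, γ * η, 1, AR, AL, unitClass_pullW hm hv abs_node_value_le, by positivity,
    zero_le_one, hR, hL, ?_, fun f hf => rep_pullW_zero hγ hf⟩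
  rw [mul_comm, mul_one]
  gcongr

lemma regime_chain {n : ℕ} (hn : 0 < n) (hN : 0 < N) {γ η : ℝ} (hγ : 0 < γ) (hη : 0 < η)
    (hm : Measurable v) (hv : ∀ x d, v x d ∈ Set.Ico (0 : ℝ) 1) {b : ℕ} (hb : D * N = b) {U c : ℝ}
    (hU : ∀ K, ∑ k ∈ range K, linkSize (2 ^ b) k ≤ U) (hc : 3 * U + 306 / 100 ≤ c) :
    Regime 𝒟 n D N γ η v (c * (γ * η)) := by
  have hν := card_nodes_pow_le hN D
  rw [hb] at hν
  exact regime_of_bounds (AR := U + 1 / 100) (AL := U + 1 / 100) hγ hη hm hv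
    (fun x => procBound_chain (subG_radZ hn x) hm hv abs_node_value_le hν hU (by linarith))
    (fun s hs hs1 => procBound_chain (subG_empZ hn hs hs1) hm hv abs_node_value_le hν hU (by linarith))
    (by linarith)

lemma regime_mixed {n : ℕ} (hn : 0 < n) (hD : 2 ≤ D) (hN : 0 < N) {γ η : ℝ} (hγ : 0 < γ) (hη : 0 < η)
    (hm : Measurable v) (hv : ∀ x d, v x d ∈ Set.Ico (0 : ℝ) 1) {b : ℕ} (hb : D * N = b) {U c r : ℝ}
    (hU : ∀ K, ∑ k ∈ range K, linkSize (2 ^ b) k ≤ U) (hr : 0 ≤ r)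
    (hbr : 13863 / 10000 * ((b : ℝ) + 10 / 7) ≤ r ^ 2) (hc : 4 * r + U + 2190 / 100 ≤ c) :
    Regime 𝒟 n D N γ η v (c * (γ * η)) := by
  have hν := card_nodes_pow_le hN D
  rw [hb] at hν
  exact regime_of_bounds (AR := 2 * r + 943 / 100) (AL := U + 1 / 100) hγ hη hm hv
    (fun x => procBound_peel hn hD hN hv (by rw [hb]; exact peel_const_lt hr hbr) x)
    (fun s hs hs1 => procBound_chain (subG_empZ hn hs hs1) hm hv abs_node_value_le hν hU (by linarith))
    (by linarith)

lemma regime_peel {n : ℕ} (hn : 0 < n) (hD : 2 ≤ D) (hN : 0 < N) {γ η : ℝ} (hγ : 0 < γ) (hη : 0 < η)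
    (hm : Measurable v) (hv : ∀ x d, v x d ∈ Set.Ico (0 : ℝ) 1) (hb : 9 ≤ D * N) :
    Regime 𝒟 n D N γ η v (8 * (D * N : ℕ) * (γ * η)) := by
  have hb' : (9 : ℝ) ≤ (D * N : ℕ) := by exact_mod_cast hb
  have hR : ∀ x : Fin n → X, ProcBound (unif (Fin n → Bool)) (radZ x) (pullW D N v 0 0)
      (2 * ((D * N : ℕ) - 51 / 10) + 943 / 100) := fun x =>
    procBound_peel hn hD hN hv (peel_const_lt (by linarith) (by nlinarith)) x
  refine regime_of_bounds hγ hη hm hv hR (fun s hs hs1 => procBound_empZ_of_radZ hn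
    (unitClass_pullW hm hv abs_node_value_le) hR hs hs1) (by linarith)

lemma exists_regime {n : ℕ} (hn : 0 < n) (hD : 1 ≤ D) (hN : 0 < N) {γ η : ℝ} (hγ : 0 < γ)
    (hη : 0 < η) (hm : Measurable v) (hv : ∀ x d, v x d ∈ Set.Ico (0 : ℝ) 1) :
    Regime 𝒟 n D N γ η v (8 * γ * η * D * N) := by
  rcases hD.eq_or_lt with rfl | hD
  · simpa using regime_line hn hN hγ hη hm hv
  have hD2 : 2 ≤ D := hD
  rw [show 8 * γ * η * D * N = 8 * (D * N : ℕ) * (γ * η) by push_cast; ring]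
  by_cases h9 : 9 ≤ D * N
  · exact regime_peel hn hD2 hN hγ hη hm hv h9
  have hge : 2 ≤ D * N := le_trans hD2 (Nat.le_mul_of_pos_right D hN)
  obtain ⟨b, hb⟩ : ∃ b, D * N = b := ⟨_, rfl⟩
  by_cases h2 : D = 2 ∧ N = 1
  · obtain ⟨rfl, rfl⟩ := h2
    rw [show (8 : ℝ) * (2 * 1 : ℕ) = 16 by norm_num]
    exact regime_centered hn hγ hη hm hv
  have hb2 : b ≠ 2 := by
    rintro rfl
    have hN1 : N = 1 := by nlinarith
    exact h2 ⟨by rw [hN1] at hb; omega, hN1⟩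
  rw [hb] at h9 hge
  have : b = 3 ∨ b = 4 ∨ b = 5 ∨ b = 6 ∨ b = 7 ∨ b = 8 := by omega
  rcases this with rfl | rfl | rfl | rfl | rfl | rfl <;> rw [hb]
  · exact regime_chain hn hN hγ hη hm hv hb sum_linkSize_le_8 (by norm_num)
  · exact regime_chain hn hN hγ hη hm hv hb sum_linkSize_le_16 (by norm_num)
  · exact regime_chain hn hN hγ hη hm hv hb sum_linkSize_le_32 (by norm_num)
  · exact regime_chain hn hN hγ hη hm hv hb sum_linkSize_le_64 (by norm_num)
  · exact regime_mixed hn hD2 hN hγ hη hm hv hb sum_linkSize_le_128 (r := 342 / 100) (by norm_num)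
      (by norm_num) (by norm_num)
  · exact regime_mixed hn hD2 hN hγ hη hm hv hb sum_linkSize_le_256 (r := 362 / 100) (by norm_num)
      (by norm_num) (by norm_num)

end GridTD

namespace GridTD

lemma exists_net {D : ℕ} {K ε : ℝ} (hK : 0 ≤ K) (hε : 0 < ε) (𝓕 : Set ((Fin D → ℝ) → ℝ))
    (h01 : ∀ f ∈ 𝓕, ∀ v : Fin D → ℝ, (∀ d, v d ∈ Set.Ico (0 : ℝ) 1) → f v ∈ Set.Icc (0 : ℝ) 1)
    (hL : ∀ f ∈ 𝓕, ∀ v w : Fin D → ℝ, (∀ d, v d ∈ Set.Ico (0 : ℝ) 1) →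
      (∀ d, w d ∈ Set.Ico (0 : ℝ) 1) → |f v - f w| ≤ K * ∑ d, |v d - w d|) :
    ∃ (J : Type) (_ : Fintype J) (g : J → (Fin D → ℝ) → ℝ), (∀ j, g j ∈ 𝓕) ∧
      ∀ f ∈ 𝓕, ∃ j, ∀ v : Fin D → ℝ, (∀ d, v d ∈ Set.Ico (0 : ℝ) 1) → |f v - g j v| ≤ ε := by
  classical
  obtain ⟨m, hm⟩ := exists_nat_gt ((2 * K * D + 1) / ε)
  have hm0 : (0 : ℝ) < m := lt_of_le_of_lt (by positivity) hm
  rw [div_lt_iff₀ hε] at hm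
  set pt : (Fin D → Fin m) → Fin D → ℝ := fun c d => (c d : ℕ) / m with hpt
  have hcube : ∀ c d, pt c d ∈ Set.Ico (0 : ℝ) 1 := fun c d => by
    refine ⟨by positivity, (div_lt_one hm0).2 ?_⟩
    exact_mod_cast (c d).2
  set q : 𝓕 → (Fin D → Fin m) → Fin (m + 1) := fun f c =>
    ⟨⌊m * f.1 (pt c)⌋₊, Nat.lt_succ_of_le (Nat.floor_le_of_le (by
      have := (h01 f.1 f.2 (pt c) (hcube c)).2
      nlinarith))⟩ with hq
  choose r hr using fun j : Set.range q => j.2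
  refine ⟨Set.range q, inferInstance, fun j => (r j).1, fun j => (r j).2, fun f hf =>
    ⟨⟨q ⟨f, hf⟩, _, rfl⟩, fun v hv => ?_⟩⟩
  set g := r ⟨q ⟨f, hf⟩, _, rfl⟩ with hg
  have hqg : q g = q ⟨f, hf⟩ := hr ⟨q ⟨f, hf⟩, _, rfl⟩
  have hfl : ∀ d, ⌊m * v d⌋₊ < m := fun d => by
    rw [Nat.floor_lt (mul_nonneg hm0.le (hv d).1)]
    nlinarith [(hv d).2]
  set c : Fin D → Fin m := fun d => ⟨⌊m * v d⌋₊, hfl d⟩ with hc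
  have hvc : ∑ d, |v d - pt c d| ≤ D * (m : ℝ)⁻¹ := by
    refine (sum_le_card_nsmul univ _ ((m : ℝ)⁻¹) fun d _ => ?_).trans (by simp)
    have h1 := Nat.floor_le (mul_nonneg hm0.le (hv d).1)
    have h2 := Nat.lt_floor_add_one ((m : ℝ) * v d)
    have h3 : v d - pt c d = (m * v d - ⌊m * v d⌋₊) * (m : ℝ)⁻¹ := by
      simp only [hpt, hc]; field_simp
    rw [h3, abs_of_nonneg (mul_nonneg (by linarith) (by positivity))]
    exact mul_le_of_le_one_left (by positivity) (by linarith)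
  have hmid : |f (pt c) - g.1 (pt c)| ≤ (m : ℝ)⁻¹ := by
    have h1 : ⌊m * g.1 (pt c)⌋₊ = ⌊m * f (pt c)⌋₊ := by
      have := congrArg (fun z => (z c : ℕ)) hqg
      simpa [hq] using this
    have a1 := Nat.floor_le (mul_nonneg hm0.le (h01 f hf _ (hcube c)).1)
    have a2 := Nat.lt_floor_add_one ((m : ℝ) * f (pt c))
    have b1 := Nat.floor_le (mul_nonneg hm0.le (h01 g.1 g.2 _ (hcube c)).1)
    have b2 := Nat.lt_floor_add_one ((m : ℝ) * g.1 (pt c))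
    rw [h1] at b1 b2
    have h3 : f (pt c) - g.1 (pt c) = (m * f (pt c) - m * g.1 (pt c)) * (m : ℝ)⁻¹ := by field_simp
    rw [h3, abs_mul, abs_of_pos (inv_pos.2 hm0)]
    refine mul_le_of_le_one_left (by positivity) (abs_le.2 ⟨?_, ?_⟩) <;> linarith
  have e1 := hL f hf v (pt c) hv (hcube c)
  have e2 := hL g.1 g.2 v (pt c) hv (hcube c)
  have e3 : K * ∑ d, |v d - pt c d| ≤ K * (D * (m : ℝ)⁻¹) := by gcongr
  have e4 : (2 * K * D + 1) * (m : ℝ)⁻¹ ≤ ε := by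
    rw [← div_eq_mul_inv, div_le_iff₀ hm0]; linarith
  have e5 : f v - g.1 v = (f v - f (pt c)) + (f (pt c) - g.1 (pt c)) - (g.1 v - g.1 (pt c)) := by ring
  rw [abs_le] at e1 e2 hmid ⊢
  constructor <;> linarith

lemma deviation_const_le {L : ℝ} (hL : 0 ≤ L) :
    166 / 100 + Real.sqrt (L / 2) ≤ 3 * Real.sqrt ((L + Real.log 2) / 2) := by
  have h1 := Real.log_two_gt_d9
  have h2 : 0 ≤ Real.sqrt (L / 2) := Real.sqrt_nonneg _
  have h3 := Real.sq_sqrt (show 0 ≤ L / 2 by positivity)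
  have h4 : (166 / 100 + Real.sqrt (L / 2)) / 3 ≤ Real.sqrt ((L + Real.log 2) / 2) := by
    refine Real.le_sqrt_of_sq_le ?_
    nlinarith [sq_nonneg (Real.sqrt (L / 2) - 166 / 800)]
  linarith

end GridTD

namespace GridTD

variable {X : Type*} [MeasurableSpace X] {𝒟 : Measure X} [IsProbabilityMeasure 𝒟]

/-- The gap between the mean of `l` and its empirical mean. -/
noncomputable def gap (𝒟 : Measure X) {n : ℕ} (l : X → ℝ) (ω : Fin n → X) : ℝ :=
  (∫ x, l x ∂𝒟) - 1 / (n : ℝ) * ∑ i, l (ω i)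

omit [IsProbabilityMeasure 𝒟] in
lemma bm_gap {n : ℕ} {l : X → ℝ} (hl : BM l) : BM (gap 𝒟 l : (Fin n → X) → ℝ) := by
  have h : BM fun ω : Fin n → X => ∑ i, l (ω i) := BM.sum univ fun i _ => by
    obtain ⟨hm, c, hc⟩ := hl
    exact ⟨hm.comp (measurable_pi_apply i), c, fun ω => hc _⟩
  have := (BM.const (X := Fin n → X) (∫ x, l x ∂𝒟)).add (h.smul (-(1 / (n : ℝ))))
  convert this using 2 with ω
  simp only [gap]; ring

omit [IsProbabilityMeasure 𝒟] in
lemma abs_gap_update_le {n : ℕ} {l : X → ℝ} (h0 : ∀ x, 0 ≤ l x) (h1 : ∀ x, l x ≤ 1)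
    (ω : Fin n → X) (i : Fin n) (a : X) :
    |gap 𝒟 l ω - gap 𝒟 l (Function.update ω i a)| ≤ (n : ℝ)⁻¹ := by
  have h : gap 𝒟 l ω - gap 𝒟 l (Function.update ω i a) = (n : ℝ)⁻¹ * (l a - l (ω i)) := by
    have h2 : ∑ k, l (Function.update ω i a k) = l a + ∑ k ∈ univ.erase i, l (ω k) := by
      rw [← add_sum_erase univ _ (mem_univ i), Function.update_self]
      congr 1
      exact sum_congr rfl fun k hk => by rw [Function.update_of_ne (ne_of_mem_erase hk)]
    rw [gap, gap, h2, ← add_sum_erase univ _ (mem_univ i), one_div]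
    ring
  rw [h, abs_mul, abs_of_nonneg (by positivity)]
  refine mul_le_of_le_one_right (by positivity) (abs_le.2 ⟨?_, ?_⟩) <;>
    linarith [h0 a, h1 a, h0 (ω i), h1 (ω i)]

lemma abs_gap_sub_le {n : ℕ} (hn : 0 < n) {l l' : X → ℝ} (hl : BM l) (hl' : BM l') {c : ℝ}
    (h : ∀ x, |l x - l' x| ≤ c) (ω : Fin n → X) : gap 𝒟 l ω ≤ gap 𝒟 l' ω + 2 * c := by
  have hn' : (0 : ℝ) < n := by exact_mod_cast hn
  have h1 : (∫ x, l x ∂𝒟) ≤ (∫ x, l' x ∂𝒟) + c := by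
    have : ∫ x, l' x + c ∂𝒟 = (∫ x, l' x ∂𝒟) + c := by
      rw [integral_add hl'.integrable (integrable_const _)]; simp
    rw [← this]
    exact integral_mono hl.integrable (hl'.add (BM.const c)).integrable fun x => by
      have := (abs_le.1 (h x)).2
      simp only; linarith
  have h2 : ∑ i, l' (ω i) ≤ (∑ i, l (ω i)) + n * c := by
    have : ∑ i, l' (ω i) ≤ ∑ i, (l (ω i) + c) := sum_le_sum fun i _ => by
      have := (abs_le.1 (h (ω i))).1
      linarith
    simpa [sum_add_distrib] using this
  have h3 : 1 / (n : ℝ) * ∑ i, l' (ω i) ≤ 1 / (n : ℝ) * ∑ i, l (ω i) + c := by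
    calc 1 / (n : ℝ) * ∑ i, l' (ω i) ≤ 1 / (n : ℝ) * ((∑ i, l (ω i)) + n * c) := by gcongr
      _ = _ := by field_simp
  unfold gap
  linarith

/-- Uniform deviations of finitely many losses exceed their mean bound by at most the bounded
difference term. -/
lemma measure_fmax_gap_le {n : ℕ} (hn : 0 < n) {J : Type} [Fintype J] [Nonempty J] {l : J → X → ℝ}
    (hl : ∀ j, BM (l j)) (h0 : ∀ j x, 0 ≤ l j x) (h1 : ∀ j x, l j x ≤ 1) {c : ℝ}
    (H : Dom (Measure.pi fun _ : Fin n => 𝒟) (fun j => empZ 𝒟 n (fun _ => 1) (l j)) c) {δ : ℝ}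
    (hδ : 0 < δ) (hδ1 : δ < 1) :
    (Measure.pi fun _ : Fin n => 𝒟).real {ω | c / Real.sqrt n +
      Real.sqrt (Real.log δ⁻¹ / (2 * n)) ≤ fmax fun j => gap 𝒟 (l j) ω} ≤ δ := by
  have hn' : (0 : ℝ) < n := by exact_mod_cast hn
  have hs : 0 < Real.sqrt n := Real.sqrt_pos.2 hn'
  have hY : BM fun ω : Fin n → X => fmax fun j => gap 𝒟 (l j) ω := BM.fmax fun j => bm_gap (hl j)
  have hlog : 0 < Real.log δ⁻¹ := Real.log_pos ((one_lt_inv₀ hδ).2 hδ1)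
  have hM := measureReal_boundedDiff_le (𝒟 := 𝒟) hn hY
    (fun ω i a => abs_fmax_sub_le fun j => abs_gap_update_le (h0 j) (h1 j) ω i a)
    (Real.sqrt_nonneg (Real.log δ⁻¹ / (2 * n)))
  have hmean : ∫ ω, (fmax fun j => gap 𝒟 (l j) ω) ∂(Measure.pi fun _ : Fin n => 𝒟) ≤
      c / Real.sqrt n := by
    obtain ⟨S, hS, hS1, hS2⟩ := H
    rw [le_div_iff₀ hs, ← integral_mul_const]
    refine (integral_mono (hY.integrable.mul_const _) hS fun ω => ?_).trans hS2
    obtain ⟨j, hj⟩ := exists_fmax fun j => gap 𝒟 (l j) ω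
    have := hS1 j ω
    simp only [empZ, one_mul] at this
    simp only
    rw [hj, gap, mul_comm, one_div]
    exact this
  refine (measureReal_mono (fun ω hω => ?_)).trans (hM.trans (le_of_eq ?_))
  · simp only [Set.mem_ofPred_eq] at hω ⊢
    linarith
  · rw [Real.sq_sqrt (by positivity), mul_div_cancel₀ _ (by positivity : (2 * n : ℝ) ≠ 0),
      Real.exp_neg, Real.exp_log (inv_pos.2 hδ), inv_inv]

end GridTD

namespace GridTD

section uniform
variable {X : Type*} [MeasurableSpace X] {𝒟 : Measure X} [IsProbabilityMeasure 𝒟]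

lemma abs_sq_loss_sub_le {a b y ε : ℝ} (ha : a ∈ Set.Icc (0 : ℝ) 1) (hb : b ∈ Set.Icc (0 : ℝ) 1)
    (hy : y ∈ Set.Icc (0 : ℝ) 1) (h : |a - b| ≤ ε) : |(a - y) ^ 2 - (b - y) ^ 2| ≤ 2 * ε := by
  have h1 : |a + b - 2 * y| ≤ 2 := abs_le.2
    ⟨by linarith [ha.1, hb.1, hy.2], by linarith [ha.2, hb.2, hy.1]⟩
  rw [show (a - y) ^ 2 - (b - y) ^ 2 = (a + b - 2 * y) * (a - b) by ring, abs_mul]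
  exact mul_le_mul h1 h (abs_nonneg _) zero_le_two

/-- Off an event of probability at most `δ`, the generalization gap is bounded simultaneously for
all GridTD models. -/
lemma exists_bad_event {n D N : ℕ} (hn : 0 < n) (hD : 1 ≤ D) (hN : 0 < N) {γ η δ : ℝ} (hγ : 0 < γ)
    (hη : 0 < η) (hδ : 0 < δ) (hδ1 : δ < 1) {v : X → Fin D → ℝ} (hm : Measurable v)
    (hv : ∀ x d, v x d ∈ Set.Ico (0 : ℝ) 1) {y : X → ℝ} (hy : Measurable y)
    (hy01 : ∀ x, y x ∈ Set.Icc (0 : ℝ) 1) :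
    ∃ B : Set (Fin n → X), MeasurableSet B ∧ (Measure.pi fun _ : Fin n => 𝒟).real B ≤ δ ∧
      ∀ ω ∉ B, ∀ f ∈ gridTDClass D γ η N, gap 𝒟 (fun x => (f (v x) - y x) ^ 2) ω ≤
        8 * γ * η * D * N / Real.sqrt n + 3 * Real.sqrt (Real.log (2 / δ) / (2 * n)) := by
  have hs : 0 < Real.sqrt n := Real.sqrt_pos.2 (by exact_mod_cast hn)
  have h01 : ∀ f ∈ gridTDClass D γ η N, ∀ v : Fin D → ℝ, (∀ d, v d ∈ Set.Ico (0 : ℝ) 1) →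
      f v ∈ Set.Icc (0 : ℝ) 1 := by
    rintro f ⟨_, _, _, _, _, _, _, _, _, -, -, -, -, -, -, -, h, -⟩
    exact h
  obtain ⟨J, hJ, g, hg, hnet⟩ := exists_net (K := 2 * γ * η * D * N) (by positivity)
    (show 0 < 3 / 100 / Real.sqrt n by positivity) (gridTDClass D γ η N) h01 (by
      rintro f ⟨_, _, _, _, _, _, _, _, _, -, -, -, -, -, -, -, -, h⟩
      exact h)
  obtain hJ0 | hJ0 := isEmpty_or_nonempty J
  · exact ⟨∅, MeasurableSet.empty, by simpa using hδ.le, fun ω _ f hf =>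
      hJ0.elim (hnet f hf).choose⟩
  obtain ⟨𝒲, κ, β₀, AR, AL, h𝒲, hκ, hβ₀, HR, HL, hc, hrep⟩ :=
    exists_regime (𝒟 := 𝒟) hn hD hN hγ hη hm hv
  have hloss : ∀ f ∈ gridTDClass D γ η N, BM fun x => (f (v x) - y x) ^ 2 := fun f hf => by
    have h1 : BM fun x => f (v x) + -1 * y x := ((hrep f hf).bm h𝒲).add
      (BM.smul ⟨hy, 1, fun x => abs_le.2 ⟨by linarith [(hy01 x).1], (hy01 x).2⟩⟩ _)
    convert h1.mul h1 using 2 with x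
    ring
  have hgb := fun j => hloss (g j) (hg j)
  have hH := (dom_loss hn h𝒲 HR HL hκ hβ₀ hy (fun x => (hy01 x).1) (fun x => (hy01 x).2)
    (f := fun j x => g j (v x)) (fun j => hrep (g j) (hg j))
    (fun j x => (h01 _ (hg j) _ (hv x)).1) fun j x => (h01 _ (hg j) _ (hv x)).2).mono_const
      (add_le_add le_rfl hc)
  refine ⟨_, measurableSet_le measurable_const (BM.fmax fun j => bm_gap (hgb j)).1,
    measure_fmax_gap_le hn hgb (fun j x => sq_nonneg _) (fun j x => ?_) hH hδ hδ1,
    fun ω hω f hf => ?_⟩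
  · have h1 := h01 _ (hg j) _ (hv x)
    refine (sq_le_one_iff_abs_le_one _).2 (abs_le.2 ⟨?_, ?_⟩) <;>
      linarith [h1.1, h1.2, (hy01 x).1, (hy01 x).2]
  obtain ⟨j, hj⟩ := hnet f hf
  have h1 := abs_gap_sub_le (𝒟 := 𝒟) hn (hloss f hf) (hgb j) (fun x => abs_sq_loss_sub_le
    (h01 f hf _ (hv x)) (h01 _ (hg j) _ (hv x)) (hy01 x) (hj _ (hv x))) ω
  have h2 := le_fmax (fun j => gap 𝒟 (fun x => (g j (v x) - y x) ^ 2) ω) j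
  rw [Set.mem_ofPred_eq, not_le] at hω
  have hL : 0 < Real.log δ⁻¹ := Real.log_pos ((one_lt_inv₀ hδ).2 hδ1)
  have h4 := div_le_div_of_nonneg_right (deviation_const_le hL.le) hs.le
  have h5 : ∀ z : ℝ, Real.sqrt (z / (2 * n)) = Real.sqrt (z / 2) / Real.sqrt n := fun z => by
    rw [← div_div, Real.sqrt_div' _ (Nat.cast_nonneg n)]
  have h6 : Real.log (2 / δ) = Real.log δ⁻¹ + Real.log 2 := by
    rw [div_eq_mul_inv, Real.log_mul two_ne_zero (inv_pos.2 hδ).ne', add_comm]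
  rw [h5] at hω ⊢
  rw [h6]
  simp only [div_eq_mul_inv] at h1 hω h4 ⊢
  linarith

end uniform

end GridTD

/-- **Generalization error bound for GridTD via Lipschitz smoothness.** With probability
at least `1 − δ` over an i.i.d. sample of size `n` from `𝒟`, every GridTD model `f`
in the class satisfies
`𝔼(f(x)−y)² − (1/n)Σᵢ(f(xᵢ)−yᵢ)² ≤ 8γηDN/√n + 3√(log(2/δ)/(2n))`. -/
theorem gridTD_generalization_bound
    (D : ℕ) (hD : 1 ≤ D) (γ η : ℝ) (Nsum : ℕ)
    (hγ : 0 < γ) (hη : 0 < η) (hNsum : 0 < Nsum)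
    (𝒟 : Measure ((Fin D → ℝ) × ℝ)) [IsProbabilityMeasure 𝒟]
    (h𝒟 : ∀ᵐ p ∂𝒟, (∀ d, p.1 d ∈ Set.Ico (0:ℝ) 1) ∧ p.2 ∈ Set.Icc (0:ℝ) 1)
    (n : ℕ) (hn : 0 < n) (δ : ℝ) (hδ : 0 < δ) (hδ1 : δ < 1) :
    ENNReal.ofReal (1 - δ) ≤
      Measure.pi (fun _ : Fin n => 𝒟)
        {s : Fin n → (Fin D → ℝ) × ℝ | ∀ f ∈ gridTDClass D γ η Nsum,
          (∫ p, (f p.1 - p.2) ^ 2 ∂𝒟) - (1 / (n : ℝ)) * ∑ i, (f (s i).1 - (s i).2) ^ 2 ≤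
            8 * γ * η * D * Nsum / Real.sqrt n +
              3 * Real.sqrt (Real.log (2 / δ) / (2 * n))} := by
  classical
  set v : (Fin D → ℝ) × ℝ → Fin D → ℝ := fun p d => (Set.Ico (0 : ℝ) 1).indicator id (p.1 d) with hv
  set y : (Fin D → ℝ) × ℝ → ℝ := fun p => (Set.Icc (0 : ℝ) 1).indicator id p.2 with hy
  have hvm : Measurable v := measurable_pi_iff.2 fun d =>
    (measurable_id.indicator measurableSet_Ico).comp ((measurable_pi_apply d).comp measurable_fst)
  have hym : Measurable y := (measurable_id.indicator measurableSet_Icc).comp measurable_snd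
  have hv01 : ∀ p d, v p d ∈ Set.Ico (0 : ℝ) 1 := fun p d => by
    simp only [hv, Set.indicator_apply]
    split_ifs with h
    exacts [h, ⟨le_rfl, one_pos⟩]
  have hy01 : ∀ p, y p ∈ Set.Icc (0 : ℝ) 1 := fun p => by
    simp only [hy, Set.indicator_apply]
    split_ifs with h
    exacts [h, ⟨le_rfl, zero_le_one⟩]
  have hae : ∀ᵐ p ∂𝒟, v p = p.1 ∧ y p = p.2 := h𝒟.mono fun p hp =>
    ⟨funext fun d => Set.indicator_of_mem (hp.1 d) _, Set.indicator_of_mem hp.2 _⟩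
  obtain ⟨B, hB, hBδ, hgap⟩ :=
    GridTD.exists_bad_event (𝒟 := 𝒟) hn hD hNsum hγ hη hδ hδ1 hvm hv01 hym hy01
  have hsample : ∀ᵐ s ∂(Measure.pi fun _ : Fin n => 𝒟), ∀ i, v (s i) = (s i).1 ∧ y (s i) = (s i).2 :=
    Filter.eventually_all.2 fun i =>
      (Measure.tendsto_eval_ae_ae (μ := fun _ : Fin n => 𝒟)).eventually hae
  calc ENNReal.ofReal (1 - δ) ≤ ENNReal.ofReal ((Measure.pi fun _ : Fin n => 𝒟).real Bᶜ) := by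
        rw [probReal_compl_eq_one_sub hB]
        gcongr
    _ = Measure.pi (fun _ : Fin n => 𝒟) Bᶜ := ofReal_measureReal
    _ ≤ _ := measure_mono_ae (hsample.mono fun s hs hsB f hf => ?_)
  have h1 := hgap s hsB f hf
  have h2 : ∫ p, (f (v p) - y p) ^ 2 ∂𝒟 = ∫ p, (f p.1 - p.2) ^ 2 ∂𝒟 :=
    integral_congr_ae (hae.mono fun p hp => by simp only [hp.1, hp.2])
  simpa only [GridTD.gap, h2, fun i => (hs i).1, fun i => (hs i).2] using h1
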